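/- For every integer t ≥ 1 there exists an integer k = k(t) with the following property: if G ∈ C_t and x, y are distinct non-adjacent vertices of G such that N(x) ∩ Hub(G) = ∅, then there do not exist k pairwise internally vertex-disjoint induced paths in G from x to y. -/

import Mathlib

open Set

/-- `f` enumerates an induced path on `n` vertices in `G`. -/
def IsPathEmb {α : Type} (G : SimpleGraph α) (n : ℕ) (f : Fin n → α) : Prop :=
  Function.Injective f ∧
    ∀ i j : Fin n, G.Adj (f i) (f j) ↔ (i.val = j.val + 1 ∨ j.val = i.val + 1)

/-- `f` enumerates an induced path from `a` to `b`. -/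
def IsPathFromTo {α : Type} (G : SimpleGraph α) (n : ℕ) (f : Fin n → α) (a b : α) : Prop :=
  IsPathEmb G n f ∧ ∃ h : 1 ≤ n, f ⟨0, h⟩ = a ∧ f ⟨n - 1, by omega⟩ = b

/-- The interior (internal vertices) of the path enumerated by `f`. -/
def pathInterior {α : Type} (n : ℕ) (f : Fin n → α) : Set α :=
  {v | ∃ j : Fin n, 0 < j.val ∧ j.val < n - 1 ∧ f j = v}

/-- `k` pairwise internally vertex-disjoint induced paths from `a` to `b` in `G`. -/
def KDisjointPaths {α : Type} (G : SimpleGraph α) (k : ℕ) (a b : α) : Prop :=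
  ∃ (n : Fin k → ℕ) (f : ∀ i, Fin (n i) → α),
    (∀ i, IsPathFromTo G (n i) (f i) a b) ∧
    (∀ i j, i ≠ j → Disjoint (pathInterior (n i) (f i)) (pathInterior (n j) (f j)))

/-- `f` enumerates an induced cycle on `n` vertices. -/
def IsHoleEmb {α : Type} (G : SimpleGraph α) (n : ℕ) (f : ZMod n → α) : Prop :=
  Function.Injective f ∧ ∀ i j : ZMod n, G.Adj (f i) (f j) ↔ (i = j + 1 ∨ j = i + 1)

/-- `H` is the vertex set of a hole of `G` (an induced cycle with at least 4 vertices). -/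
def IsHole {α : Type} (G : SimpleGraph α) (H : Set α) : Prop :=
  ∃ (n : ℕ) (f : ZMod n → α), 4 ≤ n ∧ IsHoleEmb G n f ∧ Set.range f = H

/-- `G` has no even hole. -/
def EvenHoleFree {α : Type} (G : SimpleGraph α) : Prop :=
  ∀ H : Set α, IsHole G H → ¬ Even H.ncard

def Anticomplete {α : Type} (G : SimpleGraph α) (A B : Set α) : Prop :=
  ∀ a ∈ A, ∀ b ∈ B, ¬ G.Adj a b

/-- `X` is a stable (independent) set of `G`. -/
def StableSet {α : Type} (G : SimpleGraph α) (X : Set α) : Prop :=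
  ∀ a ∈ X, ∀ b ∈ X, a ≠ b → ¬ G.Adj a b

/-- The open neighborhood of the set `A`. -/
def setNbhd {α : Type} (G : SimpleGraph α) (A : Set α) : Set α :=
  {v | v ∉ A ∧ ∃ a ∈ A, G.Adj v a}

/-- The set `A` induces a connected (nonempty) subgraph of `G`. -/
def ConnSet {α : Type} (G : SimpleGraph α) (A : Set α) : Prop :=
  (G.induce A).Connected

/-- `D` is a connected component of the subgraph of `G` induced by `S`. -/
def IsCompOf {α : Type} (G : SimpleGraph α) (S D : Set α) : Prop :=
  D ⊆ S ∧ ConnSet G D ∧ ∀ D', D ⊆ D' → D' ⊆ S → ConnSet G D' → D' = D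

/-- `G` contains an (induced) theta. -/
def HasTheta {α : Type} (G : SimpleGraph α) : Prop :=
  ∃ (a b : α) (n : Fin 3 → ℕ) (f : ∀ i, Fin (n i) → α),
    a ≠ b ∧ ¬ G.Adj a b ∧ (∀ i, 3 ≤ n i) ∧
    (∀ i, IsPathFromTo G (n i) (f i) a b) ∧
    (∀ i j : Fin 3, i ≠ j → ∀ (u : Fin (n i)) (v : Fin (n j)),
      0 < u.val → u.val < n i - 1 → 0 < v.val → v.val < n j - 1 →
      f i u ≠ f j v ∧ ¬ G.Adj (f i u) (f j v))

/-- `G` contains an (induced) prism. -/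
def HasPrism {α : Type} (G : SimpleGraph α) : Prop :=
  ∃ (n : Fin 3 → ℕ) (f : ∀ i, Fin (n i) → α),
    (∀ i, 2 ≤ n i) ∧ (∀ i, IsPathEmb G (n i) (f i)) ∧
    (∀ i j : Fin 3, i ≠ j → ∀ u v, f i u ≠ f j v) ∧
    (∀ i j : Fin 3, i ≠ j → ∀ (u : Fin (n i)) (v : Fin (n j)),
      G.Adj (f i u) (f j v) ↔
        ((u.val = 0 ∧ v.val = 0) ∨ (u.val = n i - 1 ∧ v.val = n j - 1)))

/-- The neighbors of `x` in the hole `H`. -/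
def holeNbrs {α : Type} (G : SimpleGraph α) (H : Set α) (x : α) : Set α :=
  {v ∈ H | G.Adj x v}

def IsWheel {α : Type} (G : SimpleGraph α) (H : Set α) (x : α) : Prop :=
  IsHole G H ∧ x ∉ H ∧ 3 ≤ (holeNbrs G H x).ncard

def IsTwinWheel {α : Type} (G : SimpleGraph α) (H : Set α) (x : α) : Prop :=
  IsWheel G H x ∧ ∃ p q r : α, p ≠ q ∧ q ≠ r ∧ p ≠ r ∧
    holeNbrs G H x = {p, q, r} ∧ G.Adj p q ∧ G.Adj q r ∧ ¬ G.Adj p r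

def IsShortPyramid {α : Type} (G : SimpleGraph α) (H : Set α) (x : α) : Prop :=
  IsWheel G H x ∧ ∃ p q r : α, p ≠ q ∧ q ≠ r ∧ p ≠ r ∧
    holeNbrs G H x = {p, q, r} ∧ G.Adj p q ∧ ¬ G.Adj q r ∧ ¬ G.Adj p r

def IsProperWheel {α : Type} (G : SimpleGraph α) (H : Set α) (x : α) : Prop :=
  IsWheel G H x ∧ ¬ IsTwinWheel G H x ∧ ¬ IsShortPyramid G H x

/-- `x` is a hub of the induced subgraph `G[W]`. -/
def IsHubIn {α : Type} (G : SimpleGraph α) (W : Set α) (x : α) : Prop :=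
  x ∈ W ∧ ∃ H : Set α, H ⊆ W ∧ IsProperWheel G H x

/-- `x` is a hub of `G`: the center of some proper wheel. -/
def IsHub {α : Type} (G : SimpleGraph α) (x : α) : Prop :=
  ∃ H : Set α, IsProperWheel G H x

/-- membership in the class `𝒞` of (C₄, theta, prism, even wheel)-free graphs. -/
def MemC {α : Type} (G : SimpleGraph α) : Prop :=
  (∀ H : Set α, IsHole G H → H.ncard ≠ 4) ∧ ¬ HasTheta G ∧ ¬ HasPrism G ∧
    (∀ (H : Set α) (x : α), IsWheel G H x → ¬ Even (holeNbrs G H x).ncard)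

/-- membership in the class `𝒞ₜ`: graphs in `𝒞` with no clique of size `t`. -/
def MemCt {α : Type} (t : ℕ) (G : SimpleGraph α) : Prop :=
  MemC G ∧ G.CliqueFree t

/-- `G` contains a generalized `k`-pyramid as an induced subgraph. -/
def ContainsGenPyramid {α : Type} (G : SimpleGraph α) (k : ℕ) : Prop :=
  ∃ (nP nQ : ℕ) (P : Fin nP → α) (Q : Fin nQ → α)
    (m : Fin k → ℕ) (R : ∀ i, Fin (m i) → α) (xI zI : Fin k → ℕ),
    4 ≤ nP + nQ ∧ 1 ≤ nP ∧ 1 ≤ nQ ∧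
    IsPathEmb G nP P ∧ IsPathEmb G nQ Q ∧
    (∀ i j, P i ≠ Q j) ∧
    (∀ (i : Fin nP) (j : Fin nQ), G.Adj (P i) (Q j) ↔
      ((i.val = 0 ∧ j.val = 0) ∨ (i.val = nP - 1 ∧ j.val = nQ - 1))) ∧
    (∀ i, 1 ≤ m i) ∧ (∀ i, IsPathEmb G (m i) (R i)) ∧
    (∀ i u j, R i u ≠ P j) ∧ (∀ i u j, R i u ≠ Q j) ∧
    (∀ i i', i ≠ i' → ∀ u u', R i u ≠ R i' u' ∧ ¬ G.Adj (R i u) (R i' u')) ∧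
    (∀ i, 0 < xI i ∧ xI i + 1 < nP - 1) ∧
    (∀ (i : Fin k) (u : Fin (m i)) (j : Fin nP), G.Adj (R i u) (P j) ↔
      (u.val = 0 ∧ (j.val = xI i ∨ j.val = xI i + 1))) ∧
    (∀ i, zI i < nQ) ∧
    (∀ (i : Fin k) (u : Fin (m i)) (j : Fin nQ), G.Adj (R i u) (Q j) ↔
      (u.val = m i - 1 ∧ j.val = zI i)) ∧
    (∀ i i' : Fin k, i < i' → xI i + 1 < xI i') ∧
    (∀ i i' : Fin k, i ≤ i' → zI i ≤ zI i')

/-- membership in the class `𝒞ₜₜ`: graphs in `𝒞ₜ` with no induced generalized `t`-pyramid. -/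
def MemCtt {α : Type} (t : ℕ) (G : SimpleGraph α) : Prop :=
  MemCt t G ∧ ¬ ContainsGenPyramid G t

/-- `(T, χ)` is a tree decomposition of `G`. -/
structure IsTD {α ι : Type} (G : SimpleGraph α) (T : SimpleGraph ι) (χ : ι → Set α) : Prop where
  finite : Finite ι
  isTree : T.IsTree
  memBag : ∀ v : α, ∃ t, v ∈ χ t
  edgeBag : ∀ ⦃u v : α⦄, G.Adj u v → ∃ t, u ∈ χ t ∧ v ∈ χ t
  subtree : ∀ v : α, (T.induce {t | v ∈ χ t}).Connected

/-- `G` has a tree decomposition of width at most `w`. -/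
def TwLE {α : Type} (G : SimpleGraph α) (w : ℕ) : Prop :=
  ∃ (ι : Type) (T : SimpleGraph ι) (χ : ι → Set α),
    IsTD G T χ ∧ ∀ t, (χ t).ncard ≤ w + 1

/-- The treewidth of `G`. -/
noncomputable def treeWidth {α : Type} (G : SimpleGraph α) : ℕ :=
  sInf {w | TwLE G w}

/-- For adjacent `t, t'` in a tree `T`, the vertex set of the component of `T - t`
containing `t'`. -/
def branchSet {ι : Type} (T : SimpleGraph ι) (t t' : ι) : Set ι :=
  {s | ∀ w : T.Walk s t, t' ∈ w.support}

/-- The vertex set of `G_{t → t'}`: the union of the bags over the component of `T - t`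
containing `t'`. -/
def sideSet {α ι : Type} (T : SimpleGraph ι) (χ : ι → Set α) (t t' : ι) : Set α :=
  ⋃ s ∈ branchSet T t t', χ s

/-- `(T, χ)` is a tight tree decomposition of `G`. -/
def TightTD {α ι : Type} (G : SimpleGraph α) (T : SimpleGraph ι) (χ : ι → Set α) : Prop :=
  IsTD G T χ ∧ ∀ ⦃t t' : ι⦄, T.Adj t t' →
    ∃ D, IsCompOf G (sideSet T χ t t' \ χ t) D ∧ setNbhd G D = χ t ∩ χ t'

/-- `G` admits a clique cutset. -/
def HasCliqueCutset {α : Type} (G : SimpleGraph α) : Prop :=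
  ∃ C : Set α, G.IsClique C ∧ ¬ (G.induce (Set.univ \ C)).Preconnected

/-- `G` is chordal: it has no hole. -/
def ChordalG {α : Type} (G : SimpleGraph α) : Prop := ∀ H : Set α, ¬ IsHole G H

/-- `G'` is a minimal chordal completion of `G`. -/
def IsMinChordalCompletion {α : Type} (G G' : SimpleGraph α) : Prop :=
  G ≤ G' ∧ ChordalG G' ∧ ∀ G'', G ≤ G'' → G'' ≤ G' → ChordalG G'' → G'' = G'

/-- `Ω` is a potential maximal clique of `G` : a maximal clique of some minimal chordal
completion of `G`. -/
def IsPMC {α : Type} (G : SimpleGraph α) (Ω : Set α) : Prop :=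
  ∃ G' : SimpleGraph α, IsMinChordalCompletion G G' ∧ G'.IsClique Ω ∧
    ∀ Ω' : Set α, G'.IsClique Ω' → Ω ⊆ Ω' → Ω' = Ω

/-- `(T, χ)` is a structured tree decomposition: every bag is a PMC of `G`. -/
def StructuredTD {α ι : Type} (G : SimpleGraph α) (T : SimpleGraph ι) (χ : ι → Set α) : Prop :=
  IsTD G T χ ∧ ∀ t, IsPMC G (χ t)

/-- the decomposition has adhesion less than `m`. -/
def AdhLT {α ι : Type} (T : SimpleGraph ι) (χ : ι → Set α) (m : ℕ) : Prop :=
  ∀ ⦃t t' : ι⦄, T.Adj t t' → (χ t ∩ χ t').ncard < m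

/-- `fatness χ i` is the number of bags of size `i`. -/
noncomputable def fatness {α ι : Type} (χ : ι → Set α) (i : ℕ) : ℕ :=
  {t : ι | (χ t).ncard = i}.ncard

/-- Lexicographic comparison of fatness vectors `(aₙ, …, a₀)` (larger sizes more
significant). -/
def FatLexLE (f g : ℕ → ℕ) : Prop :=
  (∀ i, f i = g i) ∨ ∃ j, f j < g j ∧ ∀ i, j < i → f i = g i

/-- `(T, χ)` is an `m`-atomic tree decomposition of `G`: its adhesion is less than `m` and its
fatness is lexicographically minimum among all tree decompositions with adhesion less than `m`. -/
def IsAtomicTD {α ι : Type} (m : ℕ) (G : SimpleGraph α) (T : SimpleGraph ι)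
    (χ : ι → Set α) : Prop :=
  IsTD G T χ ∧ AdhLT T χ m ∧
    ∀ (ι' : Type) (T' : SimpleGraph ι') (χ' : ι' → Set α),
      IsTD G T' χ' → AdhLT T' χ' m → FatLexLE (fatness χ) (fatness χ')

/-- Adjacency in the torso at the node `x` of the tree decomposition. -/
def torsoAdj {α ι : Type} (G : SimpleGraph α) (T : SimpleGraph ι) (χ : ι → Set α)
    (x : ι) (u v : α) : Prop :=
  u ∈ χ x ∧ v ∈ χ x ∧ u ≠ v ∧
    (G.Adj u v ∨ ∃ y, T.Adj x y ∧ u ∈ χ y ∧ v ∈ χ y)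

/-- The degree of `u` in the torso at `x`. -/
noncomputable def torsoDeg {α ι : Type} (G : SimpleGraph α) (T : SimpleGraph ι)
    (χ : ι → Set α) (x : ι) (u : α) : ℕ :=
  {v | torsoAdj G T χ x u v}.ncard

/-- `u` and `v` lie in the same component of `G[S]`. -/
def SameComp {α : Type} (G : SimpleGraph α) (S : Set α) (u v : α) : Prop :=
  ∃ (hu : u ∈ S) (hv : v ∈ S), (G.induce S).Reachable ⟨u, hu⟩ ⟨v, hv⟩

/-- `X` is a minimal separator of `G`. -/
def IsMinimalSeparator {α : Type} (G : SimpleGraph α) (X : Set α) : Prop :=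
  ∃ u v : α, u ∉ X ∧ v ∉ X ∧ ¬ SameComp G (Set.univ \ X) u v ∧
    ∀ Y : Set α, Y ⊂ X → SameComp G (Set.univ \ Y) u v
/-- The degree of `v` in `H` (as the cardinality of its neighbor set). -/
noncomputable def degreeSet {α : Type} (H : SimpleGraph α) (v : α) : ℕ :=
  (H.neighborSet v).ncard

/-- `H` is a path (as a graph). -/
def IsPathGraph {α : Type} (H : SimpleGraph α) : Prop :=
  ∃ (n : ℕ) (f : Fin n → α), Function.Bijective f ∧
    ∀ i j, H.Adj (f i) (f j) ↔ (i.val = j.val + 1 ∨ j.val = i.val + 1)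

/-- `H` is a caterpillar: a tree of maximum degree three having a path containing all
branch vertices. -/
def IsCaterpillar {α : Type} (H : SimpleGraph α) : Prop :=
  H.IsTree ∧ (∀ v, degreeSet H v ≤ 3) ∧
    ∃ (n : ℕ) (f : Fin n → α), IsPathEmb H n f ∧
      ∀ v, 2 < degreeSet H v → v ∈ Set.range f

/-- `H` is a subdivided star: a tree with exactly one branch vertex (its root), of degree
at least 3. -/
def IsSubdividedStar {α : Type} (H : SimpleGraph α) : Prop :=
  H.IsTree ∧ ∃! r, 2 < degreeSet H r

/-- `H` is (isomorphic to) the line graph of a caterpillar. -/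
def IsLineGraphOfCaterpillar {α : Type} (H : SimpleGraph α) : Prop :=
  ∃ (β : Type) (C : SimpleGraph β), IsCaterpillar C ∧
    Nonempty (SimpleGraph.Iso H C.lineGraph)

/-- `w` is a simplicial vertex of the induced subgraph `G[W]`. -/
def SimplicialIn {α : Type} (G : SimpleGraph α) (W : Set α) (w : α) : Prop :=
  w ∈ W ∧ G.IsClique {u | u ∈ W ∧ G.Adj w u}

/-- `(p, x)` is an alignment: `p` enumerates an induced path, `x` enumerates the set `X`
in the order given by the alignment. -/
structure IsAlignment {α : Type} (G : SimpleGraph α) (n : ℕ) (p : Fin n → α)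
    (k : ℕ) (x : Fin k → α) : Prop where
  hn : 1 ≤ n
  hk : 2 ≤ k
  path : IsPathEmb G n p
  injx : Function.Injective x
  disj : ∀ i j, x i ≠ p j
  cover : ∀ i, ∃ j, G.Adj (x i) (p j)
  first : ∀ j : Fin n, G.Adj (x ⟨0, by omega⟩) (p j) ↔ j.val = 0
  last : ∀ j : Fin n, G.Adj (x ⟨k - 1, by omega⟩) (p j) ↔ j.val = n - 1
  ordered : ∀ (i i' : Fin k) (j j' : Fin n),
    i < i' → G.Adj (x i) (p j) → G.Adj (x i') (p j') → j < j'

/-- A wide alignment: every middle vertex of `X` has two non-adjacent neighbors in `P`. -/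
def IsWideAlignment {α : Type} (G : SimpleGraph α) (n : ℕ) (p : Fin n → α)
    (k : ℕ) (x : Fin k → α) : Prop :=
  IsAlignment G n p k x ∧ ∀ i : Fin k, 0 < i.val → i.val < k - 1 →
    ∃ j j' : Fin n, j.val + 1 < j'.val ∧ G.Adj (x i) (p j) ∧ G.Adj (x i) (p j')

/-- A spiky alignment: every middle vertex of `X` has a unique neighbor in `P`. -/
def IsSpikyAlignment {α : Type} (G : SimpleGraph α) (n : ℕ) (p : Fin n → α)
    (k : ℕ) (x : Fin k → α) : Prop :=
  IsAlignment G n p k x ∧ ∀ i : Fin k, 0 < i.val → i.val < k - 1 →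
    ∃! j : Fin n, G.Adj (x i) (p j)

/-- A triangular alignment: every middle vertex of `X` has exactly two neighbors in `P`,
and they are adjacent. -/
def IsTriangularAlignment {α : Type} (G : SimpleGraph α) (n : ℕ) (p : Fin n → α)
    (k : ℕ) (x : Fin k → α) : Prop :=
  IsAlignment G n p k x ∧ ∀ i : Fin k, 0 < i.val → i.val < k - 1 →
    ∃ j : Fin n, j.val + 1 < n ∧
      ∀ j' : Fin n, G.Adj (x i) (p j') ↔ (j'.val = j.val ∨ j'.val = j.val + 1)

/-- `(H, x)` is a spiky connectifier: `H` is an induced caterpillar with spine `p` and legs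
`ℓ`, and `x` enumerates `X` in the order given by the connectifier (`x 0` and `x (k-1)`
attached at the ends of the spine, the others to the tips of the legs, in the order in which
the legs attach along the spine). -/
def IsSpikyConnectifier {α : Type} (G : SimpleGraph α) (H : Set α)
    (k : ℕ) (x : Fin k → α) : Prop :=
  ∃ (hk : 2 ≤ k) (n : ℕ) (_ : 2 ≤ n) (p : Fin n → α)
    (m : Fin (k - 2) → ℕ) (ℓ : ∀ i, Fin (m i) → α) (a : Fin (k - 2) → ℕ),
    IsPathEmb G n p ∧ (∀ i, 1 ≤ m i) ∧ (∀ i, IsPathEmb G (m i) (ℓ i)) ∧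
    H = Set.range p ∪ ⋃ i, Set.range (ℓ i) ∧
    Function.Injective x ∧ (∀ i, x i ∉ H) ∧
    (∀ i j j', ℓ i j ≠ p j') ∧
    (∀ i i', i ≠ i' → ∀ j j', ℓ i j ≠ ℓ i' j' ∧ ¬ G.Adj (ℓ i j) (ℓ i' j')) ∧
    (∀ i, 0 < a i ∧ a i < n - 1) ∧
    (∀ i i', i < i' → a i < a i') ∧
    (∀ (i : Fin (k - 2)) (j : Fin (m i)) (j' : Fin n),
      G.Adj (ℓ i j) (p j') ↔ (j.val = 0 ∧ j'.val = a i)) ∧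
    (∀ j : Fin n, G.Adj (x ⟨0, by omega⟩) (p j) ↔ j.val = 0) ∧
    (∀ (i : Fin (k - 2)) (j : Fin (m i)), ¬ G.Adj (x ⟨0, by omega⟩) (ℓ i j)) ∧
    (∀ j : Fin n, G.Adj (x ⟨k - 1, by omega⟩) (p j) ↔ j.val = n - 1) ∧
    (∀ (i : Fin (k - 2)) (j : Fin (m i)), ¬ G.Adj (x ⟨k - 1, by omega⟩) (ℓ i j)) ∧
    (∀ (i : Fin (k - 2)) (j : Fin n),
      ¬ G.Adj (x ⟨i.val + 1, by have := i.isLt; omega⟩) (p j)) ∧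
    (∀ (i i' : Fin (k - 2)) (j : Fin (m i')),
      G.Adj (x ⟨i.val + 1, by have := i.isLt; omega⟩) (ℓ i' j) ↔ (i' = i ∧ j.val = m i' - 1))

/-- `(H, x)` is a triangular connectifier: `H` is the line graph of a caterpillar, with
spine `p` and legs `ℓ` attached along triangles, and `x` enumerates `X` in the order given
by the connectifier. -/
def IsTriangularConnectifier {α : Type} (G : SimpleGraph α) (H : Set α)
    (k : ℕ) (x : Fin k → α) : Prop :=
  ∃ (hk : 2 ≤ k) (n : ℕ) (_ : 2 ≤ n) (p : Fin n → α)
    (m : Fin (k - 2) → ℕ) (ℓ : ∀ i, Fin (m i) → α) (a : Fin (k - 2) → ℕ),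
    IsPathEmb G n p ∧ (∀ i, 1 ≤ m i) ∧ (∀ i, IsPathEmb G (m i) (ℓ i)) ∧
    H = Set.range p ∪ ⋃ i, Set.range (ℓ i) ∧
    Function.Injective x ∧ (∀ i, x i ∉ H) ∧
    (∀ i j j', ℓ i j ≠ p j') ∧
    (∀ i i', i ≠ i' → ∀ j j', ℓ i j ≠ ℓ i' j' ∧ ¬ G.Adj (ℓ i j) (ℓ i' j')) ∧
    (∀ i, a i + 1 ≤ n - 1) ∧
    (∀ i i', i < i' → a i < a i') ∧
    (∀ (i : Fin (k - 2)) (j : Fin (m i)) (j' : Fin n),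
      G.Adj (ℓ i j) (p j') ↔ (j.val = 0 ∧ (j'.val = a i ∨ j'.val = a i + 1))) ∧
    (∀ j : Fin n, G.Adj (x ⟨0, by omega⟩) (p j) ↔ j.val = 0) ∧
    (∀ (i : Fin (k - 2)) (j : Fin (m i)), ¬ G.Adj (x ⟨0, by omega⟩) (ℓ i j)) ∧
    (∀ j : Fin n, G.Adj (x ⟨k - 1, by omega⟩) (p j) ↔ j.val = n - 1) ∧
    (∀ (i : Fin (k - 2)) (j : Fin (m i)), ¬ G.Adj (x ⟨k - 1, by omega⟩) (ℓ i j)) ∧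
    (∀ (i : Fin (k - 2)) (j : Fin n),
      ¬ G.Adj (x ⟨i.val + 1, by have := i.isLt; omega⟩) (p j)) ∧
    (∀ (i i' : Fin (k - 2)) (j : Fin (m i')),
      G.Adj (x ⟨i.val + 1, by have := i.isLt; omega⟩) (ℓ i' j) ↔ (i' = i ∧ j.val = m i' - 1))

/-- `(H, x)` is a stellar connectifier: `H` is an induced subdivided star with root `r` and
legs `ℓ`, and the vertices of `X` are attached to the tips of the legs. -/
def IsStellarConnectifier {α : Type} (G : SimpleGraph α) (H : Set α)
    (k : ℕ) (x : Fin k → α) : Prop :=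
  ∃ (_ : 3 ≤ k) (r : α) (m : Fin k → ℕ) (ℓ : ∀ i, Fin (m i) → α),
    (∀ i, 1 ≤ m i) ∧ (∀ i, IsPathEmb G (m i) (ℓ i)) ∧
    H = {r} ∪ ⋃ i, Set.range (ℓ i) ∧
    Function.Injective x ∧ (∀ i, x i ∉ H) ∧
    (∀ i j, ℓ i j ≠ r) ∧
    (∀ i i', i ≠ i' → ∀ j j', ℓ i j ≠ ℓ i' j' ∧ ¬ G.Adj (ℓ i j) (ℓ i' j')) ∧
    (∀ (i : Fin k) (j : Fin (m i)), G.Adj r (ℓ i j) ↔ j.val = 0) ∧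
    (∀ i, ¬ G.Adj (x i) r) ∧
    (∀ (i i' : Fin k) (j : Fin (m i')),
      G.Adj (x i) (ℓ i' j) ↔ (i' = i ∧ j.val = m i' - 1))

/-- `(H, X)` is a wide alignment (set version). -/
def IsWideAlignSet {α : Type} (G : SimpleGraph α) (H X : Set α) : Prop :=
  ∃ (n k : ℕ) (p : Fin n → α) (e : Fin k → α),
    H = Set.range p ∧ X = Set.range e ∧ IsWideAlignment G n p k e

/-- `(H, X)` is a spiky alignment (set version). -/
def IsSpikyAlignSet {α : Type} (G : SimpleGraph α) (H X : Set α) : Prop :=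
  ∃ (n k : ℕ) (p : Fin n → α) (e : Fin k → α),
    H = Set.range p ∧ X = Set.range e ∧ IsSpikyAlignment G n p k e

/-- `(H, X)` is a triangular alignment (set version). -/
def IsTriAlignSet {α : Type} (G : SimpleGraph α) (H X : Set α) : Prop :=
  ∃ (n k : ℕ) (p : Fin n → α) (e : Fin k → α),
    H = Set.range p ∧ X = Set.range e ∧ IsTriangularAlignment G n p k e

/-- `(H, X)` is a spiky connectifier (set version). -/
def IsSpikyConnSet {α : Type} (G : SimpleGraph α) (H X : Set α) : Prop :=
  ∃ (k : ℕ) (e : Fin k → α), X = Set.range e ∧ IsSpikyConnectifier G H k e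

/-- `(H, X)` is a triangular connectifier (set version). -/
def IsTriConnSet {α : Type} (G : SimpleGraph α) (H X : Set α) : Prop :=
  ∃ (k : ℕ) (e : Fin k → α), X = Set.range e ∧ IsTriangularConnectifier G H k e

/-- `(H, X)` is a stellar connectifier (set version). -/
def IsStellarConnSet {α : Type} (G : SimpleGraph α) (H X : Set α) : Prop :=
  ∃ (k : ℕ) (e : Fin k → α), X = Set.range e ∧ IsStellarConnectifier G H k e

/-- `(H, X)` (with order `e` on `X`) is a consistent alignment or consistent connectifier. -/
def IsConsistentWith {α : Type} (G : SimpleGraph α) (H : Set α)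
    (k : ℕ) (e : Fin k → α) : Prop :=
  (∃ (n : ℕ) (p : Fin n → α), H = Set.range p ∧
    (IsWideAlignment G n p k e ∨ IsSpikyAlignment G n p k e ∨ IsTriangularAlignment G n p k e)) ∨
  IsSpikyConnectifier G H k e ∨ IsTriangularConnectifier G H k e ∨
    IsStellarConnectifier G H k e

namespace HubPaths

/-- `f 0, …, f l` is an induced path of `G`. -/
def IP {V : Type} (G : SimpleGraph V) (f : ℕ → V) (l : ℕ) : Prop :=
  (∀ i ≤ l, ∀ j ≤ l, f i = f j → i = j) ∧
    ∀ i ≤ l, ∀ j ≤ l, (G.Adj (f i) (f j) ↔ i = j + 1 ∨ j = i + 1)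

/-- `v` can be reached from `u` along edges of `G` whose heads lie in `X`. -/
abbrev Lk {V : Type} (G : SimpleGraph V) (X : Set V) : V → V → Prop :=
  Relation.ReflTransGen (fun a b => G.Adj a b ∧ b ∈ X)

/-- The set `X` is connected (or empty). -/
def Cn {V : Type} (G : SimpleGraph V) (X : Set V) : Prop :=
  ∀ u ∈ X, ∀ v ∈ X, Lk G X u v

/-- The sets `X` and `Y` are disjoint and anticomplete. -/
def Anti {V : Type} (G : SimpleGraph V) (X Y : Set V) : Prop :=
  ∀ u ∈ X, ∀ v ∈ Y, u ≠ v ∧ ¬ G.Adj u v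

/-- The vertices `f i, …, f (j - 1)`. -/
def sg {V : Type} (f : ℕ → V) (i j : ℕ) : Set V := {v | ∃ t, i ≤ t ∧ t < j ∧ f t = v}

section
variable {V : Type} {G : SimpleGraph V}

theorem Anti.symm {X Y : Set V} (h : Anti G X Y) : Anti G Y X :=
  fun u hu v hv => ⟨(h v hv u hu).1.symm, fun a => (h v hv u hu).2 a.symm⟩

theorem Lk.mono {X Y : Set V} (h : X ⊆ Y) {u v : V} (H : Lk G X u v) : Lk G Y u v :=
  Relation.ReflTransGen.mono (r := fun a b => G.Adj a b ∧ b ∈ X)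
    (p := fun a b => G.Adj a b ∧ b ∈ Y) (fun _ _ hab => ⟨hab.1, h hab.2⟩) _ _ H

theorem Lk.symm {X : Set V} {u v : V} (hu : u ∈ X) (H : Lk G X u v) : Lk G X v u := by
  have key : Lk G X v u ∧ v ∈ X := by
    induction H with
    | refl => exact ⟨.refl, hu⟩
    | tail _ h2 ih => exact ⟨(Relation.ReflTransGen.single ⟨h2.1.symm, ih.2⟩).trans ih.1, h2.2⟩
  exact key.1

theorem Cn.singleton (v : V) : Cn G {v} := by
  rintro _ rfl _ rfl; exact .refl

theorem Cn.union {X Y : Set V} (hX : Cn G X) (hY : Cn G Y)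
    (h : X.Nonempty → Y.Nonempty → ∃ u ∈ X, ∃ v ∈ Y, G.Adj u v) : Cn G (X ∪ Y) := by
  have key : ∀ a ∈ X, ∀ b ∈ Y, Lk G (X ∪ Y) a b := by
    intro a ha b hb
    obtain ⟨u, hu, v, hv, huv⟩ := h ⟨a, ha⟩ ⟨b, hb⟩
    exact ((hX a ha u hu).mono subset_union_left |>.tail ⟨huv, Or.inr hv⟩).trans
      ((hY v hv b hb).mono subset_union_right)
  rintro a (ha | ha) b (hb | hb)
  · exact (hX a ha b hb).mono subset_union_left
  · exact key a ha b hb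
  · exact (key b hb a ha).symm (Or.inl hb)
  · exact (hY a ha b hb).mono subset_union_right

theorem Cn.segment {f : ℕ → V} {l : ℕ} (hf : ∀ t < l, G.Adj (f t) (f (t + 1))) {i j : ℕ}
    (hj : j ≤ l + 1) : Cn G (sg f i j) := by
  have key : ∀ d s, i ≤ s → s + d < j → Lk G (sg f i j) (f s) (f (s + d)) := by
    intro d
    induction d with
    | zero => intros; exact .refl
    | succ d ih =>
      intro s hs hd
      exact (ih s hs (by omega)).tail ⟨hf _ (by omega), ⟨s + d + 1, by omega, by omega, rfl⟩⟩
  rintro _ ⟨s, hs, hs', rfl⟩ _ ⟨t, ht, ht', rfl⟩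
  rcases le_total s t with h | h
  · have := key (t - s) s hs (by omega)
    rwa [show s + (t - s) = t by omega] at this
  · have := key (s - t) t ht (by omega)
    rw [show t + (s - t) = s by omega] at this
    exact this.symm ⟨t, ht, ht', rfl⟩

theorem IP.step {f : ℕ → V} {l : ℕ} (hf : IP G f l) : ∀ t < l, G.Adj (f t) (f (t + 1)) :=
  fun t ht => (hf.2 t (by omega) (t + 1) (by omega)).2 (Or.inr rfl)

theorem IP.cn {f : ℕ → V} {l : ℕ} (hf : IP G f l) {i j : ℕ} (hj : j ≤ l + 1) :
    Cn G (sg f i j) := Cn.segment hf.step hj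

theorem IP.rev {f : ℕ → V} {l : ℕ} (hf : IP G f l) : IP G (fun t => f (l - t)) l := by
  refine ⟨fun i hi j hj h => ?_, fun i hi j hj => ?_⟩
  · have := hf.1 _ (by omega) _ (by omega) h; omega
  · rw [hf.2 _ (by omega) _ (by omega)]; omega

theorem IP.sub {f : ℕ → V} {l k : ℕ} (hf : IP G f l) (h : k ≤ l) : IP G f k :=
  ⟨fun i hi j hj => hf.1 i (by omega) j (by omega),
    fun i hi j hj => hf.2 i (by omega) j (by omega)⟩

theorem IP.shift {f : ℕ → V} {l : ℕ} (hf : IP G f l) {s k : ℕ} (h : s + k ≤ l) :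
    IP G (fun t => f (s + t)) k := by
  refine ⟨fun i hi j hj h => ?_, fun i hi j hj => ?_⟩
  · have := hf.1 _ (by omega) _ (by omega) h; omega
  · rw [hf.2 _ (by omega) _ (by omega)]; omega

/-- A shortest walk within `Z` between two kinds of vertices. -/
theorem min_cross {Z : Set V} {U W : V → Prop} {u w : V} (hu : u ∈ Z) (hU : U u) (hW : W w)
    (h : Lk G Z u w) :
    ∃ (f : ℕ → V) (l : ℕ), IP G f l ∧ (∀ t ≤ l, f t ∈ Z) ∧ U (f 0) ∧ W (f l) ∧
      (∀ t ≤ l, U (f t) → t = 0) ∧ ∀ t ≤ l, W (f t) → t = l := by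
  classical
  let P : ℕ → Prop := fun l => ∃ f : ℕ → V, (∀ t < l, G.Adj (f t) (f (t + 1))) ∧
    (∀ t ≤ l, f t ∈ Z) ∧ U (f 0) ∧ W (f l)
  have hex : ∃ l, P l := by
    have key : ∃ (l : ℕ) (f : ℕ → V), (∀ t < l, G.Adj (f t) (f (t + 1))) ∧
        (∀ t ≤ l, f t ∈ Z) ∧ f 0 = u ∧ f l = w := by
      clear hW
      induction h with
      | refl => exact ⟨0, fun _ => u, by simp, by simpa using hu, rfl, rfl⟩
      | @tail b c _ h2 ih =>
        obtain ⟨l, f, h1, h3, h4, h5⟩ := ih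
        refine ⟨l + 1, fun t => if t ≤ l then f t else c, ?_, ?_, by simpa using h4, by simp⟩
        · intro t ht
          rcases Nat.lt_or_ge t l with h | h
          · have := h1 t h
            simpa [h.le, Nat.succ_le_of_lt h] using this
          · obtain rfl : t = l := by omega
            simpa [h5] using h2.1
        · intro t ht
          by_cases h : t ≤ l
          · simpa [h] using h3 t h
          · simpa [h] using h2.2
    obtain ⟨l, f, h1, h2, h3, h4⟩ := key
    exact ⟨l, f, h1, h2, h3 ▸ hU, h4 ▸ hW⟩
  obtain ⟨f, h1, h2, h3, h4⟩ := Nat.find_spec hex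
  have hmin : ∀ l, P l → Nat.find hex ≤ l := fun l hl => Nat.find_min' hex hl
  generalize Nat.find hex = l at *
  have hshort : ∀ i d, i + d ≤ l → 0 < d → (i + d = l → f i = f l) →
      (i + d < l → G.Adj (f i) (f (i + d + 1))) → False := by
    intro i d hid hd hend hadj
    have := hmin (l - d) ⟨fun t => if t ≤ i then f t else f (t + d), ?_, ?_, by simpa using h3, ?_⟩
    · omega
    · intro t ht
      rcases lt_trichotomy t i with h | h | h
      · simpa [h.le, Nat.succ_le_of_lt h] using h1 t (by omega)
      · subst h
        have := hadj (by omega)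
        simp only [le_refl, if_true, Nat.not_succ_le_self, if_false]
        rwa [show t + 1 + d = t + d + 1 by omega]
      · have := h1 (t + d) (by omega)
        dsimp only
        rw [if_neg (by omega), if_neg (by omega)]
        rwa [show t + 1 + d = t + d + 1 by omega]
    · intro t ht
      dsimp only
      split_ifs
      · exact h2 _ (by omega)
      · exact h2 _ (by omega)
    · dsimp only
      split_ifs with h
      · have : i + d = l := by omega
        rw [show l - d = i by omega, hend this]; exact h4
      · rw [show l - d + d = l by omega]; exact h4
  have hinj : ∀ i j, i < j → j ≤ l → f i ≠ f j := by
    intro i j hij hj heq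
    refine hshort i (j - i) (by omega) (by omega) (fun h => ?_) (fun h => ?_)
    · rw [heq]; congr 1; omega
    · rw [heq, show i + (j - i) + 1 = j + 1 by omega]; exact h1 j (by omega)
  have hind : ∀ i j, i + 1 < j → j ≤ l → ¬ G.Adj (f i) (f j) := by
    intro i j hij hj hadj
    refine hshort i (j - i - 1) (by omega) (by omega) (fun h => by omega) (fun h => ?_)
    rwa [show i + (j - i - 1) + 1 = j by omega]
  refine ⟨f, l, ⟨fun i hi j hj heq => ?_, fun i hi j hj => ⟨fun hadj => ?_, ?_⟩⟩, h2, h3, h4,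
    ?_, ?_⟩
  · rcases lt_trichotomy i j with h | h | h
    · exact absurd heq (hinj i j h hj)
    · exact h
    · exact absurd heq.symm (hinj j i h hi)
  · by_contra hc
    rcases lt_trichotomy i j with h | h | h
    · exact hind i j (by omega) hj hadj
    · subst h; exact G.loopless.irrefl _ hadj
    · exact hind j i (by omega) hi hadj.symm
  · rintro (rfl | rfl)
    · exact (h1 j (by omega)).symm
    · exact h1 i (by omega)
  · intro t ht hUt
    have := hmin (l - t) ⟨fun s => f (s + t), fun s hs => ?_, fun s hs => h2 _ (by omega),
      by simpa using hUt, by simpa [show l - t + t = l by omega] using h4⟩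
    · omega
    · have := h1 (s + t) (by omega)
      rwa [show s + t + 1 = s + 1 + t by omega] at this
  · intro t ht hWt
    have := hmin t ⟨f, fun s hs => h1 s (by omega), fun s hs => h2 s (by omega), h3, hWt⟩
    omega

theorem exists_ip {Z : Set V} {u w : V} (hu : u ∈ Z) (h : Lk G Z u w) :
    ∃ (f : ℕ → V) (l : ℕ), IP G f l ∧ (∀ t ≤ l, f t ∈ Z) ∧ f 0 = u ∧ f l = w := by
  obtain ⟨f, l, h1, h2, h3, h4, -⟩ := min_cross (U := (· = u)) (W := (· = w)) hu rfl rfl h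
  exact ⟨f, l, h1, h2, h3, h4⟩

theorem IP.emb {f : ℕ → V} {l : ℕ} (hf : IP G f l) :
    IsPathEmb G (l + 1) (fun i => f i.val) :=
  ⟨fun i j h => Fin.ext (hf.1 _ (by omega) _ (by omega) h),
    fun i j => hf.2 _ (by omega) _ (by omega)⟩

theorem hasTheta_of {a b : V} {X : Fin 3 → Set V} (hab : a ≠ b) (hn : ¬ G.Adj a b)
    (hX : ∀ i, Cn G (X i)) (hta : ∀ i, ∃ u ∈ X i, G.Adj a u) (htb : ∀ i, ∃ u ∈ X i, G.Adj b u)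
    (hanti : ∀ i j, i ≠ j → Anti G (X i) (X j)) : HasTheta G := by
  have key : ∀ i, ∃ (f : ℕ → V) (l : ℕ), IP G f l ∧ (∀ t ≤ l, f t ∈ X i ∪ {a, b}) ∧
      f 0 = a ∧ f l = b := by
    intro i
    obtain ⟨u, hu, hau⟩ := hta i
    obtain ⟨v, hv, hbv⟩ := htb i
    apply exists_ip (by simp)
    exact (((Relation.ReflTransGen.single ⟨hau, Or.inl hu⟩).trans
      ((hX i u hu v hv).mono subset_union_left)).tail ⟨hbv.symm, by simp⟩)
  choose f l hf hfX hf0 hfl using key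
  have hl : ∀ i, 2 ≤ l i := by
    intro i
    by_contra hc
    have : l i = 0 ∨ l i = 1 := by omega
    rcases this with h | h
    · have := hfl i; rw [h, hf0] at this; exact hab this
    · have h1 := (hf i).step 0 (by omega)
      have h2 := hfl i
      rw [h] at h2
      rw [hf0, zero_add, h2] at h1
      exact hn h1
  have hinter : ∀ i t, 0 < t → t < l i → f i t ∈ X i := by
    intro i t h0 h1
    rcases hfX i t h1.le with h | h | h
    · exact h
    · have := (hf i).1 t h1.le 0 (by omega) (by rw [h, hf0]); omega
    · have := (hf i).1 t h1.le (l i) le_rfl (by rw [h, hfl]); omega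
  refine ⟨a, b, fun i => l i + 1, fun i j => f i j.val, hab, hn,
    fun i => Nat.succ_le_succ (hl i), fun i => ⟨(hf i).emb, Nat.succ_le_succ (Nat.zero_le _),
      hf0 i, hfl i⟩, ?_⟩
  intro i j hij u v hu hu' hv hv'
  exact hanti i j hij _ (hinter i u hu hu') _ (hinter j v hv hv')

theorem hasPrism_of {a b : Fin 3 → V} {X : Fin 3 → Set V} (hX : ∀ i, Cn G (X i))
    (ha : ∀ i, a i ∈ X i) (hb : ∀ i, b i ∈ X i) (hab : ∀ i, a i ≠ b i)
    (haa : ∀ i j, i ≠ j → G.Adj (a i) (a j)) (hbb : ∀ i j, i ≠ j → G.Adj (b i) (b j))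
    (hd' : ∀ i j, i ≠ j → ∀ u ∈ X i, ∀ v ∈ X j, u ≠ v ∧
      (G.Adj u v → (u = a i ∧ v = a j) ∨ (u = b i ∧ v = b j))) : HasPrism G := by
  have hd : ∀ i j, i ≠ j → ∀ u ∈ X i, ∀ v ∈ X j, u ≠ v ∧
      (G.Adj u v ↔ (u = a i ∧ v = a j) ∨ (u = b i ∧ v = b j)) := by
    refine fun i j hij u hu v hv =>
      ⟨(hd' i j hij u hu v hv).1, (hd' i j hij u hu v hv).2, ?_⟩
    rintro (⟨rfl, rfl⟩ | ⟨rfl, rfl⟩)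
    · exact haa i j hij
    · exact hbb i j hij
  have key : ∀ i, ∃ (f : ℕ → V) (l : ℕ), IP G f l ∧ (∀ t ≤ l, f t ∈ X i) ∧
      f 0 = a i ∧ f l = b i := fun i => exists_ip (ha i) (hX i _ (ha i) _ (hb i))
  choose f l hf hfX hf0 hfl using key
  have hl : ∀ i, 1 ≤ l i := by
    intro i
    by_contra hc
    have h : l i = 0 := by omega
    have := hfl i
    rw [h, hf0] at this
    exact hab i this
  have e0 : ∀ i, ∀ t ≤ l i, (f i t = a i ↔ t = 0) := fun i t ht =>
    ⟨fun h => (hf i).1 _ ht _ (by omega) (by rw [h, hf0]), fun h => by rw [h, hf0]⟩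
  have e1 : ∀ i, ∀ t ≤ l i, (f i t = b i ↔ t = l i) := fun i t ht =>
    ⟨fun h => (hf i).1 _ ht _ le_rfl (by rw [h, hfl]), fun h => by rw [h, hfl]⟩
  refine ⟨fun i => l i + 1, fun i j => f i j.val, fun i => Nat.succ_le_succ (hl i),
    fun i => (hf i).emb, fun i j hij u v => ?_, fun i j hij u v => ?_⟩
  · exact (hd i j hij _ (hfX i u (Nat.le_of_lt_succ u.isLt)) _
      (hfX j v (Nat.le_of_lt_succ v.isLt))).1
  · have hu := Nat.le_of_lt_succ u.isLt
    have hv := Nat.le_of_lt_succ v.isLt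
    rw [(hd i j hij _ (hfX i u hu) _ (hfX j v hv)).2, e0 i u hu, e0 j v hv, e1 i u hu, e1 j v hv]
    simp

theorem isHole_of_cycle {c : ℕ → V} {n : ℕ} (hn : 4 ≤ n)
    (hinj : ∀ i < n, ∀ j < n, c i = c j → i = j)
    (hadj : ∀ i < n, ∀ j < n, (G.Adj (c i) (c j) ↔
      i = j + 1 ∨ j = i + 1 ∨ (i = 0 ∧ j + 1 = n) ∨ (j = 0 ∧ i + 1 = n))) :
    IsHole G (sg c 0 n) := by
  obtain ⟨k, rfl⟩ : ∃ k, n = k + 1 := ⟨n - 1, by omega⟩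
  have hval : ∀ i j : Fin (k + 1), i = j + 1 ↔
      (i.val = j.val + 1 ∨ (i.val = 0 ∧ j.val + 1 = k + 1)) := by
    intro i j
    rw [Fin.ext_iff, Fin.val_add_one]
    have := i.isLt
    have := j.isLt
    split_ifs with h
    · subst h; simp; omega
    · have : j.val ≠ k := fun h' => h (Fin.ext (by simpa using h'))
      omega
  refine ⟨k + 1, fun i : Fin (k + 1) => c i.val, hn, ⟨?_, ?_⟩, ?_⟩
  · intro i j h
    exact Fin.ext (hinj _ i.isLt _ j.isLt h)
  · intro i j
    refine (hadj _ (Fin.isLt i) _ (Fin.isLt j)).trans ?_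
    refine Iff.trans ?_ (or_congr (hval i j) (hval j i)).symm
    tauto
  · ext v
    constructor
    · rintro ⟨i, rfl⟩
      exact ⟨_, by omega, Fin.isLt i, rfl⟩
    · rintro ⟨t, -, ht, rfl⟩
      exact ⟨⟨t, ht⟩, rfl⟩

theorem exists_hole {X Y : Set V} {p₁ p₂ r₁ r₂ : V} (hX : Cn G X) (hY : Cn G Y)
    (hp₁ : p₁ ∈ X) (hp₂ : p₂ ∈ X) (hr₁ : r₁ ∈ Y) (hr₂ : r₂ ∈ Y) (hp : p₁ ≠ p₂) (hr : r₁ ≠ r₂)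
    (h1 : G.Adj p₁ r₁) (h2 : G.Adj p₂ r₂)
    (hXY' : ∀ u ∈ X, ∀ v ∈ Y, u ≠ v ∧ (G.Adj u v → (u = p₁ ∧ v = r₁) ∨ (u = p₂ ∧ v = r₂))) :
    ∃ H, IsHole G H ∧ H ⊆ X ∪ Y ∧ p₁ ∈ H ∧ p₂ ∈ H ∧ r₁ ∈ H ∧ r₂ ∈ H := by
  have hXY : ∀ u ∈ X, ∀ v ∈ Y, u ≠ v ∧
      (G.Adj u v ↔ (u = p₁ ∧ v = r₁) ∨ (u = p₂ ∧ v = r₂)) := by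
    refine fun u hu v hv => ⟨(hXY' u hu v hv).1, (hXY' u hu v hv).2, ?_⟩
    rintro (⟨rfl, rfl⟩ | ⟨rfl, rfl⟩)
    · exact h1
    · exact h2
  obtain ⟨f, l, hf, hfX, hf0, hfl⟩ := exists_ip hp₁ (hX _ hp₁ _ hp₂)
  obtain ⟨g, m, hg, hgY, hg0, hgm⟩ := exists_ip hr₂ (hY _ hr₂ _ hr₁)
  have hl : l ≠ 0 := by rintro rfl; exact hp (hf0.symm.trans hfl)
  have hm : m ≠ 0 := by rintro rfl; exact hr (hgm.symm.trans hg0)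
  have ef0 : ∀ t ≤ l, (f t = p₁ ↔ t = 0) := fun t ht =>
    ⟨fun h => hf.1 _ ht _ (by omega) (by rw [h, hf0]), fun h => by rw [h, hf0]⟩
  have efl : ∀ t ≤ l, (f t = p₂ ↔ t = l) := fun t ht =>
    ⟨fun h => hf.1 _ ht _ le_rfl (by rw [h, hfl]), fun h => by rw [h, hfl]⟩
  have eg0 : ∀ t ≤ m, (g t = r₂ ↔ t = 0) := fun t ht =>
    ⟨fun h => hg.1 _ ht _ (by omega) (by rw [h, hg0]), fun h => by rw [h, hg0]⟩
  have egm : ∀ t ≤ m, (g t = r₁ ↔ t = m) := fun t ht =>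
    ⟨fun h => hg.1 _ ht _ le_rfl (by rw [h, hgm]), fun h => by rw [h, hgm]⟩
  have hfg : ∀ i ≤ l, ∀ j ≤ m, f i ≠ g j ∧
      (G.Adj (f i) (g j) ↔ (i = 0 ∧ j = m) ∨ (i = l ∧ j = 0)) := by
    intro i hi j hj
    have := hXY _ (hfX i hi) _ (hgY j hj)
    rwa [ef0 i hi, efl i hi, eg0 j hj, egm j hj] at this
  have e1 : ∀ i, i < l + m + 2 → ¬ i ≤ l → i - (l + 1) ≤ m := by omega
  let c : ℕ → V := fun t => if t ≤ l then f t else g (t - (l + 1))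
  have hc1 : ∀ t ≤ l, c t = f t := fun t ht => if_pos ht
  have hc2 : ∀ t, ¬ t ≤ l → c t = g (t - (l + 1)) := fun t ht => if_neg ht
  refine ⟨sg c 0 (l + m + 2), isHole_of_cycle (by omega) ?_ ?_, ?_, ⟨0, by omega, by omega, ?_⟩,
    ⟨l, by omega, by omega, ?_⟩, ⟨l + m + 1, by omega, by omega, ?_⟩,
    ⟨l + 1, by omega, by omega, ?_⟩⟩
  · intro i hi j hj h
    by_cases h1 : i ≤ l <;> by_cases h2 : j ≤ l
    · rw [hc1 _ h1, hc1 _ h2] at h; exact hf.1 _ h1 _ h2 h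
    · rw [hc1 _ h1, hc2 _ h2] at h; exact absurd h (hfg _ h1 _ (e1 j hj h2)).1
    · rw [hc2 _ h1, hc1 _ h2] at h; exact absurd h.symm (hfg _ h2 _ (e1 i hi h1)).1
    · rw [hc2 _ h1, hc2 _ h2] at h
      have := hg.1 _ (e1 i hi h1) _ (e1 j hj h2) h
      omega
  · intro i hi j hj
    by_cases h1 : i ≤ l <;> by_cases h2 : j ≤ l
    · rw [hc1 _ h1, hc1 _ h2, hf.2 _ h1 _ h2]; omega
    · rw [hc1 _ h1, hc2 _ h2, (hfg _ h1 _ (e1 j hj h2)).2]; omega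
    · rw [hc2 _ h1, hc1 _ h2, G.adj_comm, (hfg _ h2 _ (e1 i hi h1)).2]; omega
    · rw [hc2 _ h1, hc2 _ h2, hg.2 _ (e1 i hi h1) _ (e1 j hj h2)]; omega
  · rintro _ ⟨t, -, ht, rfl⟩
    by_cases h : t ≤ l
    · rw [hc1 _ h]; exact Or.inl (hfX t h)
    · rw [hc2 _ h]; exact Or.inr (hgY _ (e1 t ht h))
  · rw [hc1 _ (by omega), hf0]
  · rw [hc1 _ (by omega), hfl]
  · rw [hc2 _ (by omega), show l + m + 1 - (l + 1) = m by omega, hgm]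
  · rw [hc2 _ (by omega), Nat.sub_self, hg0]

end

/-- `α 0, …, α m` is an induced path, of which `x` sees exactly the start `α 0`. -/
def Leg {V : Type} (G : SimpleGraph V) (x : V) (α : ℕ → V) (m : ℕ) : Prop :=
  IP G α m ∧ ∀ i ≤ m, x ≠ α i ∧ (G.Adj x (α i) ↔ i = 0)

/-- Two disjoint paths joined by exactly one edge, between their last vertices. -/
def Ends {V : Type} (G : SimpleGraph V) (α : ℕ → V) (m : ℕ) (γ : ℕ → V) (n : ℕ) : Prop :=
  ∀ i ≤ m, ∀ j ≤ n, α i ≠ γ j ∧ (G.Adj (α i) (γ j) ↔ i = m ∧ j = n)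

/-- A pyramid with apex `x` whose base is the triangle of the last vertices of three legs. -/
structure Pyr {V : Type} (G : SimpleGraph V) (x : V) (α : ℕ → V) (m : ℕ) (γ : ℕ → V) (n : ℕ)
    (δ : ℕ → V) (r : ℕ) : Prop where
  legα : Leg G x α m
  legγ : Leg G x γ n
  legδ : Leg G x δ r
  αγ : Ends G α m γ n
  αδ : Ends G α m δ r
  γδ : Ends G γ n δ r

section
variable {V : Type} {G : SimpleGraph V} {x : V} {α γ δ f : ℕ → V} {m n r l : ℕ}

theorem Ends.symm (h : Ends G α m γ n) : Ends G γ n α m := by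
  intro i hi j hj
  have := h j hj i hi
  rw [G.adj_comm, and_comm (a := i = n)]
  exact ⟨this.1.symm, this.2⟩

theorem Pyr.swap (h : Pyr G x α m γ n δ r) : Pyr G x γ n α m δ r :=
  ⟨h.legγ, h.legα, h.legδ, h.αγ.symm, h.γδ, h.αδ⟩

theorem exists_first {P : ℕ → Prop} {t : ℕ} (h : P t) :
    ∃ i ≤ t, P i ∧ ∀ j < i, ¬ P j := by
  classical
  exact ⟨Nat.find ⟨t, h⟩, Nat.find_min' _ h, Nat.find_spec ⟨t, h⟩,
    fun j hj => Nat.find_min ⟨t, h⟩ hj⟩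

theorem exists_last {P : ℕ → Prop} {t l : ℕ} (ht : t ≤ l) (h : P t) :
    ∃ i ≤ l, t ≤ i ∧ P i ∧ ∀ j ≤ l, i < j → ¬ P j := by
  obtain ⟨i, hi, hPi, hmin⟩ := exists_first (P := fun s => P (l - s)) (t := l - t)
    (by rwa [show l - (l - t) = t by omega])
  refine ⟨l - i, by omega, by omega, hPi, fun j hj hij hPj => hmin (l - j) (by omega) ?_⟩
  rwa [show l - (l - j) = j by omega]

theorem no_theta (hC : MemC G) {a b : V} {X Y Z : Set V} (hab : a ≠ b) (hn : ¬ G.Adj a b)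
    (hX : Cn G X) (hY : Cn G Y) (hZ : Cn G Z)
    (haX : ∃ u ∈ X, G.Adj a u) (hbX : ∃ u ∈ X, G.Adj b u)
    (haY : ∃ u ∈ Y, G.Adj a u) (hbY : ∃ u ∈ Y, G.Adj b u)
    (haZ : ∃ u ∈ Z, G.Adj a u) (hbZ : ∃ u ∈ Z, G.Adj b u)
    (hXY : Anti G X Y) (hXZ : Anti G X Z) (hYZ : Anti G Y Z) : False := by
  refine hC.2.1 (hasTheta_of (X := ![X, Y, Z]) hab hn ?_ ?_ ?_ ?_)
  · intro i; fin_cases i <;> assumption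
  · intro i; fin_cases i <;> assumption
  · intro i; fin_cases i <;> assumption
  · have := hXY.symm
    have := hXZ.symm
    have := hYZ.symm
    intro i j hij
    fin_cases i <;> fin_cases j <;> first | exact absurd rfl hij | assumption

theorem anti_union_left {X Y Z : Set V} (h1 : Anti G X Z) (h2 : Anti G Y Z) :
    Anti G (X ∪ Y) Z := by
  rintro u (hu | hu) v hv
  · exact h1 u hu v hv
  · exact h2 u hu v hv

theorem anti_union_right {X Y Z : Set V} (h1 : Anti G Z X) (h2 : Anti G Z Y) :
    Anti G Z (X ∪ Y) := (anti_union_left h1.symm h2.symm).symm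

theorem anti_sg {i j k p : ℕ} (h : ∀ s t, i ≤ s → s < j → k ≤ t → t < p →
    f s ≠ α t ∧ ¬ G.Adj (f s) (α t)) : Anti G (sg f i j) (sg α k p) := by
  rintro _ ⟨s, hs, hs', rfl⟩ _ ⟨t, ht, ht', rfl⟩
  exact h s t hs hs' ht ht'

theorem anti_sg_left {i j : ℕ} {X : Set V} (h : ∀ s, i ≤ s → s < j → ∀ v ∈ X,
    f s ≠ v ∧ ¬ G.Adj (f s) v) : Anti G (sg f i j) X := by
  rintro _ ⟨s, hs, hs', rfl⟩ v hv
  exact h s hs hs' v hv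

theorem mem_sg {i j t : ℕ} (h1 : i ≤ t) (h2 : t < j) : f t ∈ sg f i j := ⟨t, h1, h2, rfl⟩

/-- A vertex attached to one leg of a pyramid, with a further connection to the apex, sees
exactly two consecutive vertices of the leg. -/
theorem attach_pair (hC : MemC G) (hα : Leg G x α m) (hδ : Leg G x δ r) (hαδ : Ends G α m δ r)
    {u : V} {Y : Set V} (hux : u ≠ x) (hxu : ¬ G.Adj u x)
    (huα : ∀ i ≤ m, u ≠ α i) (huδ : ∀ v ≤ r, u ≠ δ v ∧ ¬ G.Adj u (δ v))
    (hu0 : ¬ G.Adj u (α 0)) {i₀ : ℕ} (hi₀ : i₀ < m) (hui : G.Adj u (α i₀))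
    (hY : Cn G Y) (hYα : ∀ i ≤ m, ∀ y ∈ Y, α i ≠ y ∧ ¬ G.Adj (α i) y)
    (hYδ : ∀ i ≤ r, ∀ y ∈ Y, δ i ≠ y ∧ ¬ G.Adj (δ i) y)
    (huY : ∃ y ∈ Y, G.Adj u y) (hxY : ∃ y ∈ Y, G.Adj x y) :
    ∃ i, 0 < i ∧ i < m ∧ ∀ t ≤ m, (G.Adj u (α t) ↔ t = i ∨ t = i + 1) := by
  obtain ⟨i, hi, hPi, hmin⟩ := exists_first (P := fun t => G.Adj u (α t)) hui
  obtain ⟨i', hi', hii', hPi', hmax⟩ := exists_last (P := fun t => G.Adj u (α t))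
    (l := m) (t := i) (by omega) hPi
  have hi0 : 0 < i := by
    rcases Nat.eq_zero_or_pos i with h | h
    · subst h; exact absurd hPi hu0
    · exact h
  have hx0 : G.Adj x (α 0) := (hα.2 0 (by omega)).2.2 rfl
  have hd0 : G.Adj x (δ 0) := (hδ.2 0 (by omega)).2.2 rfl
  have hbb : G.Adj (α m) (δ r) := (hαδ m le_rfl r le_rfl).2.2 ⟨rfl, rfl⟩
  have hself := fun s hs t ht => (hα.1.2 s hs t ht)
  have hinj := hα.1.1
  have hcon : Cn G (sg α i' (m + 1) ∪ sg δ 0 (r + 1)) :=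
    (hα.1.cn le_rfl).union (hδ.1.cn le_rfl) fun _ _ =>
      ⟨_, mem_sg hi' (by omega), _, mem_sg (Nat.zero_le r) (by omega), hbb⟩
  rcases Nat.lt_or_ge (i + 1) i' with h | h
  · exfalso
    refine no_theta hC hux hxu (hα.1.cn (i := 0) (j := i + 1) (by omega)) hY hcon
      ⟨_, mem_sg (Nat.zero_le i) (by omega), hPi⟩
      ⟨_, mem_sg (Nat.zero_le 0) (by omega), hx0⟩ huY hxY
      ⟨_, Or.inl (mem_sg le_rfl (by omega)), hPi'⟩
      ⟨_, Or.inr (mem_sg le_rfl (by omega)), hd0⟩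
      (anti_sg_left fun s h1 h2 => hYα s (by omega))
      (anti_union_right (anti_sg fun s t _ _ _ _ => ⟨fun h => ?_, fun h => ?_⟩)
        (anti_sg fun s t _ _ _ _ => ⟨(hαδ s (by omega) t (by omega)).1, fun h => ?_⟩))
      (anti_union_left (anti_sg_left fun s h1 h2 => hYα s (by omega))
        (anti_sg_left fun s h1 h2 => hYδ s (by omega))).symm
    · have := hinj s (by omega) t (by omega) h; omega
    · have := (hself s (by omega) t (by omega)).1 h; omega
    · have := (hαδ s (by omega) t (by omega)).2.1 h; omega
  rcases Nat.lt_or_ge i i' with h' | h'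
  · obtain rfl : i' = i + 1 := by omega
    refine ⟨i, hi0, by omega, fun t ht => ⟨fun hadj => ?_, ?_⟩⟩
    · by_contra hc
      have h1 : ¬ t < i := fun h => hmin t h hadj
      have h2 : ¬ i + 1 < t := fun h => hmax t ht h hadj
      omega
    · rintro (rfl | rfl) <;> assumption
  · exfalso
    obtain rfl : i' = i := by omega
    have hcon' : Cn G (sg α (i' + 1) (m + 1) ∪ sg δ 0 (r + 1)) :=
      (hα.1.cn le_rfl).union (hδ.1.cn le_rfl) fun _ _ =>
        ⟨_, mem_sg (show i' + 1 ≤ m by omega) (by omega), _, mem_sg (Nat.zero_le r) (by omega), hbb⟩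
    refine no_theta hC (a := α i') (b := x) (hα.2 i' hi').1.symm ?_
      (hα.1.cn (i := 0) (j := i') (by omega)) ((Cn.singleton u).union hY fun _ _ => ?_) hcon'
      ⟨_, mem_sg (Nat.zero_le (i' - 1)) (by omega), ?_⟩
      ⟨_, mem_sg (Nat.zero_le 0) (by omega), hx0⟩
      ⟨u, Or.inl rfl, hPi.symm⟩ (hxY.imp fun y hy => ⟨Or.inr hy.1, hy.2⟩)
      ⟨_, Or.inl (mem_sg le_rfl (by omega)), ?_⟩
      ⟨_, Or.inr (mem_sg le_rfl (by omega)), hd0⟩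
      (anti_union_right (anti_sg_left fun s h1 h2 => ?_)
        (anti_sg_left fun s h1 h2 => hYα s (by omega)))
      (anti_union_right (anti_sg fun s t _ _ _ _ => ⟨fun h => ?_, fun h => ?_⟩)
        (anti_sg fun s t _ _ _ _ => ⟨(hαδ s (by omega) t (by omega)).1, fun h => ?_⟩))
      (anti_union_left (anti_union_right ?_ ?_) (anti_union_left
        (anti_sg_left fun s h1 h2 => hYα s (by omega))
        (anti_sg_left fun s h1 h2 => hYδ s (by omega))).symm)
    · intro h
      have := (hα.2 i' hi').2.1 h.symm; omega
    · obtain ⟨y, hy, hy'⟩ := huY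
      exact ⟨u, rfl, y, hy, hy'⟩
    · rw [hself _ hi' _ (by omega)]; omega
    · rw [hself _ hi' _ (by omega)]; omega
    · rintro _ rfl
      exact ⟨(huα s (by omega)).symm, fun h => hmin s h2 h.symm⟩
    · have := hinj s (by omega) t (by omega) h; omega
    · have := (hself s (by omega) t (by omega)).1 h; omega
    · have := (hαδ s (by omega) t (by omega)).2.1 h; omega
    · rintro _ rfl _ ⟨t, h1, h2, rfl⟩
      exact ⟨huα t (by omega), hmax t (by omega) (by omega)⟩
    · rintro _ rfl _ ⟨t, h1, h2, rfl⟩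
      exact huδ t (by omega)

end

/-- A path crossing from the leg `α` to the leg `γ` of a pyramid. -/
structure Cross {V : Type} (G : SimpleGraph V) (x : V) (α : ℕ → V) (m : ℕ) (γ : ℕ → V) (n : ℕ)
    (δ : ℕ → V) (r : ℕ) (f : ℕ → V) (l : ℕ) : Prop where
  pyr : Pyr G x α m γ n δ r
  ip : IP G f l
  fx : ∀ t ≤ l, x ≠ f t ∧ ¬ G.Adj x (f t)
  fα : ∀ t ≤ l, ∀ i ≤ m, f t ≠ α i
  fγ : ∀ t ≤ l, ∀ i ≤ n, f t ≠ γ i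
  fδ : ∀ t ≤ l, ∀ i ≤ r, f t ≠ δ i
  α0 : ∀ t ≤ l, ¬ G.Adj (f t) (α 0)
  γ0 : ∀ t ≤ l, ¬ G.Adj (f t) (γ 0)
  δlt : ∀ t ≤ l, ∀ v < r, ¬ G.Adj (f t) (δ v)
  startα : ∃ i < m, G.Adj (f 0) (α i)
  onlyα : ∀ t ≤ l, ∀ i < m, G.Adj (f t) (α i) → t = 0
  endγ : ∃ j < n, G.Adj (f l) (γ j)
  onlyγ : ∀ t ≤ l, ∀ j < n, G.Adj (f t) (γ j) → t = l
  consec : r = 0 → ∀ i ≤ l, ∀ j ≤ l, G.Adj (δ r) (f i) → G.Adj (δ r) (f j) → j ≤ i + 1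

section
variable {V : Type} {G : SimpleGraph V} {x : V} {α γ δ f : ℕ → V} {m n r l : ℕ}

theorem no_even_wheel (hC : MemC G) {X Y : Set V} {p₁ p₂ r₁ r₂ v : V} (hX : Cn G X)
    (hY : Cn G Y) (hp₁ : p₁ ∈ X) (hp₂ : p₂ ∈ X) (hr₁ : r₁ ∈ Y) (hr₂ : r₂ ∈ Y) (hp : p₁ ≠ p₂)
    (hr : r₁ ≠ r₂)
    (hpr₁ : G.Adj p₁ r₁) (hpr₂ : G.Adj p₂ r₂) (hvp₁ : G.Adj v p₁) (hvp₂ : G.Adj v p₂)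
    (hvr₁ : G.Adj v r₁) (hvr₂ : G.Adj v r₂)
    (hXY : ∀ u ∈ X, ∀ v ∈ Y, u ≠ v ∧ (G.Adj u v → (u = p₁ ∧ v = r₁) ∨ (u = p₂ ∧ v = r₂)))
    (hvX : ∀ u ∈ X, v ≠ u ∧ (G.Adj v u → u = p₁ ∨ u = p₂))
    (hvY : ∀ u ∈ Y, v ≠ u ∧ (G.Adj v u → u = r₁ ∨ u = r₂)) : False := by
  obtain ⟨H, hH, hsub, h1, h2, h3, h4⟩ := exists_hole hX hY hp₁ hp₂ hr₁ hr₂ hp hr hpr₁ hpr₂ hXY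
  have hN : holeNbrs G H v = {p₁, p₂, r₁, r₂} := by
    ext u
    simp only [holeNbrs, mem_ofPred_eq, mem_insert_iff, mem_singleton_iff]
    constructor
    · rintro ⟨hu, huv⟩
      rcases hsub hu with h | h
      · have := (hvX u h).2 huv; tauto
      · have := (hvY u h).2 huv; tauto
    · rintro (rfl | rfl | rfl | rfl)
      · exact ⟨h1, hvp₁⟩
      · exact ⟨h2, hvp₂⟩
      · exact ⟨h3, hvr₁⟩
      · exact ⟨h4, hvr₂⟩
  have hcard : (holeNbrs G H v).ncard = 4 := by
    classical
    rw [hN]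
    have e : ({p₁, p₂, r₁, r₂} : Set V) = (({p₁, p₂, r₁, r₂} : Finset V) : Set V) := by simp
    rw [e, Set.ncard_coe_finset]
    have := (hXY p₁ hp₁ r₁ hr₁).1
    have := (hXY p₁ hp₁ r₂ hr₂).1
    have := (hXY p₂ hp₂ r₁ hr₁).1
    have := (hXY p₂ hp₂ r₂ hr₂).1
    rw [Finset.card_insert_of_notMem, Finset.card_insert_of_notMem, Finset.card_insert_of_notMem,
      Finset.card_singleton] <;> simp [*]
  refine hC.2.2.2 H v ⟨hH, ?_, by omega⟩ (by rw [hcard]; decide)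
  intro hv
  rcases hsub hv with h | h
  · exact (hvX v h).1 rfl
  · exact (hvY v h).1 rfl

theorem Cross.rev (h : Cross G x α m γ n δ r f l) :
    Cross G x γ n α m δ r (fun t => f (l - t)) l where
  pyr := h.pyr.swap
  ip := h.ip.rev
  fx t _ := h.fx _ (by omega)
  fα t _ := h.fγ _ (by omega)
  fγ t _ := h.fα _ (by omega)
  fδ t _ := h.fδ _ (by omega)
  α0 t _ := h.γ0 _ (by omega)
  γ0 t _ := h.α0 _ (by omega)
  δlt t _ := h.δlt _ (by omega)
  startα := h.endγ
  onlyα t ht i hi hadj := by have := h.onlyγ _ (by omega) i hi hadj; omega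
  endγ := by simpa using h.startα
  onlyγ t ht i hi hadj := by have := h.onlyα _ (by omega) i hi hadj; omega
  consec hr i hi j hj h1 h2 := by
    have := h.consec hr _ (by omega) _ (by omega) h2 h1; omega

/-- The facts about a crossing in a form suited to `grind`. -/
theorem Cross.table (h : Cross G x α m γ n δ r f l) :
    (∀ s t, s ≤ m → t ≤ m → (α s = α t → s = t) ∧ (G.Adj (α s) (α t) ↔ s = t + 1 ∨ t = s + 1)) ∧
    (∀ s t, s ≤ n → t ≤ n → (γ s = γ t → s = t) ∧ (G.Adj (γ s) (γ t) ↔ s = t + 1 ∨ t = s + 1)) ∧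
    (∀ s t, s ≤ r → t ≤ r → (δ s = δ t → s = t) ∧ (G.Adj (δ s) (δ t) ↔ s = t + 1 ∨ t = s + 1)) ∧
    (∀ s t, s ≤ l → t ≤ l → (f s = f t → s = t) ∧ (G.Adj (f s) (f t) ↔ s = t + 1 ∨ t = s + 1)) ∧
    (∀ s t, s ≤ m → t ≤ n → α s ≠ γ t ∧ (G.Adj (α s) (γ t) ↔ s = m ∧ t = n)) ∧
    (∀ s t, s ≤ m → t ≤ r → α s ≠ δ t ∧ (G.Adj (α s) (δ t) ↔ s = m ∧ t = r)) ∧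
    (∀ s t, s ≤ n → t ≤ r → γ s ≠ δ t ∧ (G.Adj (γ s) (δ t) ↔ s = n ∧ t = r)) ∧
    (∀ s t, s ≤ l → t ≤ m → f s ≠ α t ∧ (G.Adj (f s) (α t) → 0 < t ∧ (t < m → s = 0))) ∧
    (∀ s t, s ≤ l → t ≤ n → f s ≠ γ t ∧ (G.Adj (f s) (γ t) → 0 < t ∧ (t < n → s = l))) ∧
    (∀ s t, s ≤ l → t ≤ r → f s ≠ δ t ∧ (G.Adj (f s) (δ t) → t = r)) := by
  refine ⟨fun s t hs ht => ⟨h.pyr.legα.1.1 s hs t ht, h.pyr.legα.1.2 s hs t ht⟩,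
    fun s t hs ht => ⟨h.pyr.legγ.1.1 s hs t ht, h.pyr.legγ.1.2 s hs t ht⟩,
    fun s t hs ht => ⟨h.pyr.legδ.1.1 s hs t ht, h.pyr.legδ.1.2 s hs t ht⟩,
    fun s t hs ht => ⟨h.ip.1 s hs t ht, h.ip.2 s hs t ht⟩,
    fun s t hs ht => h.pyr.αγ s hs t ht, fun s t hs ht => h.pyr.αδ s hs t ht,
    fun s t hs ht => h.pyr.γδ s hs t ht,
    fun s t hs ht => ⟨h.fα s hs t ht, fun hadj => ⟨?_, fun h' => h.onlyα s hs t h' hadj⟩⟩,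
    fun s t hs ht => ⟨h.fγ s hs t ht, fun hadj => ⟨?_, fun h' => h.onlyγ s hs t h' hadj⟩⟩,
    fun s t hs ht => ⟨h.fδ s hs t ht, fun hadj => ?_⟩⟩
  · rcases Nat.eq_zero_or_pos t with rfl | h'
    · exact absurd hadj (h.α0 s hs)
    · exact h'
  · rcases Nat.eq_zero_or_pos t with rfl | h'
    · exact absurd hadj (h.γ0 s hs)
    · exact h'
  · rcases Nat.lt_or_ge t r with h' | h'
    · exact absurd hadj (h.δlt s hs t h')
    · omega

/-- Late neighbours of the base vertex `α m` on a crossing path give a theta. -/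
theorem Cross.no_late (hC : MemC G) (h : Cross G x α m γ n δ r f l) {p : ℕ} (hp : 0 < p)
    (hpl : p ≤ l) (hpa : G.Adj (f p) (α m))
    (hδ : ∀ t, p ≤ t → t ≤ l → ¬ G.Adj (f t) (δ r)) : False := by
  obtain ⟨hαα, hγγ, hδδ, hff, hαγ, hαδ, hγδ, hfα, hfγ, hfδ⟩ := h.table
  obtain ⟨j, hj, hjγ⟩ := h.endγ
  obtain ⟨i, hi, hiα⟩ := h.startα
  have hx0 : G.Adj x (α 0) := (h.pyr.legα.2 0 (by omega)).2.2 rfl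
  have hg0 : G.Adj x (γ 0) := (h.pyr.legγ.2 0 (by omega)).2.2 rfl
  have hd0 : G.Adj x (δ 0) := (h.pyr.legδ.2 0 (by omega)).2.2 rfl
  have hadj := fun {u v} => G.adj_comm u v
  have hxα := h.pyr.legα.2
  refine no_theta hC (a := α m) (b := x) (h.pyr.legα.2 m le_rfl).1.symm ?_
    (h.pyr.legα.1.cn (i := 0) (j := m) (by omega))
    ((h.ip.cn (i := p) (j := l + 1) le_rfl).union (h.pyr.legγ.1.cn (i := 0) (j := n) (by omega))
      fun _ _ => ⟨_, mem_sg hpl (by omega), _, mem_sg (Nat.zero_le j) hj, hjγ⟩)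
    (h.pyr.legδ.1.cn (i := 0) (j := r + 1) le_rfl)
    ⟨_, mem_sg (Nat.zero_le (m - 1)) (by omega), ?_⟩ ⟨_, mem_sg (Nat.zero_le 0) (by omega), hx0⟩
    ⟨_, Or.inl (mem_sg le_rfl (by omega)), hpa.symm⟩
    ⟨_, Or.inr (mem_sg (Nat.zero_le 0) (by omega)), hg0⟩
    ⟨_, mem_sg (Nat.zero_le r) (by omega), ?_⟩ ⟨_, mem_sg (Nat.zero_le 0) (by omega), hd0⟩
    (anti_union_right (anti_sg ?_) (anti_sg ?_)) (anti_sg ?_) (anti_union_left (anti_sg ?_)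
      (anti_sg ?_))
  all_goals grind
end

section
variable {V : Type} {G : SimpleGraph V} {x : V} {α γ δ f : ℕ → V} {m n r l : ℕ}

theorem IP.cut (h : IP G α m) {a s t : ℕ} (hs : a < s) (hsm : s ≤ m) (ht : t ≤ a) :
    α s ≠ α t ∧ (G.Adj (α s) (α t) → α s = α (a + 1) ∧ α t = α a) := by
  refine ⟨fun e => ?_, fun e => ?_⟩
  · have := h.1 s hsm t (by omega) e; omega
  · have := (h.2 s hsm t (by omega)).1 e
    obtain ⟨rfl, rfl⟩ : s = a + 1 ∧ t = a := by omega
    exact ⟨rfl, rfl⟩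

/-- If the base vertex `δ r` misses the crossing path, the first vertex of the path sees two
consecutive vertices of the leg `α`, provided the path has positive length. -/
theorem Cross.pair (hC : MemC G) (h : Cross G x α m γ n δ r f l)
    {X : Set V} (hX : Cn G X) (hXα : ∀ i ≤ m, ∀ y ∈ X, α i ≠ y ∧ ¬ G.Adj (α i) y)
    (hXδ : ∀ i ≤ r, ∀ y ∈ X, δ i ≠ y ∧ ¬ G.Adj (δ i) y)
    (h0X : ∃ y ∈ X, G.Adj (f 0) y) (hxX : ∃ y ∈ X, G.Adj x y)
    (hδ : ¬ G.Adj (f 0) (δ r)) :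
    ∃ i, 0 < i ∧ i < m ∧ ∀ t ≤ m, (G.Adj (f 0) (α t) ↔ t = i ∨ t = i + 1) := by
  obtain ⟨i, hi, hiα⟩ := h.startα
  obtain ⟨hαα, hγγ, hδδ, hff, hαγ, hαδ, hγδ, hfα, hfγ, hfδ⟩ := h.table
  exact attach_pair hC h.pyr.legα h.pyr.legδ h.pyr.αδ (h.fx 0 (by omega)).1.symm
    (fun h' => (h.fx 0 (by omega)).2 h'.symm) (h.fα 0 (by omega))
    (fun v hv => ⟨h.fδ 0 (by omega) v hv, by grind⟩) (h.α0 0 (by omega)) hi hiα hX hXα hXδ h0X hxX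

theorem Cross.miss_zero (hC : MemC G) (h : Cross G x α m γ n δ r f 0)
    (hδ : ¬ G.Adj (f 0) (δ r)) : False := by
  have h' := h.rev
  obtain ⟨j, hj, hjγ⟩ := h.endγ
  obtain ⟨i, hi, hiα⟩ := h.startα
  obtain ⟨hαα, hγγ, hδδ, hff, hαγ, hαδ, hγδ, hfα, hfγ, hfδ⟩ := h.table
  have hx0 : G.Adj x (α 0) := (h.pyr.legα.2 0 (by omega)).2.2 rfl
  have hg0 : G.Adj x (γ 0) := (h.pyr.legγ.2 0 (by omega)).2.2 rfl
  have hadj := fun {u v} => G.adj_comm u v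
  have hxα := h.pyr.legα.2
  have hxγ := h.pyr.legγ.2
  have hfx := h.fx 0 le_rfl
  obtain ⟨a, ha0, ham, ha⟩ := h.pair hC (X := sg γ 0 n) (h.pyr.legγ.1.cn (by omega))
    (by rintro i hi _ ⟨t, h1, h2, rfl⟩; grind) (by rintro i hi _ ⟨t, h1, h2, rfl⟩; grind)
    ⟨_, mem_sg (Nat.zero_le j) hj, hjγ⟩ ⟨_, mem_sg (Nat.zero_le 0) (by omega), hg0⟩ hδ
  obtain ⟨b, hb0, hbn, hb⟩ := h'.pair hC (X := sg α 0 m) (h.pyr.legα.1.cn (by omega))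
    (by rintro i hi _ ⟨t, h1, h2, rfl⟩; grind) (by rintro i hi _ ⟨t, h1, h2, rfl⟩; grind)
    ⟨_, mem_sg (Nat.zero_le i) hi, hiα⟩ ⟨_, mem_sg (Nat.zero_le 0) (by omega), hx0⟩ hδ
  simp only [Nat.sub_zero] at hb
  refine no_even_wheel hC (v := f 0) (p₁ := α (a + 1)) (p₂ := γ (b + 1)) (r₁ := α a) (r₂ := γ b)
    (X := sg α (a + 1) (m + 1) ∪ sg γ (b + 1) (n + 1))
    (Y := (sg α 0 (a + 1) ∪ {x}) ∪ sg γ 0 (b + 1)) ?_ ?_ (Or.inl (mem_sg le_rfl (by omega)))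
    (Or.inr (mem_sg le_rfl (by omega))) (Or.inl (Or.inl (mem_sg (Nat.zero_le _) (by omega))))
    (Or.inr (mem_sg (Nat.zero_le _) (by omega))) ?_ ?_ ?_ ?_ ?_ ?_ ?_ ?_ ?_ ?_ ?_
  · exact (h.pyr.legα.1.cn le_rfl).union (h.pyr.legγ.1.cn le_rfl) fun _ _ =>
      ⟨_, mem_sg (show a + 1 ≤ m by omega) (by omega), _,
        mem_sg (show b + 1 ≤ n by omega) (by omega), by grind⟩
  · refine ((h.pyr.legα.1.cn (by omega)).union (Cn.singleton x) fun _ _ =>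
      ⟨_, mem_sg (Nat.zero_le 0) (by omega), _, rfl, hx0.symm⟩).union
      (h.pyr.legγ.1.cn (by omega)) fun _ _ => ⟨_, Or.inr rfl, _, mem_sg (Nat.zero_le 0) (by omega),
        hg0⟩
  iterate 8 grind
  · have key : ∀ s t, s ≤ m → t ≤ n → (s < m ∨ t < n) → α s ≠ γ t ∧ ¬ G.Adj (α s) (γ t) :=
      fun s t hs ht hst => ⟨(hαγ s t hs ht).1, fun e => by
        have := (hαγ s t hs ht).2.1 e; omega⟩
    have k1 : ∀ s, 0 < s → s ≤ m → α s ≠ x ∧ ¬ G.Adj (α s) x := fun s h0 hs =>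
      ⟨(hxα s hs).1.symm, fun e => by have := (hxα s hs).2.1 e.symm; omega⟩
    have k2 : ∀ s, 0 < s → s ≤ n → γ s ≠ x ∧ ¬ G.Adj (γ s) x := fun s h0 hs =>
      ⟨(hxγ s hs).1.symm, fun e => by have := (hxγ s hs).2.1 e.symm; omega⟩
    rintro _ (⟨s, h1, h2, rfl⟩ | ⟨s, h1, h2, rfl⟩) _ ((⟨t, h3, h4, rfl⟩ | rfl) | ⟨t, h3, h4, rfl⟩)
    · exact (h.pyr.legα.1.cut h1 (by omega) (by omega)).imp_right fun e e' => Or.inl (e e')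
    · exact (k1 s (by omega) (by omega)).imp_right fun e e' => absurd e' e
    · exact (key s t (by omega) (by omega) (by omega)).imp_right fun e e' => absurd e' e
    · exact ⟨(key t s (by omega) (by omega) (by omega)).1.symm, fun e' =>
        absurd e'.symm (key t s (by omega) (by omega) (by omega)).2⟩
    · exact (k2 s (by omega) (by omega)).imp_right fun e e' => absurd e' e
    · exact (h.pyr.legγ.1.cut h1 (by omega) (by omega)).imp_right fun e e' => Or.inr (e e')
  · rintro _ (⟨s, h1, h2, rfl⟩ | ⟨s, h1, h2, rfl⟩) <;> grind
  · rintro _ ((⟨t, h3, h4, rfl⟩ | rfl) | ⟨t, h3, h4, rfl⟩) <;> grind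

theorem no_prism (hC : MemC G) {X Y Z : Set V} {x₁ x₂ y₁ y₂ z₁ z₂ : V} (hX : Cn G X)
    (hY : Cn G Y) (hZ : Cn G Z) (hx₁ : x₁ ∈ X) (hx₂ : x₂ ∈ X) (hy₁ : y₁ ∈ Y) (hy₂ : y₂ ∈ Y)
    (hz₁ : z₁ ∈ Z) (hz₂ : z₂ ∈ Z) (hx : x₁ ≠ x₂) (hy : y₁ ≠ y₂) (hz : z₁ ≠ z₂)
    (hxy₁ : G.Adj x₁ y₁) (hxy₂ : G.Adj x₂ y₂) (hxz₁ : G.Adj x₁ z₁) (hxz₂ : G.Adj x₂ z₂)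
    (hyz₁ : G.Adj y₁ z₁) (hyz₂ : G.Adj y₂ z₂)
    (hXY : ∀ u ∈ X, ∀ v ∈ Y, u ≠ v ∧ (G.Adj u v → (u = x₁ ∧ v = y₁) ∨ (u = x₂ ∧ v = y₂)))
    (hXZ : ∀ u ∈ X, ∀ v ∈ Z, u ≠ v ∧ (G.Adj u v → (u = x₁ ∧ v = z₁) ∨ (u = x₂ ∧ v = z₂)))
    (hYZ : ∀ u ∈ Y, ∀ v ∈ Z, u ≠ v ∧ (G.Adj u v → (u = y₁ ∧ v = z₁) ∨ (u = y₂ ∧ v = z₂))) :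
    False := by
  refine hC.2.2.1 (hasPrism_of (a := ![x₁, y₁, z₁]) (b := ![x₂, y₂, z₂]) (X := ![X, Y, Z])
    ?_ ?_ ?_ ?_ ?_ ?_ ?_)
  · intro i; fin_cases i <;> assumption
  · intro i; fin_cases i <;> assumption
  · intro i; fin_cases i <;> assumption
  · intro i; fin_cases i <;> assumption
  · have := hxy₁.symm
    have := hxz₁.symm
    have := hyz₁.symm
    intro i j hij
    fin_cases i <;> fin_cases j <;> first | exact absurd rfl hij | assumption
  · have := hxy₂.symm
    have := hxz₂.symm
    have := hyz₂.symm
    intro i j hij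
    fin_cases i <;> fin_cases j <;> first | exact absurd rfl hij | assumption
  · have hsymm : ∀ {X Y : Set V} {x₁ x₂ y₁ y₂ : V},
        (∀ u ∈ X, ∀ v ∈ Y, u ≠ v ∧ (G.Adj u v → (u = x₁ ∧ v = y₁) ∨ (u = x₂ ∧ v = y₂))) →
        (∀ u ∈ Y, ∀ v ∈ X, u ≠ v ∧ (G.Adj u v → (u = y₁ ∧ v = x₁) ∨ (u = y₂ ∧ v = x₂))) := by
      intro X Y x₁ x₂ y₁ y₂ h u hu v hv
      have := h v hv u hu
      rw [G.adj_comm, and_comm (a := u = y₁), and_comm (a := u = y₂)]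
      exact ⟨this.1.symm, this.2⟩
    have := hsymm hXY
    have := hsymm hXZ
    have := hsymm hYZ
    intro i j hij
    fin_cases i <;> fin_cases j <;> first | exact absurd rfl hij | assumption

theorem Cross.miss (hC : MemC G) (h : Cross G x α m γ n δ r f l) (hl : 0 < l)
    (hδ : ∀ t ≤ l, ¬ G.Adj (f t) (δ r)) : False := by
  have h' := h.rev
  have no1 : ∀ p, 0 < p → p ≤ l → ¬ G.Adj (f p) (α m) := fun p hp hpl hpa =>
    h.no_late hC hp hpl hpa fun t _ ht => hδ t ht
  have no2 : ∀ p, p < l → ¬ G.Adj (f p) (γ n) := fun p hp hpa =>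
    h'.no_late hC (p := l - p) (by omega) (by omega)
      (by simpa [show l - (l - p) = p by omega] using hpa) fun t _ ht => hδ _ (by omega)
  obtain ⟨j, hj, hjγ⟩ := h.endγ
  obtain ⟨i, hi, hiα⟩ := h.startα
  obtain ⟨hαα, hγγ, hδδ, hff, hαγ, hαδ, hγδ, hfα, hfγ, hfδ⟩ := h.table
  have hx0 : G.Adj x (α 0) := (h.pyr.legα.2 0 (by omega)).2.2 rfl
  have hg0 : G.Adj x (γ 0) := (h.pyr.legγ.2 0 (by omega)).2.2 rfl
  have hadj := fun {u v} => G.adj_comm u v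
  have hxα := h.pyr.legα.2
  have hxγ := h.pyr.legγ.2
  have hfx := h.fx
  obtain ⟨a, ha0, ham, ha⟩ := h.pair hC (X := sg f 1 (l + 1) ∪ sg γ 0 n)
    ((h.ip.cn le_rfl).union (h.pyr.legγ.1.cn (by omega)) fun _ _ =>
      ⟨_, mem_sg (show 1 ≤ l by omega) (by omega), _, mem_sg (Nat.zero_le j) hj, hjγ⟩)
    (by rintro i hi _ (⟨t, h1, h2, rfl⟩ | ⟨t, h1, h2, rfl⟩) <;> grind)
    (by rintro i hi _ (⟨t, h1, h2, rfl⟩ | ⟨t, h1, h2, rfl⟩) <;> grind)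
    ⟨_, Or.inl (mem_sg le_rfl (by omega)), h.ip.step 0 hl⟩
    ⟨_, Or.inr (mem_sg (Nat.zero_le 0) (by omega)), hg0⟩ (hδ 0 (by omega))
  obtain ⟨b, hb0, hbn, hb⟩ := h'.pair hC (X := sg f 0 l ∪ sg α 0 m)
    ((h.ip.cn (by omega)).union (h.pyr.legα.1.cn (by omega)) fun _ _ =>
      ⟨_, mem_sg (Nat.zero_le 0) (by omega), _, mem_sg (Nat.zero_le i) hi, hiα⟩)
    (by rintro i hi _ (⟨t, h1, h2, rfl⟩ | ⟨t, h1, h2, rfl⟩) <;> grind)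
    (by rintro i hi _ (⟨t, h1, h2, rfl⟩ | ⟨t, h1, h2, rfl⟩) <;> grind)
    ⟨_, Or.inl (mem_sg (Nat.zero_le (l - 1)) (by omega)), by grind⟩
    ⟨_, Or.inr (mem_sg (Nat.zero_le 0) (by omega)), hx0⟩ (hδ _ (by omega))
  simp only [Nat.sub_zero] at hb
  refine no_prism hC (x₁ := f 0) (x₂ := f l) (y₁ := α (a + 1)) (y₂ := γ (b + 1))
    (z₁ := α a) (z₂ := γ b) (X := sg f 0 (l + 1))
    (Y := sg α (a + 1) (m + 1) ∪ sg γ (b + 1) (n + 1))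
    (Z := (sg α 0 (a + 1) ∪ {x}) ∪ sg γ 0 (b + 1)) (h.ip.cn le_rfl) ?_ ?_
    (mem_sg (Nat.zero_le _) (by omega)) (mem_sg (Nat.zero_le _) (by omega))
    (Or.inl (mem_sg le_rfl (by omega)))
    (Or.inr (mem_sg le_rfl (by omega))) (Or.inl (Or.inl (mem_sg (Nat.zero_le _) (by omega))))
    (Or.inr (mem_sg (Nat.zero_le _) (by omega))) ?_ ?_ ?_ ?_ ?_ ?_ ?_ ?_ ?_ ?_ ?_ ?_
  · exact (h.pyr.legα.1.cn le_rfl).union (h.pyr.legγ.1.cn le_rfl) fun _ _ =>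
      ⟨_, mem_sg (show a + 1 ≤ m by omega) (by omega), _,
        mem_sg (show b + 1 ≤ n by omega) (by omega), by grind⟩
  · refine ((h.pyr.legα.1.cn (by omega)).union (Cn.singleton x) fun _ _ =>
      ⟨_, mem_sg (Nat.zero_le 0) (by omega), _, rfl, hx0.symm⟩).union
      (h.pyr.legγ.1.cn (by omega)) fun _ _ => ⟨_, Or.inr rfl, _, mem_sg (Nat.zero_le 0) (by omega),
        hg0⟩
  iterate 9 grind
  · rintro _ ⟨s, h1, h2, rfl⟩ _ (⟨t, h3, h4, rfl⟩ | ⟨t, h3, h4, rfl⟩) <;> grind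
  · rintro _ ⟨s, h1, h2, rfl⟩ _ ((⟨t, h3, h4, rfl⟩ | rfl) | ⟨t, h3, h4, rfl⟩) <;> grind
  · have key : ∀ s t, s ≤ m → t ≤ n → (s < m ∨ t < n) → α s ≠ γ t ∧ ¬ G.Adj (α s) (γ t) :=
      fun s t hs ht hst => ⟨(hαγ s t hs ht).1, fun e => by
        have := (hαγ s t hs ht).2.1 e; omega⟩
    have k1 : ∀ s, 0 < s → s ≤ m → α s ≠ x ∧ ¬ G.Adj (α s) x := fun s h0 hs =>
      ⟨(hxα s hs).1.symm, fun e => by have := (hxα s hs).2.1 e.symm; omega⟩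
    have k2 : ∀ s, 0 < s → s ≤ n → γ s ≠ x ∧ ¬ G.Adj (γ s) x := fun s h0 hs =>
      ⟨(hxγ s hs).1.symm, fun e => by have := (hxγ s hs).2.1 e.symm; omega⟩
    rintro _ (⟨s, h1, h2, rfl⟩ | ⟨s, h1, h2, rfl⟩) _ ((⟨t, h3, h4, rfl⟩ | rfl) | ⟨t, h3, h4, rfl⟩)
    · exact (h.pyr.legα.1.cut h1 (by omega) (by omega)).imp_right fun e e' => Or.inl (e e')
    · exact (k1 s (by omega) (by omega)).imp_right fun e e' => absurd e' e
    · exact (key s t (by omega) (by omega) (by omega)).imp_right fun e e' => absurd e' e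
    · exact ⟨(key t s (by omega) (by omega) (by omega)).1.symm, fun e' =>
        absurd e'.symm (key t s (by omega) (by omega) (by omega)).2⟩
    · exact (k2 s (by omega) (by omega)).imp_right fun e e' => absurd e' e
    · exact (h.pyr.legγ.1.cut h1 (by omega) (by omega)).imp_right fun e e' => Or.inr (e e')
end

section
variable {V : Type} {G : SimpleGraph V} {x : V} {α γ δ f : ℕ → V} {m n r l : ℕ}

/-- The third base vertex of a pyramid sees exactly one edge of a crossing path. -/
theorem Cross.edge (hC : MemC G) (h : Cross G x α m γ n δ r f l) :
    ∃ i < l, (∀ t ≤ l, (G.Adj (f t) (δ r) ↔ t = i ∨ t = i + 1)) ∧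
      (G.Adj (f (i + 1)) (α m) ∨ G.Adj (f i) (γ n)) := by
  have h' := h.rev
  by_cases hnone : ∀ t ≤ l, ¬ G.Adj (f t) (δ r)
  · rcases Nat.eq_zero_or_pos l with rfl | hl
    · exact (h.miss_zero hC (hnone 0 le_rfl)).elim
    · exact (h.miss hC hl hnone).elim
  push Not at hnone
  obtain ⟨t₀, ht₀, hadj₀⟩ := hnone
  obtain ⟨i, hi, hPi, hmin⟩ := exists_first (P := fun t => G.Adj (f t) (δ r)) hadj₀
  obtain ⟨i', hi', hii', hPi', hmax⟩ := exists_last (P := fun t => G.Adj (f t) (δ r))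
    (l := l) (t := i) (by omega) hPi
  obtain ⟨q, hq, hqγ⟩ := h.endγ
  obtain ⟨p, hp, hpα⟩ := h.startα
  obtain ⟨hαα, hγγ, hδδ, hff, hαγ, hαδ, hγδ, hfα, hfγ, hfδ⟩ := h.table
  have hx0 : G.Adj x (α 0) := (h.pyr.legα.2 0 (by omega)).2.2 rfl
  have hg0 : G.Adj x (γ 0) := (h.pyr.legγ.2 0 (by omega)).2.2 rfl
  have hd0 : G.Adj x (δ 0) := (h.pyr.legδ.2 0 (by omega)).2.2 rfl
  have hff' : ∀ s t, s + 1 < t → t ≤ l → f s ≠ f t ∧ ¬ G.Adj (f s) (f t) :=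
    fun s t hs ht => ⟨fun e => by have := (hff s t (by omega) ht).1 e; omega,
      fun e => by have := (hff s t (by omega) ht).2.1 e; omega⟩
  have hαγ' : ∀ s t, s ≤ m → t ≤ n → (s < m ∨ t < n) → α s ≠ γ t ∧ ¬ G.Adj (α s) (γ t) :=
    fun s t hs ht hst => ⟨(hαγ s t hs ht).1, fun e => by have := (hαγ s t hs ht).2.1 e; omega⟩
  have hαδ' : ∀ s t, s ≤ m → t ≤ r → (s < m ∨ t < r) → α s ≠ δ t ∧ ¬ G.Adj (α s) (δ t) :=
    fun s t hs ht hst => ⟨(hαδ s t hs ht).1, fun e => by have := (hαδ s t hs ht).2.1 e; omega⟩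
  have hγδ' : ∀ s t, s ≤ n → t ≤ r → (s < n ∨ t < r) → γ s ≠ δ t ∧ ¬ G.Adj (γ s) (δ t) :=
    fun s t hs ht hst => ⟨(hγδ s t hs ht).1, fun e => by have := (hγδ s t hs ht).2.1 e; omega⟩
  have hfγ' : ∀ s t, s < l → t < n → f s ≠ γ t ∧ ¬ G.Adj (f s) (γ t) := fun s t hs ht =>
    ⟨(hfγ s t hs.le ht.le).1, fun e => by have := (hfγ s t hs.le ht.le).2 e; omega⟩
  have hαf' : ∀ s t, s < m → 0 < t → t ≤ l → α s ≠ f t ∧ ¬ G.Adj (α s) (f t) :=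
    fun s t hs h0 ht => ⟨(hfα t s ht hs.le).1.symm, fun e => by
      have := (hfα t s ht hs.le).2 e.symm; omega⟩
  have hfδ' : ∀ s t, s ≤ l → t ≤ r → (t < r ∨ s < i ∨ i' < s) → f s ≠ δ t ∧ ¬ G.Adj (f s) (δ t) :=
    fun s t hs ht hst => ⟨(hfδ s t hs ht).1, fun e => by
      have e1 := (hfδ s t hs ht).2 e
      rcases hst with h1 | h1 | h1
      · omega
      · subst e1; exact hmin s h1 e
      · subst e1; exact hmax s hs h1 e⟩
  have hδx : r ≠ 0 → ¬ G.Adj (δ r) x := fun h0 e => h0 ((h.pyr.legδ.2 r le_rfl).2.1 e.symm)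
  rcases Nat.lt_or_ge (i + 1) i' with hgap | hgap
  · exfalso
    have hr : r ≠ 0 := fun h0 => by
      have := h.consec h0 i (by omega) i' hi' hPi.symm hPi'.symm; omega
    refine no_theta hC (a := δ r) (b := x) (h.pyr.legδ.2 r le_rfl).1.symm (hδx hr)
      ((h.ip.cn (i := 0) (j := i + 1) (by omega)).union
        (h.pyr.legα.1.cn (i := 0) (j := m) (by omega)) fun _ _ =>
        ⟨_, mem_sg (Nat.zero_le 0) (by omega), _, mem_sg (Nat.zero_le p) hp, hpα⟩)
      ((h.ip.cn (i := i') (j := l + 1) le_rfl).union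
        (h.pyr.legγ.1.cn (i := 0) (j := n) (by omega)) fun _ _ =>
        ⟨_, mem_sg hi' (by omega), _, mem_sg (Nat.zero_le q) hq, hqγ⟩)
      (h.pyr.legδ.1.cn (i := 0) (j := r) (by omega))
      ⟨_, Or.inl (mem_sg (Nat.zero_le i) (by omega)), hPi.symm⟩
      ⟨_, Or.inr (mem_sg (Nat.zero_le 0) (by omega)), hx0⟩
      ⟨_, Or.inl (mem_sg le_rfl (by omega)), hPi'.symm⟩
      ⟨_, Or.inr (mem_sg (Nat.zero_le 0) (by omega)), hg0⟩
      ⟨_, mem_sg (Nat.zero_le (r - 1)) (by omega), (hδδ r (r - 1) (by omega) (by omega)).2.2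
        (by omega)⟩
      ⟨_, mem_sg (Nat.zero_le 0) (by omega), hd0⟩
      (anti_union_left (anti_union_right (anti_sg fun s t _ _ _ _ => hff' s t (by omega) (by omega))
        (anti_sg fun s t _ _ _ _ => hfγ' s t (by omega) (by omega)))
        (anti_union_right (anti_sg fun s t _ _ _ _ => hαf' s t (by omega) (by omega) (by omega))
          (anti_sg fun s t _ _ _ _ => hαγ' s t (by omega) (by omega) (by omega))))
      (anti_union_left (anti_sg fun s t _ _ _ _ => hfδ' s t (by omega) (by omega) (by omega))
        (anti_sg fun s t _ _ _ _ => hαδ' s t (by omega) (by omega) (by omega)))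
      (anti_union_left (anti_sg fun s t _ _ _ _ => hfδ' s t (by omega) (by omega) (by omega))
        (anti_sg fun s t _ _ _ _ => hγδ' s t (by omega) (by omega) (by omega)))
  rcases Nat.lt_or_ge i i' with hlt | hge
  · obtain rfl : i' = i + 1 := by omega
    refine ⟨i, by omega, fun t ht => ⟨fun e => ?_, ?_⟩, ?_⟩
    · by_contra hc
      have h1 : ¬ t < i := fun h => hmin t h e
      have h2 : ¬ i + 1 < t := fun h => hmax t ht h e
      omega
    · rintro (rfl | rfl) <;> assumption
    by_contra hcon
    push Not at hcon
    have no1 : ∀ p, i < p → p ≤ l → ¬ G.Adj (α m) (f p) := by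
      intro p hp hpl hpa
      rcases Nat.eq_or_lt_of_le (show i + 1 ≤ p from hp) with h1 | h1
      · subst h1; exact hcon.1 hpa.symm
      · exact h.no_late hC (by omega) hpl hpa.symm fun t h2 h3 => hmax t h3 (by omega)
    have no2 : ∀ p, p ≤ i → ¬ G.Adj (f p) (γ n) := by
      intro p hp hpa
      rcases Nat.eq_or_lt_of_le hp with h1 | h1
      · subst h1; exact hcon.2 hpa
      · exact h'.no_late hC (p := l - p) (by omega) (by omega)
          (by simpa [show l - (l - p) = p by omega] using hpa)
          fun t h2 h3 => hmin (l - t) (by omega)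
    have hαf : ∀ s t, s ≤ m → i < t → t ≤ l → α s ≠ f t ∧ ¬ G.Adj (α s) (f t) := by
      intro s t hs hit ht
      rcases Nat.eq_or_lt_of_le hs with h1 | h1
      · subst h1; exact ⟨(hfα t s ht le_rfl).1.symm, no1 t hit ht⟩
      · exact hαf' s t h1 (by omega) ht
    have hfγ'' : ∀ s t, s ≤ i → t ≤ n → f s ≠ γ t ∧ ¬ G.Adj (f s) (γ t) := by
      intro s t hs ht
      rcases Nat.eq_or_lt_of_le ht with h1 | h1
      · subst h1; exact ⟨(hfγ s t (by omega) le_rfl).1, no2 s hs⟩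
      · exact hfγ' s t (by omega) h1
    rcases Nat.eq_zero_or_pos r with hr | hr
    · refine no_even_wheel hC (v := δ r) (p₁ := α m) (p₂ := f i) (r₁ := γ n) (r₂ := f (i + 1))
        (X := sg α 0 (m + 1) ∪ sg f 0 (i + 1)) (Y := sg γ 0 (n + 1) ∪ sg f (i + 1) (l + 1))
        ((h.pyr.legα.1.cn le_rfl).union (h.ip.cn (by omega)) fun _ _ =>
          ⟨_, mem_sg (Nat.zero_le p) (by omega), _, mem_sg (Nat.zero_le 0) (by omega), hpα.symm⟩)
        ((h.pyr.legγ.1.cn le_rfl).union (h.ip.cn (by omega)) fun _ _ =>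
          ⟨_, mem_sg (Nat.zero_le q) (by omega), _, mem_sg hi' (by omega), hqγ.symm⟩)
        (Or.inl (mem_sg (Nat.zero_le m) (by omega))) (Or.inr (mem_sg (Nat.zero_le i) (by omega)))
        (Or.inl (mem_sg (Nat.zero_le n) (by omega))) (Or.inr (mem_sg le_rfl (by omega)))
        (hfα _ _ (by omega) le_rfl).1.symm (hfγ _ _ hi' le_rfl).1.symm
        ((hαγ m n le_rfl le_rfl).2.2 ⟨rfl, rfl⟩) (h.ip.step i (by omega))
        ((hαδ m r le_rfl le_rfl).2.2 ⟨rfl, rfl⟩).symm hPi.symm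
        ((hγδ n r le_rfl le_rfl).2.2 ⟨rfl, rfl⟩).symm hPi'.symm ?_ ?_ ?_
      · rintro _ (⟨s, h1, h2, rfl⟩ | ⟨s, h1, h2, rfl⟩) _ (⟨t, h3, h4, rfl⟩ | ⟨t, h3, h4, rfl⟩)
        · refine ⟨(hαγ s t (by omega) (by omega)).1, fun e => ?_⟩
          obtain ⟨rfl, rfl⟩ := (hαγ s t (by omega) (by omega)).2.1 e
          exact Or.inl ⟨rfl, rfl⟩
        · exact (hαf s t (by omega) (by omega) (by omega)).imp_right fun e e' => absurd e' e
        · exact (hfγ'' s t (by omega) (by omega)).imp_right fun e e' => absurd e' e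
        · refine ⟨fun e => ?_, fun e => ?_⟩
          · have := (hff s t (by omega) (by omega)).1 e; omega
          · have := (hff s t (by omega) (by omega)).2.1 e
            obtain ⟨rfl, rfl⟩ : s = i ∧ t = i + 1 := by omega
            exact Or.inr ⟨rfl, rfl⟩
      · rintro _ (⟨s, h1, h2, rfl⟩ | ⟨s, h1, h2, rfl⟩)
        · refine ⟨(hαδ s r (by omega) (by omega)).1.symm, fun e => ?_⟩
          obtain ⟨rfl, -⟩ := (hαδ s r (by omega) (by omega)).2.1 e.symm
          exact Or.inl rfl
        · refine ⟨(hfδ s r (by omega) (by omega)).1.symm, fun e => Or.inr ?_⟩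
          obtain rfl : s = i := by
            have h1 : ¬ s < i := fun h => hmin s h e.symm
            omega
          rfl
      · rintro _ (⟨s, h1, h2, rfl⟩ | ⟨s, h1, h2, rfl⟩)
        · refine ⟨(hγδ s r (by omega) (by omega)).1.symm, fun e => ?_⟩
          obtain ⟨rfl, -⟩ := (hγδ s r (by omega) (by omega)).2.1 e.symm
          exact Or.inl rfl
        · refine ⟨(hfδ s r (by omega) (by omega)).1.symm, fun e => Or.inr ?_⟩
          obtain rfl : s = i + 1 := by
            have h1 : ¬ i + 1 < s := fun h => hmax s (by omega) h e.symm
            omega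
          rfl
    · refine no_theta hC (a := δ r) (b := x) (h.pyr.legδ.2 r le_rfl).1.symm (hδx (by omega))
        (h.pyr.legα.1.cn (i := 0) (j := m + 1) (by omega))
        ((h.ip.cn (i := i + 1) (j := l + 1) le_rfl).union
          (h.pyr.legγ.1.cn (i := 0) (j := n) (by omega)) fun _ _ =>
          ⟨_, mem_sg hi' (by omega), _, mem_sg (Nat.zero_le q) hq, hqγ⟩)
        (h.pyr.legδ.1.cn (i := 0) (j := r) (by omega))
        ⟨_, mem_sg (Nat.zero_le m) (by omega), ((hαδ m r le_rfl le_rfl).2.2 ⟨rfl, rfl⟩).symm⟩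
        ⟨_, mem_sg (Nat.zero_le 0) (by omega), hx0⟩
        ⟨_, Or.inl (mem_sg le_rfl (by omega)), hPi'.symm⟩
        ⟨_, Or.inr (mem_sg (Nat.zero_le 0) (by omega)), hg0⟩
        ⟨_, mem_sg (Nat.zero_le (r - 1)) (by omega), (hδδ r (r - 1) (by omega) (by omega)).2.2
          (by omega)⟩
        ⟨_, mem_sg (Nat.zero_le 0) (by omega), hd0⟩
        (anti_union_right (anti_sg fun s t _ _ _ _ => hαf s t (by omega) (by omega) (by omega))
          (anti_sg fun s t _ _ _ _ => hαγ' s t (by omega) (by omega) (by omega)))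
        (anti_sg fun s t _ _ _ _ => hαδ' s t (by omega) (by omega) (by omega))
        (anti_union_left (anti_sg fun s t _ _ _ _ => hfδ' s t (by omega) (by omega) (by omega))
          (anti_sg fun s t _ _ _ _ => hγδ' s t (by omega) (by omega) (by omega)))
  · exfalso
    obtain rfl : i' = i := by omega
    refine no_theta hC (a := f i') (b := x) (h.fx i' hi').1.symm
      (fun e => (h.fx i' hi').2 e.symm)
      ((h.ip.cn (i := 0) (j := i') (by omega)).union
        (h.pyr.legα.1.cn (i := 0) (j := m) (by omega)) fun h1 _ => ?_)
      ((h.ip.cn (i := i' + 1) (j := l + 1) le_rfl).union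
        (h.pyr.legγ.1.cn (i := 0) (j := n) (by omega)) fun h1 _ => ?_)
      (h.pyr.legδ.1.cn (i := 0) (j := r + 1) (by omega))
      ?_ ⟨_, Or.inr (mem_sg (Nat.zero_le 0) (by omega)), hx0⟩
      ?_ ⟨_, Or.inr (mem_sg (Nat.zero_le 0) (by omega)), hg0⟩
      ⟨_, mem_sg (Nat.zero_le r) (by omega), hPi'⟩
      ⟨_, mem_sg (Nat.zero_le 0) (by omega), hd0⟩
      (anti_union_left (anti_union_right (anti_sg fun s t _ _ _ _ => hff' s t (by omega) (by omega))
        (anti_sg fun s t _ _ _ _ => hfγ' s t (by omega) (by omega)))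
        (anti_union_right (anti_sg fun s t _ _ _ _ => hαf' s t (by omega) (by omega) (by omega))
          (anti_sg fun s t _ _ _ _ => hαγ' s t (by omega) (by omega) (by omega))))
      (anti_union_left (anti_sg fun s t _ _ _ _ => hfδ' s t (by omega) (by omega) (by omega))
        (anti_sg fun s t _ _ _ _ => hαδ' s t (by omega) (by omega) (by omega)))
      (anti_union_left (anti_sg fun s t _ _ _ _ => hfδ' s t (by omega) (by omega) (by omega))
        (anti_sg fun s t _ _ _ _ => hγδ' s t (by omega) (by omega) (by omega)))
    · obtain ⟨_, t, h2, h3, -⟩ := h1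
      exact ⟨_, mem_sg (Nat.zero_le 0) (by omega), _, mem_sg (Nat.zero_le p) hp, hpα⟩
    · obtain ⟨_, t, h2, h3, -⟩ := h1
      exact ⟨_, mem_sg (show i' + 1 ≤ l by omega) (by omega), _, mem_sg (Nat.zero_le q) hq, hqγ⟩
    · rcases Nat.eq_zero_or_pos i' with h0 | h0
      · subst h0; exact ⟨_, Or.inr (mem_sg (Nat.zero_le p) hp), hpα⟩
      · exact ⟨_, Or.inl (mem_sg (Nat.zero_le (i' - 1)) (by omega)),
          (hff _ _ hi' (by omega)).2.2 (by omega)⟩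
    · rcases Nat.eq_or_lt_of_le hi' with h0 | h0
      · subst h0; exact ⟨_, Or.inr (mem_sg (Nat.zero_le q) hq), hqγ⟩
      · exact ⟨_, Or.inl (mem_sg le_rfl (by omega)), (hff _ _ hi' (by omega)).2.2 (by omega)⟩

end

/-- Ramsey's theorem for pairs: among sufficiently many indices, all of whose pairs satisfy one of
`C` relations, there are `k` all of whose pairs satisfy the same relation. -/
theorem exists_ramsey (C k : ℕ) : ∃ N, ∀ R : Fin (C + 1) → ℕ → ℕ → Prop,
    (∀ i j, i < j → j < N → ∃ c, R c i j) →
    ∃ (e : ℕ → ℕ) (c : Fin (C + 1)), (∀ a < k, e a < N) ∧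
      ∀ a b, a < b → b < k → e a < e b ∧ R c (e a) (e b) := by
  classical
  have key : ∀ s : ℕ, ∃ N, ∀ (R : Fin (C + 1) → ℕ → ℕ → Prop) (S : Finset ℕ),
      N ≤ S.card → (∀ i ∈ S, ∀ j ∈ S, i < j → ∃ c, R c i j) →
      ∃ (e : ℕ → ℕ) (d : ℕ → Fin (C + 1)), (∀ a < s, e a ∈ S) ∧
        ∀ a b, a < b → b < s → e a < e b ∧ R (d a) (e a) (e b) := by
    intro s
    induction s with
    | zero => exact ⟨0, fun _ _ _ _ => ⟨fun _ => 0, fun _ => 0, by simp, by simp⟩⟩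
    | succ s ih =>
      obtain ⟨N, hN⟩ := ih
      refine ⟨(C + 1) * N + 1, fun R S hS hR => ?_⟩
      have hne : S.Nonempty := Finset.card_pos.1 (by omega)
      let p := S.min' hne
      have hp : p ∈ S := S.min'_mem hne
      have hlt : ∀ j ∈ S.erase p, p < j := fun j hj =>
        lt_of_le_of_ne (S.min'_le j (Finset.mem_of_mem_erase hj)) (Finset.ne_of_mem_erase hj).symm
      have hcol : ∀ j, ∃ c, j ∈ S.erase p → R c p j := by
        intro j
        by_cases hj : j ∈ S.erase p
        · obtain ⟨c, hc⟩ := hR p hp j (Finset.mem_of_mem_erase hj) (hlt j hj)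
          exact ⟨c, fun _ => hc⟩
        · exact ⟨0, fun h => absurd h hj⟩
      choose col hcol using hcol
      obtain ⟨c, -, hc⟩ := Finset.exists_le_card_fiber_of_mul_le_card_of_maps_to
        (s := S.erase p) (t := Finset.univ) (f := col) (n := N) (fun _ _ => Finset.mem_univ _)
        Finset.univ_nonempty (by rw [Finset.card_erase_of_mem hp]; simp; omega)
      obtain ⟨e, d, he, hed⟩ := hN R _ hc fun i hi j hj =>
        hR i (Finset.mem_of_mem_erase (Finset.mem_filter.1 hi).1) j
          (Finset.mem_of_mem_erase (Finset.mem_filter.1 hj).1)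
      refine ⟨fun a => if a = 0 then p else e (a - 1), fun a => if a = 0 then c else d (a - 1),
        fun a ha => ?_, fun a b hab hb => ?_⟩
      · by_cases h0 : a = 0
        · simpa [h0] using hp
        · simp only [h0, if_false]
          exact Finset.mem_of_mem_erase (Finset.mem_filter.1 (he (a - 1) (by omega))).1
      · have hb0 : b ≠ 0 := by omega
        by_cases h0 : a = 0
        · have hm := Finset.mem_filter.1 (he (b - 1) (by omega))
          simp only [h0, hb0, if_true, if_false]
          refine ⟨hlt _ hm.1, ?_⟩
          have := hcol _ hm.1
          rwa [hm.2] at this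
        · simp only [h0, hb0, if_false]
          exact hed _ _ (by omega) (by omega)
  obtain ⟨N, hN⟩ := key ((C + 1) * k)
  refine ⟨N, fun R hR => ?_⟩
  obtain ⟨e, d, he, hed⟩ := hN R (Finset.range N) (by simp)
    fun i _ j hj hij => hR i j hij (Finset.mem_range.1 hj)
  obtain ⟨c, -, hc⟩ := Finset.exists_le_card_fiber_of_mul_le_card_of_maps_to
    (s := Finset.range ((C + 1) * k)) (t := Finset.univ) (f := d) (n := k)
    (fun _ _ => Finset.mem_univ _) Finset.univ_nonempty (by simp)
  obtain ⟨T, hT, hTc⟩ := Finset.exists_subset_card_eq hc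
  have hmem : ∀ i, T.orderEmbOfFin hTc i < (C + 1) * k ∧ d (T.orderEmbOfFin hTc i) = c := by
    intro i
    simpa using Finset.mem_filter.1 (hT (T.orderEmbOfFin_mem hTc i))
  refine ⟨fun a => if h : a < k then e (T.orderEmbOfFin hTc ⟨a, h⟩) else 0, c,
    fun a ha => ?_, fun a b hab hb => ?_⟩
  · simp only [ha, dif_pos]
    exact Finset.mem_range.1 (he _ (hmem _).1)
  · have ha : a < k := by omega
    simp only [ha, hb, dif_pos]
    have := hed (T.orderEmbOfFin hTc ⟨a, ha⟩) (T.orderEmbOfFin hTc ⟨b, hb⟩)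
      ((T.orderEmbOfFin hTc).strictMono hab) (hmem _).1
    rwa [(hmem _).2] at this

section
variable {V : Type} {G : SimpleGraph V}

theorem no_C4 (hC : MemC G) {a b c d : V} (hab : G.Adj a b) (hbc : G.Adj b c) (hcd : G.Adj c d)
    (hda : G.Adj d a) (hac : ¬ G.Adj a c) (hbd : ¬ G.Adj b d) (hac' : a ≠ c) (hbd' : b ≠ d) :
    False := by
  classical
  obtain ⟨H, hH, hsub, h1, h2, h3, h4⟩ := exists_hole (G := G) (X := {a} ∪ {b}) (Y := {d} ∪ {c})
    (p₁ := a) (p₂ := b) (r₁ := d) (r₂ := c)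
    ((Cn.singleton a).union (Cn.singleton b) fun _ _ => ⟨a, rfl, b, rfl, hab⟩)
    ((Cn.singleton d).union (Cn.singleton c) fun _ _ => ⟨d, rfl, c, rfl, hcd.symm⟩)
    (by simp) (by simp) (by simp) (by simp) hab.ne hcd.ne.symm hda.symm hbc (by
      have h1 := hda.ne.symm
      have h2 := hbc.ne
      rintro _ (rfl | rfl) _ (rfl | rfl)
      · exact ⟨h1, fun _ => Or.inl ⟨rfl, rfl⟩⟩
      · exact ⟨hac', fun h => absurd h hac⟩
      · exact ⟨hbd', fun h => absurd h hbd⟩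
      · exact ⟨h2, fun _ => Or.inr ⟨rfl, rfl⟩⟩)
  have e : H = (({a, b, d, c} : Finset V) : Set V) := by
    ext v
    constructor
    · intro hv
      have := hsub hv
      simp at this ⊢
      tauto
    · intro hv
      simp at hv
      rcases hv with rfl | rfl | rfl | rfl <;> assumption
  apply hC.1 H hH
  rw [e, Set.ncard_coe_finset]
  have := hda.ne.symm
  have := hcd.ne.symm
  have := hab.ne
  have := hbc.ne
  rw [Finset.card_insert_of_notMem, Finset.card_insert_of_notMem, Finset.card_insert_of_notMem,
      Finset.card_singleton] <;> simp [*]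

theorem no_clique {t : ℕ} (hG : G.CliqueFree t) {f : ℕ → V}
    (h : ∀ i j, i < j → j < t → G.Adj (f i) (f j)) : False := by
  classical
  have hadj : ∀ i < t, ∀ j < t, i ≠ j → G.Adj (f i) (f j) := by
    intro i hi j hj hij
    rcases lt_or_gt_of_ne hij with h' | h'
    · exact h i j h' hj
    · exact (h j i h' hi).symm
  refine hG ((Finset.range t).image f) ⟨?_, ?_⟩
  · intro a ha b hb hab
    simp only [Finset.coe_image, Finset.coe_range, mem_image, mem_Iio] at ha hb
    obtain ⟨i, hi, rfl⟩ := ha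
    obtain ⟨j, hj, rfl⟩ := hb
    exact hadj i hi j hj fun e => hab (by rw [e])
  · rw [Finset.card_image_of_injOn, Finset.card_range]
    intro i hi j hj e
    by_contra hij
    exact (hadj i (by simpa using hi) j (by simpa using hj) hij).ne e

/-- There are only boundedly many pairwise touching disjoint edges. -/
theorem exists_ladder_bound (t : ℕ) : ∃ N, ∀ {V : Type} {G : SimpleGraph V}, MemCt t G →
    ∀ z z' : ℕ → V, (∀ i < N, G.Adj (z i) (z' i)) →
    (∀ i < N, ∀ j < N, i ≠ j → z i ≠ z j ∧ z' i ≠ z' j) →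
    (∀ i j, i < j → j < N → G.Adj (z i) (z j) ∨ G.Adj (z' i) (z' j) ∨ G.Adj (z i) (z' j) ∨
      G.Adj (z' i) (z j)) → False := by
  obtain ⟨N, hN⟩ := exists_ramsey 3 (t + 3)
  refine ⟨N, fun {V} {G} hG z z' hzz hne htouch => ?_⟩
  obtain ⟨e, c, he, hec⟩ := hN ![fun i j => G.Adj (z i) (z j), fun i j => G.Adj (z' i) (z' j),
    fun i j => G.Adj (z i) (z' j) ∧ ¬ G.Adj (z i) (z j) ∧ ¬ G.Adj (z' i) (z' j),
    fun i j => G.Adj (z' i) (z j) ∧ ¬ G.Adj (z i) (z j) ∧ ¬ G.Adj (z' i) (z' j)] (by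
      intro i j hij hj
      by_cases h0 : G.Adj (z i) (z j)
      · exact ⟨0, h0⟩
      by_cases h1 : G.Adj (z' i) (z' j)
      · exact ⟨1, h1⟩
      rcases htouch i j hij hj with h | h | h | h
      · exact absurd h h0
      · exact absurd h h1
      · exact ⟨2, h, h0, h1⟩
      · exact ⟨3, h, h0, h1⟩)
  have h01 := hec 0 1 (by omega) (by omega)
  have h02 := hec 0 2 (by omega) (by omega)
  have h12 := hec 1 2 (by omega) (by omega)
  have hz1 := hzz (e 1) (he 1 (by omega))
  have d01 := hne (e 0) (he 0 (by omega)) (e 1) (he 1 (by omega)) h01.1.ne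
  have d12 := hne (e 1) (he 1 (by omega)) (e 2) (he 2 (by omega)) h12.1.ne
  fin_cases c
  · exact no_clique hG.2 fun i j hij hj => (hec i j hij (by omega)).2
  · exact no_clique hG.2 fun i j hij hj => (hec i j hij (by omega)).2
  · obtain ⟨a1, b1, c1⟩ := h01.2
    obtain ⟨a2, b2, c2⟩ := h02.2
    obtain ⟨a3, b3, c3⟩ := h12.2
    exact no_C4 hG.1 a1 hz1.symm a3 a2.symm b1 c3 d01.1 d12.2
  · obtain ⟨a1, b1, c1⟩ := h01.2
    obtain ⟨a2, b2, c2⟩ := h02.2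
    obtain ⟨a3, b3, c3⟩ := h12.2
    exact no_C4 hG.1 a1 hz1 a3 a2.symm c1 b3 d01.2 d12.1

end

/-- The path `α 0, …, α m, γ n, …, γ 0`. -/
def join {V : Type} (α : ℕ → V) (m : ℕ) (γ : ℕ → V) (n : ℕ) : ℕ → V :=
  fun t => if t ≤ m then α t else γ (m + 1 + n - t)

/-- An induced path `q 0, …, q N` of which `x` sees exactly the two ends. -/
def Spine {V : Type} (G : SimpleGraph V) (x : V) (q : ℕ → V) (N : ℕ) : Prop :=
  IP G q N ∧ ∀ t ≤ N, x ≠ q t ∧ (G.Adj x (q t) ↔ t = 0 ∨ t = N)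

section
variable {V : Type} {G : SimpleGraph V} {x : V} {α γ δ q : ℕ → V} {m n r N : ℕ}

theorem join_le {t : ℕ} (h : t ≤ m) : join α m γ n t = α t := if_pos h

theorem join_gt {t : ℕ} (h : m < t) : join α m γ n t = γ (m + 1 + n - t) := if_neg (by omega)

theorem join_cases {t : ℕ} (h : t ≤ m + n + 1) :
    (t ≤ m ∧ join α m γ n t = α t) ∨
      ∃ s ≤ n, t + s = m + 1 + n ∧ join α m γ n t = γ s := by
  by_cases ht : t ≤ m
  · exact Or.inl ⟨ht, join_le ht⟩
  · exact Or.inr ⟨m + 1 + n - t, by omega, by omega, join_gt (by omega)⟩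

theorem IP.joined (hα : IP G α m) (hγ : IP G γ n) (h : Ends G α m γ n) :
    IP G (join α m γ n) (m + n + 1) := by
  refine ⟨fun i hi j hj e => ?_, fun i hi j hj => ?_⟩
  · rcases join_cases (α := α) (γ := γ) hi with ⟨hi, ei⟩ | ⟨s, hs, hi, ei⟩ <;>
    rcases join_cases (α := α) (γ := γ) hj with ⟨hj, ej⟩ | ⟨t, ht, hj, ej⟩ <;> rw [ei, ej] at e
    · exact hα.1 i hi j hj e
    · exact absurd e (h i hi t ht).1
    · exact absurd e.symm (h j hj s hs).1
    · have := hγ.1 s hs t ht e; omega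
  · rcases join_cases (α := α) (γ := γ) hi with ⟨hi, ei⟩ | ⟨s, hs, hi, ei⟩ <;>
    rcases join_cases (α := α) (γ := γ) hj with ⟨hj, ej⟩ | ⟨t, ht, hj, ej⟩ <;> rw [ei, ej]
    · exact hα.2 i hi j hj
    · rw [(h i hi t ht).2]; omega
    · rw [G.adj_comm, (h j hj s hs).2]; omega
    · rw [hγ.2 s hs t ht]; omega

theorem Leg.joined (hα : Leg G x α m) (hγ : IP G γ n) (hx : ∀ t ≤ n, x ≠ γ t ∧ ¬ G.Adj x (γ t))
    (h : Ends G α m γ n) : Leg G x (join α m γ n) (m + n + 1) := by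
  refine ⟨hα.1.joined hγ h, fun i hi => ?_⟩
  rcases join_cases (α := α) (γ := γ) hi with ⟨hi, ei⟩ | ⟨s, hs, hi, ei⟩ <;> rw [ei]
  · exact hα.2 i hi
  · refine ⟨(hx s hs).1, fun h => absurd h (hx s hs).2, fun h => by omega⟩

theorem Leg.spine (hα : Leg G x α m) (hγ : Leg G x γ n) (h : Ends G α m γ n) :
    Spine G x (join α m γ n) (m + n + 1) := by
  refine ⟨hα.1.joined hγ.1 h, fun i hi => ?_⟩
  rcases join_cases (α := α) (γ := γ) hi with ⟨hi, ei⟩ | ⟨s, hs, hi, ei⟩ <;> rw [ei]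
  · refine ⟨(hα.2 i hi).1, (hα.2 i hi).2.trans ⟨Or.inl, fun h => by omega⟩⟩
  · refine ⟨(hγ.2 s hs).1, (hγ.2 s hs).2.trans ⟨fun h => by omega, fun h => by omega⟩⟩

theorem Leg.sub (hα : Leg G x α m) {k : ℕ} (h : k ≤ m) : Leg G x α k :=
  ⟨hα.1.sub h, fun i hi => hα.2 i (by omega)⟩

theorem Spine.rev (hq : Spine G x q N) : Spine G x (fun t => q (N - t)) N := by
  refine ⟨hq.1.rev, fun t ht => ?_⟩
  have := hq.2 (N - t) (by omega)
  exact ⟨this.1, this.2.trans (by omega)⟩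

theorem Spine.leg (hq : Spine G x q N) {k : ℕ} (h : k < N) : Leg G x q k := by
  refine ⟨hq.1.sub h.le, fun t ht => ?_⟩
  have := hq.2 t (by omega)
  exact ⟨this.1, this.2.trans (by omega)⟩

theorem Spine.ends (hq : Spine G x q N) {k : ℕ} (h : k < N) :
    Ends G q k (fun t => q (N - t)) (N - k - 1) := by
  refine fun i hi j hj => ⟨fun e => ?_, ?_⟩
  · have := hq.1.1 _ (by omega) _ (by omega) e; omega
  · rw [hq.1.2 _ (by omega) _ (by omega)]; omega

theorem Spine.pyr (hq : Spine G x q N) (hδ : Leg G x δ r)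
    (hd : ∀ t ≤ N, ∀ v ≤ r, q t ≠ δ v ∧ (v < r → ¬ G.Adj (q t) (δ v))) {k : ℕ} (hk : 0 < k)
    (hkN : k + 1 < N) (h : ∀ t ≤ N, (G.Adj (δ r) (q t) ↔ t = k ∨ t = k + 1)) :
    Pyr G x q k (fun t => q (N - t)) (N - k - 1) δ r := by
  have key : ∀ t ≤ N, ∀ v ≤ r, (G.Adj (q t) (δ v) ↔ (t = k ∨ t = k + 1) ∧ v = r) := by
    intro t ht v hv
    rcases Nat.lt_or_ge v r with hv' | hv'
    · exact ⟨fun e => absurd e ((hd t ht v hv).2 hv'), fun e => by omega⟩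
    · obtain rfl : v = r := by omega
      rw [G.adj_comm, h t ht]; simp
  refine ⟨hq.leg (by omega), hq.rev.leg (by omega), hδ, hq.ends (by omega),
    fun i hi j hj => ⟨(hd i (by omega) j hj).1, ?_⟩,
    fun i hi j hj => ⟨(hd (N - i) (by omega) j hj).1, ?_⟩⟩
  · rw [key i (by omega) j hj]; omega
  · rw [key (N - i) (by omega) j hj]; omega

/-- The centre of a wheel with three pairwise non-adjacent neighbours on the rim is a hub. -/
theorem isHub_of [Finite V] {H : Set V} {v a b c : V} (hH : IsHole G H) (hv : v ∉ H)
    (ha : a ∈ H) (hb : b ∈ H) (hc : c ∈ H) (hva : G.Adj v a) (hvb : G.Adj v b) (hvc : G.Adj v c)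
    (hab : a ≠ b) (hac : a ≠ c) (hbc : b ≠ c) (nab : ¬ G.Adj a b) (nac : ¬ G.Adj a c)
    (nbc : ¬ G.Adj b c) : IsHub G v := by
  have hmem : ∀ u, u = a ∨ u = b ∨ u = c → u ∈ holeNbrs G H v := by
    rintro u (rfl | rfl | rfl)
    · exact ⟨ha, hva⟩
    · exact ⟨hb, hvb⟩
    · exact ⟨hc, hvc⟩
  have hno : ∀ p q r : V, p ≠ q → holeNbrs G H v = {p, q, r} → ¬ G.Adj p q := by
    intro p q r hpq e hadj
    have h1 := hmem a (by simp)
    have h2 := hmem b (by simp)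
    have h3 := hmem c (by simp)
    rw [e] at h1 h2 h3
    simp only [mem_insert_iff, mem_singleton_iff] at h1 h2 h3
    have := hadj.symm
    grind
  refine ⟨H, ⟨hH, hv, ?_⟩, ?_, ?_⟩
  · have : ({a, b, c} : Set V).ncard = 3 := by
      rw [ncard_eq_three]; exact ⟨a, b, c, hab, hac, hbc, rfl⟩
    rw [← this]
    refine ncard_le_ncard (fun u hu => hmem u ?_) (toFinite _)
    simpa using hu
  · rintro ⟨-, p, q, r, hpq, -, -, e, h1, -⟩
    exact hno p q r hpq e h1
  · rintro ⟨-, p, q, r, hpq, -, -, e, h1, -⟩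
    exact hno p q r hpq e h1

theorem Spine.hole (hq : Spine G x q N) (hN : 2 ≤ N) :
    IsHole G (sg (fun t => if t ≤ N then q t else x) 0 (N + 2)) := by
  refine isHole_of_cycle (by omega) (fun i hi j hj e => ?_) (fun i hi j hj => ?_)
  · split_ifs at e with h1 h2 h2
    · exact hq.1.1 i h1 j h2 e
    · exact absurd e.symm (hq.2 i h1).1
    · exact absurd e (hq.2 j h2).1
    · omega
  · split_ifs with h1 h2 h2
    · rw [hq.1.2 i h1 j h2]; omega
    · rw [G.adj_comm, (hq.2 i h1).2]; omega
    · rw [(hq.2 j h2).2]; omega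
    · have : ¬ G.Adj x x := G.loopless.irrefl x
      exact ⟨fun e => absurd e this, fun e => by omega⟩

/-- A leg touching a spine only with its last vertex sees exactly two consecutive vertices. -/
theorem Spine.attach [Finite V] (hC : MemC G) (hq : Spine G x q N) (hδ : Leg G x δ r)
    (hd : ∀ t ≤ N, ∀ v ≤ r, q t ≠ δ v ∧ (v < r → ¬ G.Adj (q t) (δ v)))
    (ht : ∃ t ≤ N, G.Adj (δ r) (q t)) (h0 : ¬ G.Adj (δ r) (q 0)) (hN : ¬ G.Adj (δ r) (q N))
    (hub : r = 0 → ¬ IsHub G (δ 0)) :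
    ∃ k, 0 < k ∧ k + 1 < N ∧ ∀ t ≤ N, (G.Adj (δ r) (q t) ↔ t = k ∨ t = k + 1) := by
  obtain ⟨t, htN, hadj⟩ := ht
  obtain ⟨i, hi, hPi, hmin⟩ := exists_first (P := fun t => G.Adj (δ r) (q t)) hadj
  obtain ⟨j, hj, hij, hPj, hmax⟩ := exists_last (P := fun t => G.Adj (δ r) (q t))
    (l := N) (t := i) (by omega) hPi
  have hi0 : 0 < i := by
    rcases Nat.eq_zero_or_pos i with rfl | h
    · exact absurd hPi h0
    · exact h
  have hjN : j < N := by
    rcases Nat.eq_or_lt_of_le hj with rfl | h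
    · exact absurd hPj hN
    · exact h
  have hx0 : G.Adj x (q 0) := (hq.2 0 (by omega)).2.2 (Or.inl rfl)
  have hxN : G.Adj x (q N) := (hq.2 N le_rfl).2.2 (Or.inr rfl)
  have hd0 : G.Adj x (δ 0) := (hδ.2 0 (by omega)).2.2 rfl
  have hqq : ∀ s t, s + 1 < t → t ≤ N → q s ≠ q t ∧ ¬ G.Adj (q s) (q t) :=
    fun s t hs ht => ⟨fun e => by have := hq.1.1 s (by omega) t ht e; omega,
      fun e => by have := (hq.1.2 s (by omega) t ht).1 e; omega⟩
  have hqδ : ∀ s v, s ≤ N → v ≤ r → v < r ∨ s < i ∨ j < s → q s ≠ δ v ∧ ¬ G.Adj (q s) (δ v) := by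
    intro s v hs hv h
    refine ⟨(hd s hs v hv).1, fun e => ?_⟩
    rcases Nat.lt_or_ge v r with hv' | hv'
    · exact (hd s hs v hv).2 hv' e
    · obtain rfl : v = r := by omega
      rcases h with h | h | h
      · omega
      · exact hmin s h e.symm
      · exact hmax s hs h e.symm
  rcases Nat.lt_or_ge (i + 1) j with h | h
  · exfalso
    rcases Nat.eq_zero_or_pos r with rfl | hr
    · refine hub rfl (isHub_of (hq.hole (by omega)) (a := x) (b := q i) (c := q j) ?_
        ⟨N + 1, by omega, by omega, by simp⟩ ⟨i, by omega, by omega, if_pos (by omega)⟩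
        ⟨j, by omega, by omega, if_pos (by omega)⟩ hd0.symm hPi hPj (hq.2 i (by omega)).1
        (hq.2 j (by omega)).1 (hqq i j h hj).1 ?_ ?_ (hqq i j h hj).2)
      · rintro ⟨s, -, hs, e⟩
        dsimp only at e
        split_ifs at e with h1
        · exact (hd s h1 0 le_rfl).1 e
        · exact (hδ.2 0 le_rfl).1 e
      · rw [(hq.2 i (by omega)).2]; omega
      · rw [(hq.2 j (by omega)).2]; omega
    · refine no_theta hC (a := δ r) (b := x) (hδ.2 r le_rfl).1.symm ?_
        (hq.1.cn (i := 0) (j := i + 1) (by omega)) (hq.1.cn (i := j) (j := N + 1) le_rfl)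
        (hδ.1.cn (i := 0) (j := r) (by omega))
        ⟨_, mem_sg (Nat.zero_le i) (by omega), hPi⟩
        ⟨_, mem_sg (Nat.zero_le 0) (by omega), hx0⟩
        ⟨_, mem_sg le_rfl (by omega), hPj⟩
        ⟨_, mem_sg hj (by omega), hxN⟩
        ⟨_, mem_sg (Nat.zero_le (r - 1)) (by omega), ?_⟩
        ⟨_, mem_sg (Nat.zero_le 0) (by omega), hd0⟩
        (anti_sg fun s t _ _ _ _ => hqq s t (by omega) (by omega))
        (anti_sg fun s t _ _ _ _ => hqδ s t (by omega) (by omega) (by omega))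
        (anti_sg fun s t _ _ _ _ => hqδ s t (by omega) (by omega) (by omega))
      · rw [G.adj_comm, (hδ.2 r le_rfl).2]; omega
      · rw [hδ.1.2 r le_rfl _ (by omega)]; omega
  rcases Nat.lt_or_ge i j with h' | h'
  · obtain rfl : j = i + 1 := by omega
    refine ⟨i, hi0, by omega, fun t ht => ⟨fun hadj => ?_, ?_⟩⟩
    · by_contra hc
      have h1 : ¬ t < i := fun h => hmin t h hadj
      have h2 : ¬ i + 1 < t := fun h => hmax t ht h hadj
      omega
    · rintro (rfl | rfl) <;> assumption
  · exfalso
    obtain rfl : j = i := by omega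
    refine no_theta hC (a := q j) (b := x) (hq.2 j hj).1.symm ?_
        (hq.1.cn (i := 0) (j := j) (by omega)) (hq.1.cn (i := j + 1) (j := N + 1) le_rfl)
        (hδ.1.cn (i := 0) (j := r + 1) (by omega))
        ⟨_, mem_sg (Nat.zero_le (j - 1)) (by omega), ?_⟩
        ⟨_, mem_sg (Nat.zero_le 0) (by omega), hx0⟩
        ⟨_, mem_sg le_rfl (by omega), ?_⟩
        ⟨_, mem_sg (show j + 1 ≤ N by omega) (by omega), hxN⟩
        ⟨_, mem_sg (Nat.zero_le r) (by omega), hPj.symm⟩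
        ⟨_, mem_sg (Nat.zero_le 0) (by omega), hd0⟩
        (anti_sg fun s t _ _ _ _ => hqq s t (by omega) (by omega))
        (anti_sg fun s t _ _ _ _ => hqδ s t (by omega) (by omega) (by omega))
        (anti_sg fun s t _ _ _ _ => hqδ s t (by omega) (by omega) (by omega))
    · rw [G.adj_comm, (hq.2 j hj).2]; omega
    · rw [hq.1.2 _ (by omega) _ (by omega)]; omega
    · rw [hq.1.2 _ (by omega) _ (by omega)]; omega

end

section
variable {V : Type} {G : SimpleGraph V} {x : V} {α γ δ f g : ℕ → V} {m n r l p e e' : ℕ}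

theorem Pyr.reroute (h : Cross G x α m γ n δ r f l) (he : e < l)
    (hfe : ∀ t ≤ l, (G.Adj (f t) (δ r) ↔ t = e ∨ t = e + 1)) {v y : ℕ} (hv : v < m)
    (hvf : G.Adj (f 0) (α v)) (hvmin : ∀ s < v, ¬ G.Adj (f 0) (α s)) (hy : y < n)
    (hyf : G.Adj (f l) (γ y)) (hymin : ∀ s < y, ¬ G.Adj (f l) (γ s)) :
    Pyr G x (join α v (fun t => f (e - t)) e) (v + e + 1)
      (join γ y (fun t => f (e + 1 + t)) (l - e - 1)) (y + (l - e - 1) + 1) δ r := by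
  have hfα : ∀ i ≤ v, ∀ t ≤ l, α i ≠ f t ∧ (G.Adj (α i) (f t) ↔ i = v ∧ t = 0) := by
    intro i hi t ht
    refine ⟨(h.fα t ht i (by omega)).symm, fun e => ?_, ?_⟩
    · obtain rfl := h.onlyα t ht i (by omega) e.symm
      refine ⟨?_, rfl⟩
      by_contra hc
      exact hvmin i (by omega) e.symm
    · rintro ⟨rfl, rfl⟩; exact hvf.symm
  have hfγ : ∀ i ≤ y, ∀ t ≤ l, γ i ≠ f t ∧ (G.Adj (γ i) (f t) ↔ i = y ∧ t = l) := by
    intro i hi t ht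
    refine ⟨(h.fγ t ht i (by omega)).symm, fun e => ?_, ?_⟩
    · obtain rfl := h.onlyγ t ht i (by omega) e.symm
      refine ⟨?_, rfl⟩
      by_contra hc
      exact hymin i (by omega) e.symm
    · rintro ⟨rfl, rfl⟩; exact hyf.symm
  have hfδ : ∀ t ≤ l, ∀ i ≤ r, f t ≠ δ i ∧ (G.Adj (f t) (δ i) ↔ (t = e ∨ t = e + 1) ∧ i = r) := by
    intro t ht i hi
    refine ⟨h.fδ t ht i hi, ?_⟩
    rcases Nat.lt_or_ge i r with hv' | hv'
    · exact ⟨fun e => absurd e (h.δlt t ht i hv'), fun e => by omega⟩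
    · obtain rfl : i = r := by omega
      rw [hfe t ht]; simp
  refine ⟨(h.pyr.legα.sub hv.le).joined (h.ip.sub he.le).rev (fun t ht => h.fx _ (by omega)) ?_,
    (h.pyr.legγ.sub hy.le).joined (h.ip.shift (by omega)) (fun t ht => h.fx _ (by omega)) ?_,
    h.pyr.legδ, ?_, ?_, ?_⟩
  · intro i hi j hj
    have := hfα i hi (e - j) (by omega)
    exact ⟨this.1, this.2.trans (by omega)⟩
  · intro i hi j hj
    have := hfγ i hi (e + 1 + j) (by omega)
    exact ⟨this.1, this.2.trans (by omega)⟩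
  · intro i hi j hj
    rcases join_cases (α := α) (γ := fun t => f (e - t)) hi with ⟨hi, ei⟩ | ⟨s, hs, hi, ei⟩ <;>
    rcases join_cases (α := γ) (γ := fun t => f (e + 1 + t)) hj with ⟨hj, ej⟩ | ⟨t, ht, hj, ej⟩ <;>
    rw [ei, ej]
    · have := h.pyr.αγ i (by omega) j (by omega)
      exact ⟨this.1, this.2.trans (by omega)⟩
    · have := hfα i hi (e + 1 + t) (by omega)
      exact ⟨this.1, this.2.trans (by omega)⟩
    · have := hfγ j hj (e - s) (by omega)
      rw [G.adj_comm]
      exact ⟨this.1.symm, this.2.trans (by omega)⟩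
    · refine ⟨fun e => ?_, ?_⟩
      · have := h.ip.1 _ (by omega) _ (by omega) e; omega
      · rw [h.ip.2 _ (by omega) _ (by omega)]; omega
  · intro i hi j hj
    rcases join_cases (α := α) (γ := fun t => f (e - t)) hi with ⟨hi, ei⟩ | ⟨s, hs, hi, ei⟩ <;>
    rw [ei]
    · have := h.pyr.αδ i (by omega) j (by omega)
      exact ⟨this.1, this.2.trans (by omega)⟩
    · have := hfδ (e - s) (by omega) j hj
      exact ⟨this.1, this.2.trans (by omega)⟩
  · intro i hi j hj
    rcases join_cases (α := γ) (γ := fun t => f (e + 1 + t)) hi with ⟨hi, ei⟩ | ⟨s, hs, hi, ei⟩ <;>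
    rw [ei]
    · have := h.pyr.γδ i (by omega) j (by omega)
      exact ⟨this.1, this.2.trans (by omega)⟩
    · have := hfδ (e + 1 + s) (by omega) j hj
      exact ⟨this.1, this.2.trans (by omega)⟩

/-- Disjoint crossings of a pyramid have touching middle edges. -/
theorem Cross.touch (hC : MemC G) (h : Cross G x α m γ n δ r f l)
    (h' : Cross G x α m γ n δ r g p) (hr : 0 < r) (he : e < l)
    (hfe : ∀ t ≤ l, (G.Adj (f t) (δ r) ↔ t = e ∨ t = e + 1))
    (hge : ∀ t ≤ p, (G.Adj (g t) (δ r) ↔ t = e' ∨ t = e' + 1))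
    (hfg : ∀ s ≤ l, ∀ t ≤ p, f s ≠ g t) :
    G.Adj (f e) (g e') ∨ G.Adj (f (e + 1)) (g (e' + 1)) ∨ G.Adj (f e) (g (e' + 1)) ∨
      G.Adj (f (e + 1)) (g e') := by
  obtain ⟨v₀, hv₀, hvf₀⟩ := h.startα
  obtain ⟨v, hv, hvf, hvmin⟩ := exists_first (P := fun s => G.Adj (f 0) (α s)) hvf₀
  obtain ⟨y₀, hy₀, hyf₀⟩ := h.endγ
  obtain ⟨y, hy, hyf, hymin⟩ := exists_first (P := fun s => G.Adj (f l) (γ s)) hyf₀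
  obtain ⟨w, hw, hwg⟩ := h'.startα
  obtain ⟨z, hz, hzg⟩ := h'.endγ
  have hP := Pyr.reroute h he hfe (by omega) hvf hvmin (by omega) hyf hymin
  have hv0 : 0 < v := by
    rcases Nat.eq_zero_or_pos v with rfl | h0
    · exact absurd hvf (h.α0 0 (by omega))
    · exact h0
  have hy0 : 0 < y := by
    rcases Nat.eq_zero_or_pos y with rfl | h0
    · exact absurd hyf (h.γ0 l (by omega))
    · exact h0
  set α' := join α v (fun t => f (e - t)) e with hα'
  set γ' := join γ y (fun t => f (e + 1 + t)) (l - e - 1) with hγ'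
  have eα : α' (v + e + 1) = f e := by
    rw [hα', join_gt (by omega)]; congr 1; omega
  have eγ : γ' (y + (l - e - 1) + 1) = f (e + 1) := by
    rw [hγ', join_gt (by omega)]; congr 1; omega
  have eα0 : α' 0 = α 0 := join_le (Nat.zero_le _)
  have eγ0 : γ' 0 = γ 0 := join_le (Nat.zero_le _)
  have cα : ∀ t ≤ v + e + 1, (∃ s ≤ v, α' t = α s) ∨ ∃ s ≤ l, α' t = f s := by
    intro t ht
    rcases join_cases (α := α) (γ := fun t => f (e - t)) ht with ⟨hi, ei⟩ | ⟨s, hs, hi, ei⟩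
    · exact Or.inl ⟨t, hi, ei⟩
    · exact Or.inr ⟨e - s, by omega, ei⟩
  have cγ : ∀ t ≤ y + (l - e - 1) + 1, (∃ s ≤ y, γ' t = γ s) ∨ ∃ s ≤ l, γ' t = f s := by
    intro t ht
    rcases join_cases (α := γ) (γ := fun t => f (e + 1 + t)) ht with ⟨hi, ei⟩ | ⟨s, hs, hi, ei⟩
    · exact Or.inl ⟨t, hi, ei⟩
    · exact Or.inr ⟨e + 1 + s, by omega, ei⟩
  let Z : Set V := (sg α (v + 1) (w + 1) ∪ sg g 0 (p + 1)) ∪ sg γ (y + 1) (z + 1)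
  have hZ : Cn G Z := by
    refine Cn.union (Cn.union (h.pyr.legα.1.cn (by omega)) (h'.ip.cn le_rfl) ?_)
      (h.pyr.legγ.1.cn (by omega)) ?_
    · rintro ⟨_, t, ht, ht', rfl⟩ -
      exact ⟨α w, mem_sg (by omega) (by omega), g 0, mem_sg (by omega) (by omega), hwg.symm⟩
    · rintro - ⟨_, t, ht, ht', rfl⟩
      exact ⟨g p, Or.inr (mem_sg (by omega) (by omega)), γ z, mem_sg (by omega) (by omega), hzg⟩
  let U : V → Prop := fun u => ∃ i < v + e + 1, G.Adj u (α' i)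
  let W : V → Prop := fun u => ∃ i < y + (l - e - 1) + 1, G.Adj u (γ' i)
  obtain ⟨a, haZ, haU⟩ : ∃ a ∈ Z, U a := by
    rcases Nat.lt_or_ge v w with hvw | hvw
    · refine ⟨α (v + 1), Or.inl (Or.inl (mem_sg le_rfl (by omega))), v, by omega, ?_⟩
      rw [hα', join_le le_rfl, h.pyr.legα.1.2 _ (by omega) _ (by omega)]; omega
    · refine ⟨g 0, Or.inl (Or.inr (mem_sg le_rfl (by omega))), w, by omega, ?_⟩
      rwa [hα', join_le hvw]
  obtain ⟨b, hbZ, hbW⟩ : ∃ b ∈ Z, W b := by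
    rcases Nat.lt_or_ge y z with hyz | hyz
    · refine ⟨γ (y + 1), Or.inr (mem_sg le_rfl (by omega)), y, by omega, ?_⟩
      rw [hγ', join_le le_rfl, h.pyr.legγ.1.2 _ (by omega) _ (by omega)]; omega
    · refine ⟨g p, Or.inl (Or.inr (mem_sg (by omega) (by omega))), z, by omega, ?_⟩
      rwa [hγ', join_le hyz]
  obtain ⟨c, d, hc, hcZ, hc0, hcd, hcU, hcW⟩ := min_cross haZ haU hbW (hZ a haZ b hbZ)
  have hZc : ∀ u ∈ Z, (∃ s, v < s ∧ s < m ∧ u = α s) ∨ (∃ s ≤ p, u = g s) ∨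
      ∃ s, y < s ∧ s < n ∧ u = γ s := by
    rintro _ ((⟨s, h1, h2, rfl⟩ | ⟨s, h1, h2, rfl⟩) | ⟨s, h1, h2, rfl⟩)
    · exact Or.inl ⟨s, by omega, by omega, rfl⟩
    · exact Or.inr (Or.inl ⟨s, by omega, rfl⟩)
    · exact Or.inr (Or.inr ⟨s, by omega, by omega, rfl⟩)
  have hX : Cross G x α' (v + e + 1) γ' (y + (l - e - 1) + 1) δ r c d := by
    refine ⟨hP, hc, fun t ht => ?_, fun t ht i hi => ?_, fun t ht i hi => ?_, fun t ht i hi => ?_,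
      fun t ht => ?_, fun t ht => ?_, fun t ht i hi => ?_, hc0,
      fun t ht i hi hadj => hcU t ht ⟨i, hi, hadj⟩, hcd,
      fun t ht i hi hadj => hcW t ht ⟨i, hi, hadj⟩, fun h0 => by omega⟩
    · rcases hZc _ (hcZ t ht) with ⟨s, h1, h2, e1⟩ | ⟨s, h1, e1⟩ | ⟨s, h1, h2, e1⟩ <;> rw [e1]
      · rw [(h.pyr.legα.2 s (by omega)).2]
        exact ⟨(h.pyr.legα.2 s (by omega)).1, by omega⟩
      · exact h'.fx s h1
      · rw [(h.pyr.legγ.2 s (by omega)).2]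
        exact ⟨(h.pyr.legγ.2 s (by omega)).1, by omega⟩
    · rcases hZc _ (hcZ t ht) with ⟨s, h1, h2, e1⟩ | ⟨s, h1, e1⟩ | ⟨s, h1, h2, e1⟩ <;>
      rcases cα i hi with ⟨s', h3, e2⟩ | ⟨s', h3, e2⟩ <;> rw [e1, e2] <;> intro e3
      · have := h.pyr.legα.1.1 _ (by omega) _ (by omega) e3; omega
      · exact h.fα _ (by omega) _ (by omega) e3.symm
      · exact h'.fα _ (by omega) _ (by omega) e3
      · exact hfg _ (by omega) _ (by omega) e3.symm
      · exact (h.pyr.αγ _ (by omega) _ (by omega)).1 e3.symm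
      · exact h.fγ _ (by omega) _ (by omega) e3.symm
    · rcases hZc _ (hcZ t ht) with ⟨s, h1, h2, e1⟩ | ⟨s, h1, e1⟩ | ⟨s, h1, h2, e1⟩ <;>
      rcases cγ i hi with ⟨s', h3, e2⟩ | ⟨s', h3, e2⟩ <;> rw [e1, e2] <;> intro e3
      · exact (h.pyr.αγ _ (by omega) _ (by omega)).1 e3
      · exact h.fα _ (by omega) _ (by omega) e3.symm
      · exact h'.fγ _ (by omega) _ (by omega) e3
      · exact hfg _ (by omega) _ (by omega) e3.symm
      · have := h.pyr.legγ.1.1 _ (by omega) _ (by omega) e3; omega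
      · exact h.fγ _ (by omega) _ (by omega) e3.symm
    · rcases hZc _ (hcZ t ht) with ⟨s, h1, h2, e1⟩ | ⟨s, h1, e1⟩ | ⟨s, h1, h2, e1⟩ <;> rw [e1]
      · exact (h.pyr.αδ s (by omega) i hi).1
      · exact h'.fδ s h1 i hi
      · exact (h.pyr.γδ s (by omega) i hi).1
    · rcases hZc _ (hcZ t ht) with ⟨s, h1, h2, e1⟩ | ⟨s, h1, e1⟩ | ⟨s, h1, h2, e1⟩ <;>
      rw [e1, eα0]
      · rw [h.pyr.legα.1.2 _ (by omega) _ (by omega)]; omega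
      · exact h'.α0 s h1
      · rw [G.adj_comm, (h.pyr.αγ _ (by omega) _ (by omega)).2]; omega
    · rcases hZc _ (hcZ t ht) with ⟨s, h1, h2, e1⟩ | ⟨s, h1, e1⟩ | ⟨s, h1, h2, e1⟩ <;>
      rw [e1, eγ0]
      · rw [(h.pyr.αγ _ (by omega) _ (by omega)).2]; omega
      · exact h'.γ0 s h1
      · rw [h.pyr.legγ.1.2 _ (by omega) _ (by omega)]; omega
    · rcases hZc _ (hcZ t ht) with ⟨s, h1, h2, e1⟩ | ⟨s, h1, e1⟩ | ⟨s, h1, h2, e1⟩ <;> rw [e1]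
      · rw [(h.pyr.αδ s (by omega) i hi.le).2]; omega
      · exact h'.δlt s h1 i hi
      · rw [(h.pyr.γδ s (by omega) i hi.le).2]; omega
  have hδc : ∀ t ≤ d, G.Adj (c t) (δ r) → c t = g e' ∨ c t = g (e' + 1) := by
    intro t ht hadj
    rcases hZc _ (hcZ t ht) with ⟨s, h1, h2, e1⟩ | ⟨s, h1, e1⟩ | ⟨s, h1, h2, e1⟩ <;>
      rw [e1] at hadj ⊢
    · rw [(h.pyr.αδ s (by omega) r le_rfl).2] at hadj; omega
    · rcases (hge s h1).1 hadj with rfl | rfl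
      · exact Or.inl rfl
      · exact Or.inr rfl
    · rw [(h.pyr.γδ s (by omega) r le_rfl).2] at hadj; omega
  obtain ⟨i, hi, hadj, htouch⟩ := hX.edge hC
  rw [eα, eγ] at htouch
  have h1 := hδc i hi.le ((hadj i hi.le).2 (Or.inl rfl))
  have h2 := hδc (i + 1) hi ((hadj (i + 1) hi).2 (Or.inr rfl))
  rcases htouch with ht | ht
  · rcases h2 with h2 | h2 <;> rw [h2] at ht
    · exact Or.inl ht.symm
    · exact Or.inr (Or.inr (Or.inl ht.symm))
  · rcases h1 with h1 | h1 <;> rw [h1] at ht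
    · exact Or.inr (Or.inr (Or.inr ht.symm))
    · exact Or.inr (Or.inl ht.symm)

end

/-- A pyramid has only boundedly many disjoint crossings. -/
theorem exists_cross_bound (t : ℕ) : ∃ L, ∀ {V : Type} {G : SimpleGraph V}, MemCt t G →
    ∀ {x : V} {α γ δ : ℕ → V} {m n r : ℕ} (f : ℕ → ℕ → V) (l : ℕ → ℕ), 0 < r →
    (∀ j < L, Cross G x α m γ n δ r (f j) (l j)) →
    (∀ i < L, ∀ j < L, i ≠ j → ∀ s ≤ l i, ∀ t ≤ l j, f i s ≠ f j t) → False := by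
  obtain ⟨L, hL⟩ := exists_ladder_bound t
  refine ⟨L, fun {V} {G} hG x α γ δ m n r f l hr hX hd => ?_⟩
  have : ∀ j, ∃ e, j < L → e < l j ∧ ∀ t ≤ l j, (G.Adj (f j t) (δ r) ↔ t = e ∨ t = e + 1) := by
    intro j
    by_cases hj : j < L
    · obtain ⟨e, h1, h2, -⟩ := (hX j hj).edge hG.1
      exact ⟨e, fun _ => ⟨h1, h2⟩⟩
    · exact ⟨0, fun h => absurd h hj⟩
  choose e he using this
  refine hL hG (fun j => f j (e j)) (fun j => f j (e j + 1)) (fun j hj => ?_)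
    (fun i hi j hj hij => ⟨?_, ?_⟩) (fun i j hij hj => ?_)
  · exact (hX j hj).ip.step _ (he j hj).1
  · exact hd i hi j hj hij _ (he i hi).1.le _ (he j hj).1.le
  · exact hd i hi j hj hij _ (he i hi).1 _ (he j hj).1
  · exact (hX i (by omega)).touch hG.1 (hX j hj) hr (he i (by omega)).1 (he i (by omega)).2
      (he j hj).2 (hd i (by omega) j hj (by omega))

theorem exists_pigeonhole (β : Type) [Fintype β] (k : ℕ) : ∃ N, ∀ φ : ℕ → β,
    ∃ (e : ℕ → ℕ) (c : β), (∀ a < k, e a < N ∧ φ (e a) = c) ∧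
      ∀ a b, a < b → b < k → e a < e b := by
  obtain ⟨N, hN⟩ := exists_ramsey (Fintype.card β) (k + 2)
  refine ⟨N, fun φ => ?_⟩
  obtain ⟨e, c, he, hec⟩ := hN (fun c i _ => (Fintype.equivFin β (φ i)).val = c.val) (by
    intro i j _ _
    exact ⟨⟨_, Nat.lt_succ_of_lt (Fintype.equivFin β (φ i)).isLt⟩, rfl⟩)
  refine ⟨e, φ (e 0), fun a ha => ⟨he a (by omega), ?_⟩, fun a b h1 h2 => (hec a b h1 (by omega)).1⟩
  have h1 := (hec a (a + 1) (by omega) (by omega)).2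
  have h2 := (hec 0 1 (by omega) (by omega)).2
  exact (Fintype.equivFin β).injective (Fin.ext (h1.trans h2.symm))

/-- A pyramid has only boundedly many disjoint connected sets, away from its apex, attached to at
least two of its legs off the base. -/
theorem exists_family_bound (t : ℕ) : ∃ L, ∀ {V : Type} {G : SimpleGraph V}, MemCt t G →
    ∀ {x : V} (A : Fin 3 → ℕ → V) (m : Fin 3 → ℕ), (∀ a, 0 < m a) → (∀ a, Leg G x (A a) (m a)) →
    (∀ a b, a ≠ b → Ends G (A a) (m a) (A b) (m b)) → ∀ Z : ℕ → Set V,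
    (∀ j < L, Cn G (Z j)) → (∀ j < L, ∀ u ∈ Z j, x ≠ u ∧ ¬ G.Adj x u) →
    (∀ j < L, ∀ u ∈ Z j, ∀ a, ¬ G.Adj u (A a 0)) →
    (∀ j < L, ∀ u ∈ Z j, ∀ a, ∀ i ≤ m a, u ≠ A a i) →
    (∀ j < L, ∃ a b, a ≠ b ∧ (∃ u ∈ Z j, ∃ i < m a, G.Adj u (A a i)) ∧
      ∃ u ∈ Z j, ∃ i < m b, G.Adj u (A b i)) →
    (∀ i < L, ∀ j < L, i ≠ j → ∀ u ∈ Z i, ∀ v ∈ Z j, u ≠ v) → False := by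
  classical
  obtain ⟨M, hM⟩ := exists_cross_bound t
  obtain ⟨L, hL⟩ := exists_pigeonhole (Fin 3 × Fin 3 × Fin 3) M
  refine ⟨L, fun {V} {G} hG x A m hm hleg hends Z hZ hxZ hZ0 hZA htouch hd => ?_⟩
  let T : Fin 3 → V → Prop := fun a u => ∃ i < m a, G.Adj u (A a i)
  have key : ∀ j, ∃ (c : Fin 3 × Fin 3 × Fin 3) (f : ℕ → V) (l : ℕ), j < L →
      c.1 ≠ c.2.1 ∧ c.1 ≠ c.2.2 ∧ c.2.1 ≠ c.2.2 ∧
      (∀ s ≤ l, f s ∈ Z j) ∧ Cross G x (A c.1) (m c.1) (A c.2.1) (m c.2.1) (A c.2.2) (m c.2.2) f l := by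
    intro j
    by_cases hj : j < L
    swap
    · exact ⟨(0, 0, 0), fun _ => x, 0, fun h => absurd h hj⟩
    let P : ℕ → Prop := fun l => ∃ (a b : Fin 3) (f : ℕ → V), a ≠ b ∧ IP G f l ∧
      (∀ s ≤ l, f s ∈ Z j) ∧ T a (f 0) ∧ T b (f l)
    have hP : ∃ l, P l := by
      obtain ⟨a, b, hab, ⟨u, hu, hua⟩, w, hw, hwb⟩ := htouch j hj
      obtain ⟨f, l, h1, h2, h3, h4, -⟩ := min_cross (U := T a) (W := T b) hu hua hwb
        (hZ j hj u hu w hw)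
      exact ⟨l, a, b, f, hab, h1, h2, h3, h4⟩
    obtain ⟨a, b, f, hab, hf, hfZ, hfa, hfb⟩ := Nat.find_spec hP
    have hmin : ∀ k < Nat.find hP, ¬ P k := fun k hk => Nat.find_min hP hk
    generalize Nat.find hP = l at *
    have hbefore : ∀ c, c ≠ a → ∀ s ≤ l, T c (f s) → s = l := by
      intro c hc s hs hT
      by_contra hne
      exact hmin s (by omega) ⟨a, c, f, hc.symm, hf.sub hs, fun k hk => hfZ k (by omega), hfa, hT⟩
    have hafter : ∀ c, c ≠ b → ∀ s ≤ l, T c (f s) → s = 0 := by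
      intro c hc s hs hT
      by_contra hne
      refine hmin (l - s) (by omega) ⟨c, b, fun k => f (s + k), hc, hf.shift (by omega),
        fun k hk => hfZ _ (by omega), hT, ?_⟩
      dsimp only
      rwa [show s + (l - s) = l by omega]
    obtain ⟨c, hca, hcb⟩ : ∃ c : Fin 3, a ≠ c ∧ b ≠ c := by
      clear * -
      revert a b; decide
    have hc : ∀ s ≤ l, ¬ T c (f s) := by
      intro s hs hT
      obtain rfl := hafter c hcb.symm s hs hT
      have h0 := hbefore c hca.symm 0 hs hT
      have hall : ∀ d, T d (f 0) := by
        have : ∀ d : Fin 3, d = a ∨ d = b ∨ d = c := by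
          clear * - hab hca hcb
          revert a b c; decide
        intro d
        rcases this d with rfl | rfl | rfl
        · exact hfa
        · rwa [← h0] at hfb
        · exact hT
      have hx := hxZ j hj _ (hfZ 0 (by omega))
      refine hG.1.2.1 (hasTheta_of (a := f 0) (b := x) (X := fun d => sg (A d) 0 (m d)) hx.1.symm
        (fun h => hx.2 h.symm) (fun d => (hleg d).1.cn (by omega)) (fun d => ?_) (fun d => ?_)
        fun d d' hdd => anti_sg fun s t _ _ _ _ => ?_)
      · obtain ⟨i, hi, hadj⟩ := hall d
        exact ⟨_, mem_sg (Nat.zero_le i) hi, hadj⟩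
      · exact ⟨_, mem_sg (Nat.zero_le 0) (hm d), ((hleg d).2 0 (by omega)).2.2 rfl⟩
      · have := hends d d' hdd s (by omega) t (by omega)
        exact ⟨this.1, fun h => by have := this.2.1 h; omega⟩
    refine ⟨(a, b, c), f, l, fun _ => ⟨hab, hca, hcb, hfZ, ?_⟩⟩
    exact {
      pyr := ⟨hleg a, hleg b, hleg c, hends a b hab, hends a c hca, hends b c hcb⟩
      ip := hf
      fx := fun t ht => hxZ j hj _ (hfZ t ht)
      fα := fun t ht => hZA j hj _ (hfZ t ht) a
      fγ := fun t ht => hZA j hj _ (hfZ t ht) b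
      fδ := fun t ht => hZA j hj _ (hfZ t ht) c
      α0 := fun t ht => hZ0 j hj _ (hfZ t ht) a
      γ0 := fun t ht => hZ0 j hj _ (hfZ t ht) b
      δlt := fun t ht v hv h => hc t ht ⟨v, hv, h⟩
      startα := hfa
      onlyα := fun t ht i hi h => hafter a hab t ht ⟨i, hi, h⟩
      endγ := hfb
      onlyγ := fun t ht i hi h => hbefore b hab.symm t ht ⟨i, hi, h⟩
      consec := fun h => absurd h (hm c).ne' }
  choose c f l hk using key
  obtain ⟨e, k, he, hlt⟩ := hL c
  refine hM hG (fun j => f (e j)) (fun j => l (e j)) (hm k.2.2) (α := A k.1) (γ := A k.2.1)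
    (x := x) (δ := A k.2.2) (m := m k.1) (n := m k.2.1) (fun j hj => ?_) fun i hi j hj hij s hs t ht => ?_
  · have := (hk (e j) (he j hj).1).2.2.2.2
    rwa [(he j hj).2] at this
  · refine hd (e i) (he i hi).1 (e j) (he j hj).1 ?_ _
      ((hk _ (he i hi).1).2.2.2.1 s hs) _ ((hk _ (he j hj).1).2.2.2.1 t ht)
    rcases Nat.lt_or_gt_of_ne hij with h | h
    · exact (hlt i j h hj).ne
    · exact (hlt j i h hi).ne'

theorem Pyr.exists_family_bound (t : ℕ) : ∃ L, ∀ {V : Type} {G : SimpleGraph V}, MemCt t G →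
    ∀ {x : V} {α γ δ : ℕ → V} {m n r : ℕ}, Pyr G x α m γ n δ r → 0 < m → 0 < n → 0 < r →
    ∀ Z : ℕ → Set V,
    (∀ j < L, Cn G (Z j)) → (∀ j < L, ∀ u ∈ Z j, x ≠ u ∧ ¬ G.Adj x u) →
    (∀ j < L, ∀ u ∈ Z j, ¬ G.Adj u (α 0) ∧ ¬ G.Adj u (γ 0) ∧ ¬ G.Adj u (δ 0)) →
    (∀ j < L, ∀ u ∈ Z j,
      (∀ i ≤ m, u ≠ α i) ∧ (∀ i ≤ n, u ≠ γ i) ∧ ∀ i ≤ r, u ≠ δ i) →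
    (∀ j < L, ∃ u ∈ Z j, ∃ i < m, G.Adj u (α i)) →
    (∀ j < L, (∃ u ∈ Z j, ∃ i < n, G.Adj u (γ i)) ∨ ∃ u ∈ Z j, ∃ i < r, G.Adj u (δ i)) →
    (∀ i < L, ∀ j < L, i ≠ j → ∀ u ∈ Z i, ∀ v ∈ Z j, u ≠ v) → False := by
  obtain ⟨L, hL⟩ := HubPaths.exists_family_bound t
  refine ⟨L, fun {V} {G} hG x α γ δ m n r hP hm hn hr Z hZ hxZ hZ0 hZA h1 h2 hd =>
    hL hG (x := x) ![α, γ, δ] ![m, n, r] ?_ ?_ ?_ Z hZ hxZ ?_ ?_ ?_ hd⟩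
  · intro a; fin_cases a <;> assumption
  · intro a; fin_cases a
    · exact hP.legα
    · exact hP.legγ
    · exact hP.legδ
  · intro a b hab
    fin_cases a <;> fin_cases b <;> first
      | exact absurd rfl hab
      | exact hP.αγ
      | exact hP.αδ
      | exact hP.γδ
      | exact hP.αγ.symm
      | exact hP.αδ.symm
      | exact hP.γδ.symm
  · intro j hj u hu a
    have := hZ0 j hj u hu
    fin_cases a
    · exact this.1
    · exact this.2.1
    · exact this.2.2
  · intro j hj u hu a
    have := hZA j hj u hu
    fin_cases a
    · exact this.1
    · exact this.2.1
    · exact this.2.2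
  · intro j hj
    rcases h2 j hj with h | h
    · exact ⟨0, 1, by decide, h1 j hj, h⟩
    · exact ⟨0, 2, by decide, h1 j hj, h⟩

section
variable {V : Type} {G : SimpleGraph V} {x : V} {α β R : ℕ → V} {m b ρ : ℕ}

/-- Two legs attached to the end of a third one: the first contact between them. -/
theorem Leg.meet [Finite V] (hC : MemC G) (hα : Leg G x α m) (hm : 0 < m) (hβ : Leg G x β b)
    (hR : Leg G x R ρ) (hρ : 0 < ρ) (hαβ : Ends G α m β b) (hαR : Ends G α m R ρ)
    (hd : ∀ s ≤ b, ∀ t ≤ ρ, β s ≠ R t) (h0 : ∀ t ≤ ρ, ¬ G.Adj (β 0) (R t))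
    (h0' : ∀ s ≤ b, ¬ G.Adj (β s) (R 0)) (hn : ¬ G.Adj (β b) (R ρ)) :
    ∃ v k, 0 < v ∧ v < ρ ∧ m < k ∧ k < m + b ∧
      (∀ t ≤ m + b + 1, (G.Adj (R v) (join α m β b t) ↔ t = k ∨ t = k + 1)) ∧
      ∀ s < v, ∀ t ≤ m + b + 1, ¬ G.Adj (R s) (join α m β b t) := by
  have hq := hα.spine hβ hαβ
  have hcase := fun t (ht : t ≤ m + b + 1) => join_cases (α := α) (γ := β) ht
  have em : join α m β b m = α m := join_le le_rfl
  have em' : join α m β b (m + 1) = β b := by rw [join_gt (by omega)]; congr 1; omega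
  have hmR := (hαR m le_rfl ρ le_rfl).2.2 ⟨rfl, rfl⟩
  obtain ⟨v, hv, ⟨t, ht, hadj⟩, hmin⟩ := exists_first
    (P := fun s => ∃ t ≤ m + b + 1, G.Adj (R s) (join α m β b t)) (t := ρ)
    ⟨m, by omega, by rw [em]; exact hmR.symm⟩
  have hv0 : 0 < v := by
    rcases Nat.eq_zero_or_pos v with rfl | h
    · exfalso
      rcases hcase t ht with ⟨h1, e⟩ | ⟨s, h1, h2, e⟩ <;> rw [e] at hadj
      · have := (hαR t h1 0 (by omega)).2.1 hadj.symm; omega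
      · exact h0' s h1 hadj.symm
    · exact h
  have hdq : ∀ t ≤ m + b + 1, ∀ s ≤ v, join α m β b t ≠ R s ∧
      (s < v → ¬ G.Adj (join α m β b t) (R s)) := by
    intro t ht s hs
    refine ⟨?_, fun hs' h => hmin s hs' ⟨t, ht, h.symm⟩⟩
    rcases hcase t ht with ⟨h1, e⟩ | ⟨s', h1, h2, e⟩ <;> rw [e]
    · exact (hαR t h1 s (by omega)).1
    · exact hd s' h1 s (by omega)
  have hq0 : ¬ G.Adj (R v) (join α m β b 0) := by
    rw [join_le (Nat.zero_le _), G.adj_comm, (hαR 0 (by omega) v hv).2]; omega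
  have hqN : ¬ G.Adj (R v) (join α m β b (m + b + 1)) := by
    rw [join_gt (by omega), Nat.add_right_comm, Nat.sub_self]
    exact fun h => h0 v hv h.symm
  obtain ⟨k, hk, hkN, hkt⟩ := hq.attach hC (hR.sub hv) hdq ⟨t, ht, hadj⟩ hq0 hqN (by omega)
  have hvρ : v < ρ := by
    rcases Nat.eq_or_lt_of_le hv with rfl | h
    · exfalso
      have h1 := (hkt m (by omega)).1 (by rw [em]; exact hmR.symm)
      by_cases hkm : k = m
      · subst hkm
        have := (hkt (k + 1) (by omega)).2 (Or.inr rfl)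
        rw [em'] at this
        exact hn this.symm
      · have := (hkt k (by omega)).2 (Or.inl rfl)
        rw [join_le (by omega), G.adj_comm, (hαR k (by omega) v hv).2] at this
        exact hkm this.1
    · exact h
  have hmk : m < k := by
    by_contra hc
    have := (hkt k (by omega)).2 (Or.inl rfl)
    rw [join_le (by omega), G.adj_comm, (hαR k (by omega) v hv).2] at this
    omega
  exact ⟨v, k, hv0, hvρ, hmk, by omega, hkt, fun s hs t ht h => hmin s hs ⟨t, ht, h⟩⟩

end

/-- Pairwise disjoint legs whose starts do not touch the other legs. -/
structure Fam {V : Type} (G : SimpleGraph V) (x : V) (R : ℕ → ℕ → V) (ρ : ℕ → ℕ) (I : ℕ) :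
    Prop where
  leg : ∀ j < I, Leg G x (R j) (ρ j)
  pos : ∀ j < I, 0 < ρ j
  disj : ∀ i < I, ∀ j < I, i ≠ j → ∀ s ≤ ρ i, ∀ t ≤ ρ j, R i s ≠ R j t
  start : ∀ i < I, ∀ j < I, i ≠ j → ∀ t ≤ ρ j, ¬ G.Adj (R i 0) (R j t)

theorem Fam.comp {V : Type} {G : SimpleGraph V} {x : V} {R : ℕ → ℕ → V} {ρ : ℕ → ℕ} {I : ℕ}
    (h : Fam G x R ρ I) {e : ℕ → ℕ} {K : ℕ} (he : ∀ a < K, e a < I)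
    (hlt : ∀ a b, a < b → b < K → e a < e b) :
    Fam G x (fun a => R (e a)) (fun a => ρ (e a)) K := by
  have hne : ∀ i < K, ∀ j < K, i ≠ j → e i ≠ e j := by
    intro i hi j hj hij
    rcases Nat.lt_or_gt_of_ne hij with h | h
    · exact (hlt i j h hj).ne
    · exact (hlt j i h hi).ne'
  exact ⟨fun j hj => h.leg _ (he j hj), fun j hj => h.pos _ (he j hj),
    fun i hi j hj hij => h.disj _ (he i hi) _ (he j hj) (hne i hi j hj hij),
    fun i hi j hj hij => h.start _ (he i hi) _ (he j hj) (hne i hi j hj hij)⟩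

theorem Fam.trunc {V : Type} {G : SimpleGraph V} {x : V} {R : ℕ → ℕ → V} {ρ ρ' : ℕ → ℕ} {I : ℕ}
    (h : Fam G x R ρ I) (h1 : ∀ j < I, ρ' j ≤ ρ j) (h2 : ∀ j < I, 0 < ρ' j) :
    Fam G x R ρ' I :=
  ⟨fun j hj => (h.leg j hj).sub (h1 j hj), h2,
    fun i hi j hj hij s hs t ht => h.disj i hi j hj hij s (hs.trans (h1 i hi)) t
      (ht.trans (h1 j hj)),
    fun i hi j hj hij t ht => h.start i hi j hj hij t (ht.trans (h1 j hj))⟩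

/-- The first contact of the leg `R` with the spine formed by the legs `α` and `β`. -/
def Meets {V : Type} (G : SimpleGraph V) (α : ℕ → V) (m : ℕ) (β : ℕ → V) (b : ℕ) (R : ℕ → V)
    (ρ v k : ℕ) : Prop :=
  0 < v ∧ v < ρ ∧ m < k ∧ k < m + b ∧
    (∀ t ≤ m + b + 1, (G.Adj (R v) (join α m β b t) ↔ t = k ∨ t = k + 1)) ∧
    ∀ s < v, ∀ t ≤ m + b + 1, ¬ G.Adj (R s) (join α m β b t)

theorem exists_meets_bound (t : ℕ) : ∃ L, ∀ {V : Type} [Finite V] {G : SimpleGraph V}, MemCt t G →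
    ∀ {x : V} {α : ℕ → V} {m : ℕ} {R : ℕ → ℕ → V} {ρ : ℕ → ℕ} {I : ℕ}, Leg G x α m → 0 < m →
    Fam G x R ρ I → (∀ j < I, Ends G α m (R j) (ρ j)) → ∀ (v k e : ℕ → ℕ) (i₀ : ℕ),
    (∀ j, 0 < j → j < I → Meets G α m (R 0) (ρ 0) (R j) (ρ j) (v j) (k j)) →
    0 < i₀ → i₀ < I → (∀ a < L, 0 < e a ∧ e a < I ∧ e a ≠ i₀) →
    (∀ a < L, ∀ b < L, a ≠ b → e a ≠ e b) →
    (∀ a < L, k i₀ < k (e a) ∨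
      k i₀ = k (e a) ∧ ¬ G.Adj (R i₀ (v i₀)) (R (e a) (v (e a)))) → False := by
  obtain ⟨L, hL⟩ := Pyr.exists_family_bound t
  refine ⟨L, fun {V} _ {G} hG x α m R ρ I hα hm hF hends v k e i₀ hmeet hi₀ hi₀I he hinj hk => ?_⟩
  obtain ⟨hv, hvρ, hmk, hkb, hadj, hnadj⟩ := hmeet i₀ hi₀ hi₀I
  have hq := hα.spine (hF.leg 0 (by omega)) (hends 0 (by omega))
  have hcase := fun t (ht : t ≤ m + ρ 0 + 1) => join_cases (α := α) (γ := R 0) ht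
  have hqR : ∀ j, 0 < j → j < I → ∀ t ≤ m + ρ 0 + 1, ∀ s ≤ ρ j, join α m (R 0) (ρ 0) t ≠ R j s := by
    intro j hj hjI t ht s hs
    rcases hcase t ht with ⟨h1, e⟩ | ⟨s', h1, h2, e⟩ <;> rw [e]
    · exact (hends j hjI t h1 s hs).1
    · exact hF.disj 0 (by omega) j hjI (by omega) s' h1 s hs
  have hP := hq.pyr ((hF.leg i₀ hi₀I).sub hvρ.le)
    (fun t ht s hs => ⟨hqR i₀ hi₀ hi₀I t ht s (by omega), fun hs' h => hnadj s hs' t ht h.symm⟩)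
    (k := k i₀) (by omega) (by omega) hadj
  have eN : join α m (R 0) (ρ 0) (m + ρ 0 + 1 - 0) = R 0 0 := by
    rw [join_gt (by omega)]; congr 1; omega
  refine hL hG hP (by omega) (by omega) hv (fun a => sg (R (e a)) 1 (ρ (e a) + 1))
    (fun a ha => (hF.leg _ (he a ha).2.1).1.cn le_rfl) ?_ ?_ ?_ ?_ ?_ ?_
  · rintro a ha _ ⟨s, h1, h2, rfl⟩
    have := (hF.leg _ (he a ha).2.1).2 s (by omega)
    exact ⟨this.1, fun h => by have := this.2.1 h; omega⟩
  · rintro a ha _ ⟨s, h1, h2, rfl⟩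
    obtain ⟨h3, h4, h5⟩ := he a ha
    refine ⟨?_, ?_, fun h => hF.start i₀ hi₀I _ h4 h5.symm s (by omega) h.symm⟩
    · rw [join_le (Nat.zero_le _), G.adj_comm, (hends _ h4 0 (by omega) s (by omega)).2]; omega
    · rw [eN]
      exact fun h => hF.start 0 (by omega) _ h4 (by omega) s (by omega) h.symm
  · rintro a ha _ ⟨s, h1, h2, rfl⟩
    obtain ⟨h3, h4, h5⟩ := he a ha
    exact ⟨fun i hi => (hqR _ h3 h4 i (by omega) s (by omega)).symm,
      fun i hi => (hqR _ h3 h4 _ (by omega) s (by omega)).symm,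
      fun i hi => hF.disj _ h4 _ hi₀I h5 s (by omega) i (by omega)⟩
  · intro a ha
    obtain ⟨h3, h4, h5⟩ := he a ha
    refine ⟨_, mem_sg (hF.pos _ h4) (Nat.lt_succ_self _), m, hmk, ?_⟩
    rw [join_le le_rfl]
    exact ((hends _ h4 m le_rfl _ le_rfl).2.2 ⟨rfl, rfl⟩).symm
  · intro a ha
    obtain ⟨h3, h4, h5⟩ := he a ha
    obtain ⟨hv', hvρ', hmk', hkb', hadj', hnadj'⟩ := hmeet _ h3 h4
    rcases hk a ha with h | ⟨h, hn⟩
    · refine Or.inl ⟨_, mem_sg hv' (by omega), m + ρ 0 + 1 - (k (e a) + 1), by omega, ?_⟩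
      rw [hadj' _ (by omega)]; omega
    · right
      have hE : Ends G (join α m (R 0) (ρ 0)) (k i₀) (R (e a)) (v (e a)) := by
        refine fun i hi j hj => ⟨hqR _ h3 h4 i (by omega) j (by omega), ?_⟩
        rcases Nat.lt_or_ge j (v (e a)) with h' | h'
        · exact ⟨fun e' => absurd e'.symm (hnadj' j h' i (by omega)), fun e' => by omega⟩
        · obtain rfl : j = v (e a) := by omega
          rw [G.adj_comm, hadj' i (by omega)]; omega
      obtain ⟨v', k', h6, h7, h8, h9, h10, -⟩ := Leg.meet hG.1 (hq.leg (k := k i₀) (by omega))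
        (by omega) ((hF.leg i₀ hi₀I).sub hvρ.le) ((hF.leg _ h4).sub hvρ'.le) hv' hP.αδ hE
        (fun i hi j hj => hF.disj _ hi₀I _ h4 h5.symm i (by omega) j (by omega))
        (fun j hj => hF.start _ hi₀I _ h4 h5.symm j (by omega))
        (fun i hi h => hF.start _ h4 _ hi₀I h5 i (by omega) h.symm) hn
      have := (h10 (k' + 1) (by omega)).2 (Or.inr rfl)
      rw [join_gt (by omega)] at this
      exact ⟨_, mem_sg h6 (by omega), _, by omega, this⟩
  · rintro a ha a' ha' haa _ ⟨s, h1, h2, rfl⟩ _ ⟨s', h1', h2', rfl⟩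
    exact hF.disj _ (he a ha).2.1 _ (he a' ha').2.1 (hinj a ha a' ha' haa) s (by omega) s' (by omega)

/-- Only boundedly many separated legs can be attached to the end of one leg. -/
theorem exists_attached_bound (t : ℕ) : ∃ I, ∀ {V : Type} [Finite V] {G : SimpleGraph V},
    MemCt t G → ∀ {x : V} {α : ℕ → V} {m : ℕ} {R : ℕ → ℕ → V} {ρ : ℕ → ℕ}, Leg G x α m → 0 < m →
    Fam G x R ρ I → (∀ j < I, Ends G α m (R j) (ρ j)) → False := by
  obtain ⟨L, hL⟩ := exists_meets_bound t
  obtain ⟨M, hM⟩ := exists_ramsey 3 (t + L + 1)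
  obtain ⟨I, hI⟩ := exists_ramsey 1 (t + (M + 1))
  refine ⟨I, fun {V} _ {G} hG x α m R ρ hα hm hF hends => ?_⟩
  obtain ⟨d, c, hd, hdc⟩ := hI ![fun i j => G.Adj (R i (ρ i)) (R j (ρ j)),
    fun i j => ¬ G.Adj (R i (ρ i)) (R j (ρ j))] (by
      intro i j _ _
      by_cases h : G.Adj (R i (ρ i)) (R j (ρ j))
      · exact ⟨0, h⟩
      · exact ⟨1, h⟩)
  have hF' := hF.comp hd fun a b h1 h2 => (hdc a b h1 h2).1
  have hends' : ∀ j < t + (M + 1), Ends G α m (R (d j)) (ρ (d j)) := fun j hj => hends _ (hd j hj)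
  fin_cases c
  · exact no_clique hG.2 (f := fun i => R (d i) (ρ (d i))) fun i j h1 h2 =>
      (hdc i j h1 (by omega)).2
  have hnadj : ∀ i j, i < j → j < t + (M + 1) → ¬ G.Adj (R (d i) (ρ (d i))) (R (d j) (ρ (d j))) :=
    fun i j h1 h2 => (hdc i j h1 h2).2
  clear hdc hd hF hends
  generalize hR' : (fun a => R (d a)) = R' at *
  generalize hρ' : (fun a => ρ (d a)) = ρ' at *
  have eR : ∀ a, R (d a) = R' a := fun a => by rw [← hR']
  have eρ : ∀ a, ρ (d a) = ρ' a := fun a => by rw [← hρ']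
  simp only [eR, eρ] at hends' hnadj
  have key : ∀ j, ∃ v k, 0 < j → j < M + 1 →
      Meets G α m (R' 0) (ρ' 0) (R' j) (ρ' j) v k := by
    intro j
    by_cases hj : 0 < j ∧ j < M + 1
    · obtain ⟨hj0, hjM⟩ := hj
      obtain ⟨v, k, h⟩ := Leg.meet hG.1 hα hm (hF'.leg 0 (by omega)) (hF'.leg j (by omega))
        (hF'.pos j (by omega)) (hends' 0 (by omega)) (hends' j (by omega))
        (hF'.disj 0 (by omega) j (by omega) (by omega))
        (hF'.start 0 (by omega) j (by omega) (by omega))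
        (fun s hs h => hF'.start j (by omega) 0 (by omega) (by omega) s hs h.symm)
        (hnadj 0 j hj0 (by omega))
      exact ⟨v, k, fun _ _ => h⟩
    · exact ⟨0, 0, fun h1 h2 => absurd ⟨h1, h2⟩ hj⟩
  choose v k hvk using key
  obtain ⟨e, c, he, hec⟩ := hM ![fun i j => k (i + 1) < k (j + 1), fun i j => k (j + 1) < k (i + 1),
    fun i j => G.Adj (R' (i + 1) (v (i + 1))) (R' (j + 1) (v (j + 1))),
    fun i j => k (i + 1) = k (j + 1) ∧
      ¬ G.Adj (R' (i + 1) (v (i + 1))) (R' (j + 1) (v (j + 1)))] (by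
      intro i j _ _
      rcases lt_trichotomy (k (i + 1)) (k (j + 1)) with h | h | h
      · exact ⟨0, h⟩
      · by_cases h' : G.Adj (R' (i + 1) (v (i + 1))) (R' (j + 1) (v (j + 1)))
        · exact ⟨2, h'⟩
        · exact ⟨3, h, h'⟩
      · exact ⟨1, h⟩)
  have hF'' : Fam G x R' ρ' (M + 1) := by
    have := hF'.comp (e := id) (K := M + 1) (fun a ha => by simp only [id]; omega)
      (fun a b h _ => h)
    simpa using this
  have fin := fun (g : ℕ → ℕ) (i₀ : ℕ) => hL hG hα hm hF'' (fun j hj => hends' j (by omega))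
    v k (fun a => e (g a) + 1) (e i₀ + 1) hvk (Nat.succ_pos _)
  have hne : ∀ a b, a < b → b < t + L + 1 → e a < e b := fun a b h1 h2 => (hec a b h1 h2).1
  fin_cases c
  · have hc : ∀ a b, a < b → b < t + L + 1 → k (e a + 1) < k (e b + 1) :=
      fun a b h1 h2 => (hec a b h1 h2).2
    refine fin (fun a => a + 1) 0 (by have := he 0 (by omega); omega) (fun a ha => ?_)
      (fun a ha b hb hab => ?_) (fun a ha => Or.inl (hc 0 (a + 1) (by omega) (by omega)))
    · have := he (a + 1) (by omega)
      have := hne 0 (a + 1) (by omega) (by omega)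
      omega
    · rcases Nat.lt_or_gt_of_ne hab with h | h
      · have := hne (a + 1) (b + 1) (by omega) (by omega); omega
      · have := hne (b + 1) (a + 1) (by omega) (by omega); omega
  · have hc : ∀ a b, a < b → b < t + L + 1 → k (e b + 1) < k (e a + 1) :=
      fun a b h1 h2 => (hec a b h1 h2).2
    refine fin id L (by have := he L (by omega); omega) (fun a ha => ?_)
      (fun a ha b hb hab => ?_) (fun a ha => Or.inl (hc a L (by omega) (by omega)))
    · have := he a (by omega)
      have := hne a L (by omega) (by omega)
      simp only [id]; omega
    · simp only [id]
      rcases Nat.lt_or_gt_of_ne hab with h | h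
      · have := hne a b (by omega) (by omega); omega
      · have := hne b a (by omega) (by omega); omega
  · exact no_clique hG.2 (f := fun a => R' (e a + 1) (v (e a + 1))) fun i j h1 h2 =>
      (hec i j h1 (by omega)).2
  · have hc : ∀ a b, a < b → b < t + L + 1 → k (e a + 1) = k (e b + 1) ∧
        ¬ G.Adj (R' (e a + 1) (v (e a + 1))) (R' (e b + 1) (v (e b + 1))) :=
      fun a b h1 h2 => (hec a b h1 h2).2
    refine fin (fun a => a + 1) 0 (by have := he 0 (by omega); omega) (fun a ha => ?_)
      (fun a ha b hb hab => ?_) (fun a ha => Or.inr (hc 0 (a + 1) (by omega) (by omega)))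
    · have := he (a + 1) (by omega)
      have := hne 0 (a + 1) (by omega) (by omega)
      omega
    · rcases Nat.lt_or_gt_of_ne hab with h | h
      · have := hne (a + 1) (b + 1) (by omega) (by omega); omega
      · have := hne (b + 1) (a + 1) (by omega) (by omega); omega

/-- Only boundedly many pairwise touching separated legs can be attached to a spine. -/
theorem exists_spine_bound (t : ℕ) : ∃ K, ∀ {V : Type} [Finite V] {G : SimpleGraph V},
    MemCt t G → ∀ {x : V} {q : ℕ → V} {N : ℕ} {P : ℕ → ℕ → V} {d : ℕ → ℕ}, Spine G x q N →
    Fam G x P d K →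
    (∀ i < K, ∀ j < K, i ≠ j → ∃ s ≤ d i, ∃ t ≤ d j, G.Adj (P i s) (P j t)) →
    (∀ j < K, ∀ t ≤ N, ∀ s ≤ d j, q t ≠ P j s) →
    (∀ j < K, ∀ s ≤ d j, ¬ G.Adj (P j s) (q 0) ∧ ¬ G.Adj (P j s) (q N)) →
    (∀ j < K, ∀ t ≤ N, ¬ G.Adj (P j 0) (q t)) →
    (∀ j < K, ∃ s ≤ d j, ∃ t ≤ N, G.Adj (P j s) (q t)) → False := by
  obtain ⟨L, hL⟩ := Pyr.exists_family_bound t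
  obtain ⟨I, hI⟩ := exists_attached_bound t
  obtain ⟨K, hK⟩ := exists_ramsey 2 (2 * L + 1 + I)
  refine ⟨K, fun {V} _ {G} hG x q N P d hq hF hPP hne hend hstart hmeet => ?_⟩
  have key : ∀ j, ∃ ρ k, j < K → 0 < ρ ∧ ρ ≤ d j ∧ 0 < k ∧ k + 1 < N ∧
      (∀ t ≤ N, (G.Adj (P j ρ) (q t) ↔ t = k ∨ t = k + 1)) ∧
      ∀ s < ρ, ∀ t ≤ N, ¬ G.Adj (P j s) (q t) := by
    intro j
    by_cases hj : j < K
    · obtain ⟨s, hs, hst⟩ := hmeet j hj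
      obtain ⟨ρ, hρ, hadj, hmin⟩ := exists_first
        (P := fun s => ∃ t ≤ N, G.Adj (P j s) (q t)) hst
      have hρ0 : 0 < ρ := by
        rcases Nat.eq_zero_or_pos ρ with rfl | h
        · obtain ⟨t, ht, h⟩ := hadj
          exact absurd h (hstart j hj t ht)
        · exact h
      obtain ⟨k, h1, h2, h3⟩ := hq.attach hG.1 ((hF.leg j hj).sub (hρ.trans hs))
        (fun t ht s hs' => ⟨hne j hj t ht s (by omega), fun h h' => hmin s h ⟨t, ht, h'.symm⟩⟩)
        hadj (hend j hj ρ (by omega)).1 (hend j hj ρ (by omega)).2 (by omega)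
      exact ⟨ρ, k, fun _ => ⟨hρ0, by omega, h1, h2, h3, fun s hs t ht h => hmin s hs ⟨t, ht, h⟩⟩⟩
    · exact ⟨0, 0, fun h => absurd h hj⟩
  choose ρ k hk using key
  have hxP : ∀ j < K, ∀ s, 1 ≤ s → s < d j + 1 → x ≠ P j s ∧ ¬ G.Adj x (P j s) := by
    intro j hj s h1 h2
    have := (hF.leg j hj).2 s (by omega)
    exact ⟨this.1, fun h => by have := this.2.1 h; omega⟩
  have two : ∀ (lo hi : ℕ → ℕ) (l : ℕ), l < K →
      (∀ a < L, lo a < K ∧ hi a < K ∧ k (lo a) < k l ∧ k l < k (hi a)) →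
      (∀ a < L, ∀ b < L, a ≠ b → lo a ≠ lo b ∧ hi a ≠ hi b) → False := by
    intro lo hi l hl hlh hinj
    obtain ⟨hρ, hρd, hk0, hkN, hadj, hnadj⟩ := hk l hl
    have hP := hq.pyr ((hF.leg l hl).sub hρd) (fun t ht s hs => ⟨hne l hl t ht s (by omega),
      fun hs' h => hnadj s hs' t ht h.symm⟩) hk0 hkN hadj
    have hall : ∀ a < L, ∀ u ∈ sg (P (lo a)) 1 (d (lo a) + 1) ∪ sg (P (hi a)) 1 (d (hi a) + 1),
        ∃ j s, (j = lo a ∨ j = hi a) ∧ j < K ∧ j ≠ l ∧ 1 ≤ s ∧ s < d j + 1 ∧ P j s = u := by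
      intro a ha u hu
      obtain ⟨h1, h2, h3, h4⟩ := hlh a ha
      rcases hu with ⟨s, h5, h6, rfl⟩ | ⟨s, h5, h6, rfl⟩
      · exact ⟨_, s, Or.inl rfl, h1, fun e => by rw [e] at h3; omega, h5, h6, rfl⟩
      · exact ⟨_, s, Or.inr rfl, h2, fun e => by rw [e] at h4; omega, h5, h6, rfl⟩
    refine hL hG hP hk0 (by omega) hρ
      (fun a => sg (P (lo a)) 1 (d (lo a) + 1) ∪ sg (P (hi a)) 1 (d (hi a) + 1))
      ?_ ?_ ?_ ?_ ?_ ?_ ?_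
    · intro a ha
      obtain ⟨h1, h2, h3, h4⟩ := hlh a ha
      have hne' : lo a ≠ hi a := fun e => by rw [e] at h3; omega
      refine ((hF.leg _ h1).1.cn le_rfl).union ((hF.leg _ h2).1.cn le_rfl) fun _ _ => ?_
      obtain ⟨s, hs, s', hs', h⟩ := hPP _ h1 _ h2 hne'
      have hs0 : 1 ≤ s := by
        rcases Nat.eq_zero_or_pos s with rfl | h0
        · exact absurd h (hF.start _ h1 _ h2 hne' s' hs')
        · exact h0
      have hs0' : 1 ≤ s' := by
        rcases Nat.eq_zero_or_pos s' with rfl | h0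
        · exact absurd h.symm (hF.start _ h2 _ h1 hne'.symm s hs)
        · exact h0
      exact ⟨_, mem_sg hs0 (by omega), _, mem_sg hs0' (by omega), h⟩
    · intro a ha u hu
      obtain ⟨j, s, -, hj, -, h1, h2, rfl⟩ := hall a ha u hu
      exact hxP j hj s h1 h2
    · intro a ha u hu
      obtain ⟨j, s, -, hj, hjl, h1, h2, rfl⟩ := hall a ha u hu
      exact ⟨(hend j hj s (by omega)).1, (hend j hj s (by omega)).2,
        fun h => hF.start l hl j hj hjl.symm s (by omega) h.symm⟩
    · intro a ha u hu
      obtain ⟨j, s, -, hj, hjl, h1, h2, rfl⟩ := hall a ha u hu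
      exact ⟨fun i hi => (hne j hj i (by omega) s (by omega)).symm,
        fun i hi => (hne j hj _ (by omega) s (by omega)).symm,
        fun i hi => hF.disj j hj l hl hjl s (by omega) i (by omega)⟩
    · intro a ha
      obtain ⟨h1, h2, h3, h4⟩ := hlh a ha
      obtain ⟨g1, g2, g3, g4, g5, g6⟩ := hk _ h1
      exact ⟨_, Or.inl (mem_sg g1 (by omega)), k (lo a), h3, (g5 _ (by omega)).2 (Or.inl rfl)⟩
    · intro a ha
      obtain ⟨h1, h2, h3, h4⟩ := hlh a ha
      obtain ⟨g1, g2, g3, g4, g5, g6⟩ := hk _ h2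
      refine Or.inl ⟨_, Or.inr (mem_sg g1 (by omega)), N - (k (hi a) + 1), by omega, ?_⟩
      rw [g5 _ (by omega)]; omega
    · intro a ha b hb hab u hu v hv
      obtain ⟨j, s, e1, hj, hjl, h1, h2, rfl⟩ := hall a ha u hu
      obtain ⟨j', s', e2, hj', hjl', h1', h2', rfl⟩ := hall b hb v hv
      refine hF.disj j hj j' hj' (fun e => ?_) s (by omega) s' (by omega)
      have ha' := hlh a ha
      have hb' := hlh b hb
      have hab' := hinj a ha b hb hab
      rcases e1 with rfl | rfl <;> rcases e2 with e2 | e2 <;> rw [e2] at e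
      · exact hab'.1 e
      · rw [e] at ha'; omega
      · rw [e] at ha'; omega
      · exact hab'.2 e
  obtain ⟨e, c, he, hec⟩ := hK ![fun i j => k i < k j, fun i j => k j < k i,
    fun i j => k i = k j] (by
      intro i j _ _
      rcases lt_trichotomy (k i) (k j) with h | h | h
      · exact ⟨0, h⟩
      · exact ⟨2, h⟩
      · exact ⟨1, h⟩)
  have hlt : ∀ a b, a < b → b < 2 * L + 1 + I → e a < e b := fun a b h1 h2 => (hec a b h1 h2).1
  have hinj : ∀ a b, a < 2 * L + 1 + I → b < 2 * L + 1 + I → a ≠ b → e a ≠ e b := by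
    intro a b ha hb hab
    rcases Nat.lt_or_gt_of_ne hab with h | h
    · exact (hlt a b h hb).ne
    · exact (hlt b a h ha).ne'
  fin_cases c
  · have hc : ∀ a b, a < b → b < 2 * L + 1 + I → k (e a) < k (e b) :=
      fun a b h1 h2 => (hec a b h1 h2).2
    exact two (fun a => e a) (fun a => e (L + 1 + a)) (e L) (he _ (by omega))
      (fun a ha => ⟨he _ (by omega), he _ (by omega), hc _ _ ha (by omega),
        hc _ _ (by omega) (by omega)⟩)
      (fun a ha b hb hab => ⟨hinj _ _ (by omega) (by omega) hab,
        hinj _ _ (by omega) (by omega) (by omega)⟩)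
  · have hc : ∀ a b, a < b → b < 2 * L + 1 + I → k (e b) < k (e a) :=
      fun a b h1 h2 => (hec a b h1 h2).2
    exact two (fun a => e (L + 1 + a)) (fun a => e a) (e L) (he _ (by omega))
      (fun a ha => ⟨he _ (by omega), he _ (by omega), hc _ _ (by omega) (by omega),
        hc _ _ ha (by omega)⟩)
      (fun a ha b hb hab => ⟨hinj _ _ (by omega) (by omega) (by omega),
        hinj _ _ (by omega) (by omega) hab⟩)
  · have hc : ∀ b, b < 2 * L + 1 + I → k (e b) = k (e 0) := by
      intro b hb
      rcases Nat.eq_zero_or_pos b with rfl | h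
      · rfl
      · exact ((hec 0 b h hb).2 : k (e 0) = k (e b)).symm
    have h0 := hk (e 0) (he 0 (by omega))
    refine hI hG (hq.leg (k := k (e 0)) (by omega)) h0.2.2.1
      ((hF.comp (K := I) (fun a ha => he a (by omega)) (fun a b h1 h2 => hlt a b h1 (by omega))).trunc
        (ρ' := fun a => ρ (e a)) (fun j hj => (hk _ (he j (by omega))).2.1)
        (fun j hj => (hk _ (he j (by omega))).1)) fun j hj i hi s hs => ?_
    obtain ⟨g1, g2, g3, g4, g5, g6⟩ := hk _ (he j (by omega))
    rw [hc j (by omega)] at g5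
    refine ⟨hne _ (he j (by omega)) i (by omega) s (by omega), ?_⟩
    rcases Nat.lt_or_ge s (ρ (e j)) with h | h
    · exact ⟨fun h' => absurd h'.symm (g6 s h i (by omega)), fun h' => by omega⟩
    · obtain rfl : s = ρ (e j) := by omega
      rw [G.adj_comm, g5 i (by omega)]; omega

/-- There are boundedly many pairwise touching separated legs. -/
theorem exists_touching_bound (t : ℕ) : ∃ K, ∀ {V : Type} [Finite V] {G : SimpleGraph V},
    MemCt t G → ∀ {x : V} {P : ℕ → ℕ → V} {d : ℕ → ℕ}, Fam G x P d K →
    (∀ i < K, ∀ j < K, i ≠ j → ∃ s ≤ d i, ∃ t ≤ d j, G.Adj (P i s) (P j t)) → False := by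
  obtain ⟨K, hK⟩ := exists_spine_bound t
  refine ⟨K + 2, fun {V} _ {G} hG x P d hF hPP => ?_⟩
  have key : ∀ j, ∃ τ, 0 < j → j < K + 2 → τ ≤ d 0 ∧ (∃ s ≤ d j, G.Adj (P 0 τ) (P j s)) ∧
      ∀ i < τ, ∀ s ≤ d j, ¬ G.Adj (P 0 i) (P j s) := by
    intro j
    by_cases hj : 0 < j ∧ j < K + 2
    · obtain ⟨i, hi, h⟩ := hPP 0 (by omega) j hj.2 (by omega)
      obtain ⟨τ, h1, h2, h3⟩ := exists_first (P := fun i => ∃ s ≤ d j, G.Adj (P 0 i) (P j s)) h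
      exact ⟨τ, fun _ _ => ⟨by omega, h2, fun i hi s hs h => h3 i hi ⟨s, hs, h⟩⟩⟩
    · exact ⟨0, fun h1 h2 => absurd ⟨h1, h2⟩ hj⟩
  choose τ hτ using key
  obtain ⟨κ, hκ, hmax⟩ := Finset.exists_max_image (Finset.Ico 1 (K + 2)) τ ⟨1, by simp⟩
  simp only [Finset.mem_Ico] at hκ hmax
  obtain ⟨h1, ⟨s, hs, h2⟩, h3⟩ := hτ κ (by omega) (by omega)
  obtain ⟨β, hβ, h4, h5⟩ := exists_first (P := fun s => G.Adj (P 0 (τ κ)) (P κ s)) h2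
  have hτ0 : 0 < τ κ := by
    rcases Nat.eq_zero_or_pos (τ κ) with e | h
    · rw [e] at h2
      exact absurd h2 (hF.start 0 (by omega) κ (by omega) (by omega) s hs)
    · exact h
  have hE : Ends G (P 0) (τ κ) (P κ) β := by
    refine fun i hi j hj => ⟨hF.disj 0 (by omega) κ (by omega) (by omega) i (by omega) j
      (by omega), fun h => ?_, ?_⟩
    · by_contra hc
      rcases Nat.lt_or_ge i (τ κ) with h' | h'
      · exact h3 i h' j (by omega) h
      · obtain rfl : i = τ κ := by omega
        exact h5 j (by omega) h
    · rintro ⟨rfl, rfl⟩; exact h4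
  have hq := ((hF.leg 0 (by omega)).sub h1).spine ((hF.leg κ (by omega)).sub (hβ.trans hs)) hE
  have hcase := fun t (ht : t ≤ τ κ + β + 1) => join_cases (α := P 0) (γ := P κ) ht
  have eN : join (P 0) (τ κ) (P κ) β (τ κ + β + 1) = P κ 0 := by
    rw [join_gt (by omega)]; congr 1; omega
  let g : ℕ → ℕ := fun a => if a + 1 < κ then a + 1 else a + 2
  have hg : ∀ a < K, 0 < g a ∧ g a < K + 2 ∧ g a ≠ κ := by
    intro a ha
    simp only [g]
    split_ifs <;> omega
  have hglt : ∀ a b, a < b → b < K → g a < g b := by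
    intro a b h1 h2
    simp only [g]
    split_ifs <;> omega
  have hgne : ∀ i < K, ∀ j < K, i ≠ j → g i ≠ g j := by
    intro i hi j hj hij
    rcases Nat.lt_or_gt_of_ne hij with h | h
    · exact (hglt i j h hj).ne
    · exact (hglt j i h hi).ne'
  refine hK hG hq (hF.comp (fun a ha => (hg a ha).2.1) hglt)
    (fun i hi j hj hij => hPP _ (hg i hi).2.1 _ (hg j hj).2.1 (hgne i hi j hj hij)) ?_ ?_ ?_ ?_
  · intro j hj t ht s hs
    obtain ⟨g1, g2, g3⟩ := hg j hj
    rcases hcase t ht with ⟨h1, e⟩ | ⟨s', h1, h2, e⟩ <;> rw [e]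
    · exact hF.disj 0 (by omega) _ g2 (by omega) t (by omega) s hs
    · exact hF.disj κ (by omega) _ g2 (by omega) s' (by omega) s hs
  · intro j hj s hs
    obtain ⟨g1, g2, g3⟩ := hg j hj
    rw [eN, join_le (Nat.zero_le _)]
    exact ⟨fun h => hF.start 0 (by omega) _ g2 (by omega) s hs h.symm,
      fun h => hF.start κ (by omega) _ g2 (by omega) s hs h.symm⟩
  · intro j hj t ht
    obtain ⟨g1, g2, g3⟩ := hg j hj
    rcases hcase t ht with ⟨h1, e⟩ | ⟨s', h1, h2, e⟩ <;> rw [e]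
    · exact hF.start _ g2 0 (by omega) (by omega) t (by omega)
    · exact hF.start _ g2 κ (by omega) (by omega) s' (by omega)
  · intro j hj
    obtain ⟨g1, g2, g3⟩ := hg j hj
    obtain ⟨g4, ⟨s, g5, g6⟩, g7⟩ := hτ _ g1 g2
    have := hmax (g j) ⟨g1, g2⟩
    exact ⟨s, g5, τ (g j), by omega, by rw [join_le this]; exact g6.symm⟩

/-- A spine inside `T` which meets the seven neighbours `s` of `x` in their order. -/
structure Rail {V : Type} (G : SimpleGraph V) (x : V) (s : Fin 7 → V) (T : ℕ → V) (l : ℕ)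
    (q : ℕ → V) (N : ℕ) (k : Fin 7 → ℕ) : Prop where
  spine : Spine G x q N
  zero : q 0 = s 0
  last : q N = s 6
  mem : ∀ t, 0 < t → t < N → ∃ t' ≤ l, q t = T t'
  key : ∀ p, 0 < p → p < 6 → 0 < k p ∧ k p + 1 < N ∧
    ∀ t ≤ N, (G.Adj (s p) (q t) ↔ t = k p ∨ t = k p + 1)
  gap : ∀ p p', 0 < p → p < p' → p' < 6 → k p + 1 < k p'

section
variable {V : Type} {G : SimpleGraph V} {x : V} {s : Fin 7 → V} {T T' q q' : ℕ → V}
  {l l' N N' : ℕ} {k k' : Fin 7 → ℕ}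

theorem Leg.single {v : V} (h : G.Adj x v) : Leg G x (fun _ => v) 0 := by
  refine ⟨⟨fun i hi j hj _ => by omega, fun i hi j hj => ?_⟩, fun i hi => ⟨h.ne, ?_⟩⟩
  · exact ⟨fun h => absurd h (G.loopless.irrefl v), fun h => by omega⟩
  · exact ⟨fun _ => by omega, fun _ => h⟩

/-- Two non-adjacent neighbours of `x` have no common neighbour far from `x`. -/
theorem no_common (hC : MemC G) {a b u : V} (ha : G.Adj x a) (hb : G.Adj x b) (hab : a ≠ b)
    (nab : ¬ G.Adj a b) (hxu : x ≠ u) (nxu : ¬ G.Adj x u) (hau : G.Adj a u) (hbu : G.Adj b u) :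
    False :=
  no_C4 hC ha hau hbu.symm hb.symm nxu nab hxu hab

theorem exists_interval (hC : MemC G) (hs : ∀ p, G.Adj x (s p))
    (hss : ∀ p p', p ≠ p' → s p ≠ s p' ∧ ¬ G.Adj (s p) (s p'))
    (hxT : ∀ t ≤ l, x ≠ T t ∧ ¬ G.Adj x (T t)) (hsT : ∀ p, ∃ t ≤ l, G.Adj (s p) (T t)) :
    ∃ lo hi a b, lo < hi ∧ hi ≤ l ∧ a ≠ b ∧ (∀ p, ∃ t, lo ≤ t ∧ t ≤ hi ∧ G.Adj (s p) (T t)) ∧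
      (∀ t, lo ≤ t → t ≤ hi → (G.Adj (s a) (T t) ↔ t = lo)) ∧
      ∀ t, lo ≤ t → t ≤ hi → (G.Adj (s b) (T t) ↔ t = hi) := by
  obtain ⟨hi, hhi, hP, hmin⟩ := exists_first
    (P := fun h => ∀ p, ∃ t ≤ h, G.Adj (s p) (T t)) hsT
  obtain ⟨lo, hlo, -, hQ, hmax⟩ := exists_last
    (P := fun h => ∀ p, ∃ t, h ≤ t ∧ t ≤ hi ∧ G.Adj (s p) (T t)) (Nat.zero_le hi)
    (fun p => by obtain ⟨t, ht, h⟩ := hP p; exact ⟨t, Nat.zero_le _, ht, h⟩)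
  have hlt : lo < hi := by
    refine lt_of_le_of_ne hlo ?_
    rintro rfl
    obtain ⟨t, h1, h2, h3⟩ := hQ 0
    obtain ⟨t', h1', h2', h3'⟩ := hQ 1
    obtain rfl : t = lo := by omega
    obtain rfl : t' = t := by omega
    have := hss 0 1 (by decide)
    exact no_common hC (hs 0) (hs 1) this.1 this.2 (hxT t' hhi).1 (hxT t' hhi).2 h3 h3'
  have h1 := hmin (hi - 1) (by omega)
  have h2 := hmax (lo + 1) (by omega) (by omega)
  push Not at h1 h2
  obtain ⟨b, hb⟩ := h1
  obtain ⟨a, ha⟩ := h2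
  have ha' : ∀ t, lo ≤ t → t ≤ hi → (G.Adj (s a) (T t) ↔ t = lo) := by
    have key : ∀ t, lo ≤ t → t ≤ hi → G.Adj (s a) (T t) → t = lo := by
      intro t h1 h2 h
      by_contra hne
      exact ha t (by omega) h2 h
    intro t h1 h2
    refine ⟨key t h1 h2, ?_⟩
    rintro rfl
    obtain ⟨t', h3, h4, h5⟩ := hQ a
    have := key t' h3 h4 h5
    rwa [this] at h5
  have hb' : ∀ t, lo ≤ t → t ≤ hi → (G.Adj (s b) (T t) ↔ t = hi) := by
    have key : ∀ t, lo ≤ t → t ≤ hi → G.Adj (s b) (T t) → t = hi := by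
      intro t h1 h2 h
      by_contra hne
      exact hb t (by omega) h
    intro t h1 h2
    refine ⟨key t h1 h2, ?_⟩
    rintro rfl
    obtain ⟨t', h3, h4, h5⟩ := hQ b
    have := key t' h3 h4 h5
    rwa [this] at h5
  refine ⟨lo, hi, a, b, hlt, hhi, ?_, hQ, ha', hb'⟩
  rintro rfl
  have := (ha' lo le_rfl hlt.le).2 rfl
  have := (hb' lo le_rfl hlt.le).1 this
  omega

theorem exists_rail [Finite V] (hC : MemC G) (hs : ∀ p, G.Adj x (s p))
    (hss : ∀ p p', p ≠ p' → s p ≠ s p' ∧ ¬ G.Adj (s p) (s p'))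
    (hub : ∀ p, ¬ IsHub G (s p)) (hT : IP G T l)
    (hxT : ∀ t ≤ l, x ≠ T t ∧ ¬ G.Adj x (T t)) (hsT : ∀ p, ∃ t ≤ l, G.Adj (s p) (T t)) :
    ∃ σ : Fin 7 → Fin 7, Function.Injective σ ∧ ∃ q N k, Rail G x (s ∘ σ) T l q N k := by
  obtain ⟨lo, hi, a, b, hlt, hhi, hab, hQ, ha, hb⟩ := exists_interval hC hs hss hxT hsT
  have hne : ∀ p, ∀ t ≤ l, s p ≠ T t := by
    rintro p t ht e
    exact (hxT t ht).2 (e ▸ hs p)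
  obtain ⟨N, hN⟩ : ∃ N, N = hi - lo + 2 := ⟨_, rfl⟩
  obtain ⟨q, hq⟩ : ∃ q : ℕ → V, q = fun t => if t = 0 then s a else if t = N then s b
    else T (lo + t - 1) := ⟨_, rfl⟩
  have q0 : q 0 = s a := by simp [hq]
  have qN : q N = s b := by simp [hq, show N ≠ 0 by omega]
  have qt : ∀ t, 0 < t → t < N → q t = T (lo + t - 1) := by
    intro t h1 h2
    simp [hq, h1.ne', h2.ne]
  have hcase : ∀ t ≤ N, t = 0 ∧ q t = s a ∨ t = N ∧ q t = s b ∨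
      0 < t ∧ t < N ∧ q t = T (lo + t - 1) := by
    intro t ht
    rcases Nat.eq_zero_or_pos t with rfl | h1
    · exact Or.inl ⟨rfl, q0⟩
    · rcases Nat.eq_or_lt_of_le ht with rfl | h2
      · exact Or.inr (Or.inl ⟨rfl, qN⟩)
      · exact Or.inr (Or.inr ⟨h1, h2, qt t h1 h2⟩)
  have hsp : Spine G x q N := by
    refine ⟨⟨fun i hi' j hj e => ?_, fun i hi' j hj => ?_⟩, fun t ht => ?_⟩
    · rcases hcase i hi' with ⟨h1, e1⟩ | ⟨h1, e1⟩ | ⟨h1, h2, e1⟩ <;>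
      rcases hcase j hj with ⟨h3, e3⟩ | ⟨h3, e3⟩ | ⟨h3, h4, e3⟩ <;> rw [e1, e3] at e
      · omega
      · exact absurd e (hss a b hab).1
      · exact absurd e (hne a _ (by omega))
      · exact absurd e.symm (hss a b hab).1
      · omega
      · exact absurd e (hne b _ (by omega))
      · exact absurd e.symm (hne a _ (by omega))
      · exact absurd e.symm (hne b _ (by omega))
      · have := hT.1 _ (by omega) _ (by omega) e
        omega
    · have nab := (hss a b hab).2
      rcases hcase i hi' with ⟨h1, e1⟩ | ⟨h1, e1⟩ | ⟨h1, h2, e1⟩ <;>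
      rcases hcase j hj with ⟨h3, e3⟩ | ⟨h3, e3⟩ | ⟨h3, h4, e3⟩ <;> rw [e1, e3]
      · exact ⟨fun h => absurd h (G.loopless.irrefl _), fun h => by omega⟩
      · exact ⟨fun h => absurd h nab, fun h => by omega⟩
      · rw [ha _ (by omega) (by omega)]; omega
      · exact ⟨fun h => absurd h.symm nab, fun h => by omega⟩
      · exact ⟨fun h => absurd h (G.loopless.irrefl _), fun h => by omega⟩
      · rw [hb _ (by omega) (by omega)]; omega
      · rw [G.adj_comm, ha _ (by omega) (by omega)]; omega
      · rw [G.adj_comm, hb _ (by omega) (by omega)]; omega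
      · rw [hT.2 _ (by omega) _ (by omega)]; omega
    · rcases hcase t ht with ⟨h1, e1⟩ | ⟨h1, e1⟩ | ⟨h1, h2, e1⟩ <;> rw [e1]
      · exact ⟨(hs a).ne, fun _ => Or.inl h1, fun _ => hs a⟩
      · exact ⟨(hs b).ne, fun _ => Or.inr h1, fun _ => hs b⟩
      · have := hxT (lo + t - 1) (by omega)
        exact ⟨this.1, fun h => absurd h this.2, fun h => by omega⟩
  have key : ∀ p, ∃ k, p ≠ a → p ≠ b → 0 < k ∧ k + 1 < N ∧
      ∀ t ≤ N, (G.Adj (s p) (q t) ↔ t = k ∨ t = k + 1) := by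
    intro p
    by_cases hp : p ≠ a ∧ p ≠ b
    · obtain ⟨t, h1, h2, h3⟩ := hQ p
      have hd : ∀ t ≤ N, q t ≠ s p := by
        intro t ht
        rcases hcase t ht with ⟨h1, e1⟩ | ⟨h1, e1⟩ | ⟨h1, h2, e1⟩ <;> rw [e1]
        · exact (hss p a hp.1).1.symm
        · exact (hss p b hp.2).1.symm
        · exact (hne p _ (by omega)).symm
      obtain ⟨k, hk⟩ := hsp.attach (δ := fun _ => s p) (r := 0) hC (Leg.single (hs p))
        (fun t ht v hv => ⟨hd t ht, fun h => by omega⟩) ⟨t + 1 - lo, by omega, by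
          rw [qt _ (by omega) (by omega)]
          rwa [show lo + (t + 1 - lo) - 1 = t by omega]⟩
        (by rw [q0]; exact (hss p a hp.1).2) (by rw [qN]; exact (hss p b hp.2).2)
        (fun _ => hub p)
      exact ⟨k, fun _ _ => hk⟩
    · exact ⟨0, fun h1 h2 => absurd ⟨h1, h2⟩ hp⟩
  choose k hk using key
  obtain ⟨K, hK⟩ : ∃ K : Fin 7 → ℕ, K = fun p => if p = a then 0 else if p = b then N else k p :=
    ⟨_, rfl⟩
  have Ka : K a = 0 := by simp [hK]
  have Kb : K b = N := by simp [hK, hab.symm]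
  have Kk : ∀ p, p ≠ a → p ≠ b → K p = k p := fun p h1 h2 => by simp [hK, h1, h2]
  have hcom : ∀ p p', p ≠ p' → ∀ t, 0 < t → t < N → G.Adj (s p) (q t) → ¬ G.Adj (s p') (q t) := by
    intro p p' hp t h1 h2 h3 h4
    have h5 := hsp.2 t h2.le
    exact no_common hC (hs p) (hs p') (hss p p' hp).1 (hss p p' hp).2 h5.1
      (fun h => by have := h5.2.1 h; omega) h3 h4
  have hKN : ∀ p, K p ≤ N ∧ (K p = 0 → p = a) ∧ (K p = N → p = b) := by
    intro p
    by_cases h1 : p = a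
    · subst h1
      rw [Ka]
      exact ⟨by omega, fun _ => rfl, fun h => by omega⟩
    by_cases h2 : p = b
    · subst h2
      rw [Kb]
      exact ⟨by omega, fun h => by omega, fun _ => rfl⟩
    have := hk p h1 h2
    rw [Kk p h1 h2]
    exact ⟨by omega, fun h => by omega, fun h => by omega⟩
  have hKinj : Function.Injective K := by
    intro p p' e
    by_contra hpp
    by_cases h1 : p = a
    · subst h1
      exact hpp ((hKN p').2.1 (by rw [← e, Ka])).symm
    by_cases h2 : p = b
    · subst h2
      exact hpp ((hKN p').2.2 (by rw [← e, Kb])).symm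
    by_cases h1' : p' = a
    · subst h1'
      exact h1 ((hKN p).2.1 (by rw [e, Ka]))
    by_cases h2' : p' = b
    · subst h2'
      exact h2 ((hKN p).2.2 (by rw [e, Kb]))
    rw [Kk p h1 h2, Kk p' h1' h2'] at e
    obtain ⟨g1, g2, g3⟩ := hk p h1 h2
    obtain ⟨g1', g2', g3'⟩ := hk p' h1' h2'
    exact hcom p p' hpp (k p) g1 (by omega) ((g3 _ (by omega)).2 (Or.inl rfl))
      ((g3' _ (by omega)).2 (Or.inl e))
  have hmono : StrictMono (K ∘ Tuple.sort K) :=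
    (Tuple.monotone_sort K).strictMono_of_injective (hKinj.comp (Tuple.sort K).injective)
  generalize hσ : Tuple.sort K = σ at hmono
  have hσ0 : σ 0 = a := by
    refine (hKN _).2.1 ?_
    have := hmono.monotone (Fin.zero_le (σ.symm a))
    simp only [Function.comp, Equiv.apply_symm_apply, Ka] at this
    omega
  have hσ6 : σ 6 = b := by
    refine (hKN _).2.2 ?_
    have := hmono.monotone (Fin.le_last (σ.symm b))
    simp only [Function.comp, Equiv.apply_symm_apply, Kb] at this
    have h := (hKN (σ 6)).1
    exact le_antisymm h this
  have hmid : ∀ p, 0 < p → p < 6 → σ p ≠ a ∧ σ p ≠ b := by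
    intro p h1 h2
    rw [← hσ0, ← hσ6]
    exact ⟨fun e => h1.ne' (σ.injective e), fun e => h2.ne (σ.injective e)⟩
  refine ⟨σ, σ.injective, q, N, k ∘ σ, hsp, ?_, ?_, fun t h1 h2 => ⟨_, ?_, qt t h1 h2⟩, ?_, ?_⟩
  · rw [q0, Function.comp, hσ0]
  · rw [qN, Function.comp, hσ6]
  · omega
  · intro p h1 h2
    exact hk _ (hmid p h1 h2).1 (hmid p h1 h2).2
  · intro p p' h1 h2 h3
    have hp := hmid p h1 (h2.trans h3)
    have hp' := hmid p' (h1.trans h2) h3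
    have h4 := hmono h2
    simp only [Function.comp, Kk _ hp.1 hp.2, Kk _ hp'.1 hp'.2] at h4 ⊢
    obtain ⟨g1, g2, g3⟩ := hk _ hp.1 hp.2
    obtain ⟨g1', g2', g3'⟩ := hk _ hp'.1 hp'.2
    refine lt_of_le_of_ne h4 fun e => ?_
    exact hcom (σ p) (σ p') (fun e => h2.ne (σ.injective e)) (k (σ p) + 1) (by omega) g2
      ((g3 _ (by omega)).2 (Or.inr rfl)) ((g3' _ (by omega)).2 (Or.inl e))

theorem Rail.touch_between (hC : MemC G) (hs : ∀ p, G.Adj x (s p))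
    (hss : ∀ p p', p ≠ p' → s p ≠ s p' ∧ ¬ G.Adj (s p) (s p')) (h : Rail G x s T l q N k)
    (h' : Rail G x s T' l' q' N' k') (hTT : ∀ t ≤ l, ∀ t' ≤ l', T t ≠ T' t') {p p' : Fin 7}
    (hp : 0 < p) (hpp : p < p') (hp' : p' < 6) :
    ∃ t t', k p + 1 ≤ t ∧ t ≤ k p' ∧ k' p + 1 ≤ t' ∧ t' ≤ k' p' ∧ G.Adj (q' t') (q t) := by
  by_contra hc
  push Not at hc
  obtain ⟨g1, g2, g3⟩ := h.key p hp (hpp.trans hp')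
  obtain ⟨g4, g5, g6⟩ := h.key p' (hp.trans hpp) hp'
  obtain ⟨g1', g2', g3'⟩ := h'.key p hp (hpp.trans hp')
  obtain ⟨g4', g5', g6'⟩ := h'.key p' (hp.trans hpp) hp'
  have g7 := h.gap p p' hp hpp hp'
  have g7' := h'.gap p p' hp hpp hp'
  have hx : ∀ {q : ℕ → V} {N : ℕ}, Spine G x q N → ∀ t, 0 < t → t < N →
      x ≠ q t ∧ ¬ G.Adj x (q t) := fun hq t h1 h2 =>
    ⟨(hq.2 t h2.le).1, fun h => by have := (hq.2 t h2.le).2.1 h; omega⟩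
  refine no_theta hC (hss p p' hpp.ne).1 (hss p p' hpp.ne).2 (Cn.singleton x)
    (h.spine.1.cn (i := k p + 1) (j := k p' + 1) (by omega))
    (h'.spine.1.cn (i := k' p + 1) (j := k' p' + 1) (by omega))
    ⟨x, rfl, (hs p).symm⟩ ⟨x, rfl, (hs p').symm⟩
    ⟨_, mem_sg le_rfl (by omega), (g3 _ (by omega)).2 (Or.inr rfl)⟩
    ⟨_, mem_sg (show k p + 1 ≤ k p' by omega) (by omega), (g6 _ (by omega)).2 (Or.inl rfl)⟩
    ⟨_, mem_sg le_rfl (by omega), (g3' _ (by omega)).2 (Or.inr rfl)⟩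
    ⟨_, mem_sg (show k' p + 1 ≤ k' p' by omega) (by omega), (g6' _ (by omega)).2 (Or.inl rfl)⟩
    ?_ ?_ ?_
  · rintro _ rfl _ ⟨t, h1, h2, rfl⟩
    exact hx h.spine t (by omega) (by omega)
  · rintro _ rfl _ ⟨t, h1, h2, rfl⟩
    exact hx h'.spine t (by omega) (by omega)
  · rintro _ ⟨t, h1, h2, rfl⟩ _ ⟨t', h1', h2', rfl⟩
    refine ⟨?_, fun e => hc t t' h1 (by omega) h1' (by omega) e.symm⟩
    obtain ⟨u, hu, e⟩ := h.mem t (by omega) (by omega)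
    obtain ⟨u', hu', e'⟩ := h'.mem t' (by omega) (by omega)
    rw [e, e']
    exact hTT u hu u' hu'

theorem Rail.touch (hC : MemC G) (hs : ∀ p, G.Adj x (s p))
    (hss : ∀ p p', p ≠ p' → s p ≠ s p' ∧ ¬ G.Adj (s p) (s p')) (h : Rail G x s T l q N k)
    (h' : Rail G x s T' l' q' N' k') (hTT : ∀ t ≤ l, ∀ t' ≤ l', T t ≠ T' t') :
    G.Adj (q (k 3)) (q' (k' 3)) ∨ G.Adj (q (k 3 + 1)) (q' (k' 3 + 1)) ∨
      G.Adj (q (k 3)) (q' (k' 3 + 1)) ∨ G.Adj (q (k 3 + 1)) (q' (k' 3)) := by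
  have hqs : ∀ t ≤ N, ∀ p, 0 < p → p < 6 → q t ≠ s p := by
    intro t ht p h1 h2 e
    have h4 := (h.spine.2 t ht).2
    rw [e] at h4
    rcases h4.1 (hs p) with rfl | rfl
    · rw [h.zero] at e; exact (hss 0 p h1.ne).1 e
    · rw [h.last] at e; exact (hss 6 p h2.ne').1 e
  have hxq' : ∀ t, 0 < t → t < N' → x ≠ q' t ∧ ¬ G.Adj x (q' t) := fun t h1 h2 =>
    ⟨(h'.spine.2 t h2.le).1, fun e => by have := (h'.spine.2 t h2.le).2.1 e; omega⟩
  have hqq : ∀ t, 0 < t → t < N' → ∀ i ≤ N, q' t ≠ q i := by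
    intro t h1 h2 i hi e
    obtain ⟨t', ht', e'⟩ := h'.mem t h1 h2
    by_cases hi' : 0 < i ∧ i < N
    · obtain ⟨i', hi1, e1⟩ := h.mem i hi'.1 hi'.2
      exact hTT i' hi1 t' ht' (by rw [← e1, ← e', e])
    · have := (h.spine.2 i hi).2.2 (by omega)
      rw [← e] at this
      exact (hxq' t h1 h2).2 this
  obtain ⟨g1, g2, g3⟩ := h.key 3 (by decide) (by decide)
  obtain ⟨g1', g2', g3'⟩ := h'.key 3 (by decide) (by decide)
  obtain ⟨f1, f2, f3⟩ := h.key 1 (by decide) (by decide)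
  obtain ⟨f1', f2', f3'⟩ := h'.key 1 (by decide) (by decide)
  obtain ⟨e1, e2, e3⟩ := h.key 5 (by decide) (by decide)
  obtain ⟨e1', e2', e3'⟩ := h'.key 5 (by decide) (by decide)
  have gaps := And.intro (h.gap 1 2 (by decide) (by decide) (by decide)) <|
    And.intro (h.gap 2 3 (by decide) (by decide) (by decide)) <|
    And.intro (h.gap 3 4 (by decide) (by decide) (by decide))
      (h.gap 4 5 (by decide) (by decide) (by decide))
  have gaps' := And.intro (h'.gap 1 2 (by decide) (by decide) (by decide)) <|
    And.intro (h'.gap 2 3 (by decide) (by decide) (by decide)) <|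
    And.intro (h'.gap 3 4 (by decide) (by decide) (by decide))
      (h'.gap 4 5 (by decide) (by decide) (by decide))
  have hP := h.spine.pyr (δ := fun _ => s 3) (r := 0) (Leg.single (hs 3))
    (fun t ht v hv => ⟨hqs t ht 3 (by decide) (by decide), fun h => by omega⟩) g1 g2 g3
  obtain ⟨i, i', a1, a2, a3, a4, a5⟩ := h.touch_between hC hs hss h' hTT (p := 1) (p' := 2)
    (by decide) (by decide) (by decide)
  obtain ⟨j, j', b1, b2, b3, b4, b5⟩ := h.touch_between hC hs hss h' hTT (p := 4) (p' := 5)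
    (by decide) (by decide) (by decide)
  have hZ := h'.spine.1.cn (i := k' 1 + 1) (j := k' 5 + 1) (by omega)
  have hu := mem_sg (f := q') (show k' 1 + 1 ≤ i' by omega) (show i' < k' 5 + 1 by omega)
  obtain ⟨f, L, hf, hfZ, hf0, hfL, hfU, hfW⟩ := min_cross
    (U := fun u => ∃ i < k 3, G.Adj u (q i))
    (W := fun u => ∃ i < N - k 3 - 1, G.Adj u (q (N - i))) hu ⟨i, by omega, a5⟩
    ⟨N - j, by omega, by rwa [show N - (N - j) = j by omega]⟩
    (hZ _ hu _ (mem_sg (show k' 1 + 1 ≤ j' by omega) (show j' < k' 5 + 1 by omega)))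
  have hfq : ∀ t ≤ L, ∃ t', 1 < t' ∧ t' + 1 < N' ∧ f t = q' t' := by
    intro t ht
    obtain ⟨t', h1, h2, e⟩ := hfZ t ht
    exact ⟨t', by omega, by omega, e.symm⟩
  have hf3 : ∀ t ≤ L, G.Adj (s 3) (f t) → f t = q' (k' 3) ∨ f t = q' (k' 3 + 1) := by
    intro t ht hadj
    obtain ⟨t', h1, h2, e⟩ := hfq t ht
    rw [e] at hadj ⊢
    rcases (g3' t' (by omega)).1 hadj with rfl | rfl
    · exact Or.inl rfl
    · exact Or.inr rfl
  have hX : Cross G x q (k 3) (fun t => q (N - t)) (N - k 3 - 1) (fun _ => s 3) 0 f L := by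
    refine ⟨hP, hf, ?_, ?_, ?_, ?_, ?_, ?_, fun t _ v hv => by omega, hf0,
      fun t ht i hi e => hfU t ht ⟨i, hi, e⟩, hfL, fun t ht i hi e => hfW t ht ⟨i, hi, e⟩, ?_⟩
    · intro t ht
      obtain ⟨t', h1, h2, e⟩ := hfq t ht
      rw [e]
      exact hxq' t' (by omega) (by omega)
    · intro t ht i hi
      obtain ⟨t', h1, h2, e⟩ := hfq t ht
      rw [e]
      exact hqq t' (by omega) (by omega) i (by omega)
    · intro t ht i hi
      obtain ⟨t', h1, h2, e⟩ := hfq t ht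
      rw [e]
      exact hqq t' (by omega) (by omega) _ (by omega)
    · intro t ht i hi e'
      obtain ⟨t', h1, h2, e⟩ := hfq t ht
      have := (hxq' t' (by omega) (by omega)).2
      rw [← e, e'] at this
      exact this (hs 3)
    · intro t ht
      obtain ⟨t', h1, h2, e⟩ := hfq t ht
      rw [e, h.zero, ← h'.zero, h'.spine.1.2 _ (by omega) _ (by omega)]
      omega
    · intro t ht
      obtain ⟨t', h1, h2, e⟩ := hfq t ht
      rw [e, Nat.sub_zero, h.last, ← h'.last, h'.spine.1.2 _ (by omega) _ (by omega)]
      omega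
    · intro _ i hi j hj h1 h2
      have hadj := (h'.spine.1.2 (k' 3) (by omega) (k' 3 + 1) (by omega)).2 (Or.inr rfl)
      rcases hf3 i hi h1 with e1 | e1 <;> rcases hf3 j hj h2 with e2 | e2
      · have := hf.1 i hi j hj (e1.trans e2.symm); omega
      · rw [← e1, ← e2, hf.2 i hi j hj] at hadj; omega
      · rw [← e1, ← e2, hf.2 j hj i hi] at hadj; omega
      · have := hf.1 i hi j hj (e1.trans e2.symm); omega
  obtain ⟨v, hv, hadj, hor⟩ := hX.edge hC
  have h1 := hf3 v (by omega) ((hadj v (by omega)).2 (Or.inl rfl)).symm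
  have h2 := hf3 (v + 1) (by omega) ((hadj (v + 1) (by omega)).2 (Or.inr rfl)).symm
  rcases hor with h3 | h3
  · rcases h2 with e | e <;> rw [e] at h3
    · exact Or.inl h3.symm
    · exact Or.inr (Or.inr (Or.inl h3.symm))
  · rw [show N - (N - k 3 - 1) = k 3 + 1 by omega] at h3
    rcases h1 with e | e <;> rw [e] at h3
    · exact Or.inr (Or.inr (Or.inr h3.symm))
    · exact Or.inr (Or.inl h3.symm)

end

/-- Only boundedly many disjoint paths meet seven given non-hub neighbours of `x`. -/
theorem exists_seven_bound (t : ℕ) : ∃ K, ∀ {V : Type} [Finite V] {G : SimpleGraph V},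
    MemCt t G → ∀ {x : V} {s : Fin 7 → V} {T : ℕ → ℕ → V} {l : ℕ → ℕ}, (∀ p, G.Adj x (s p)) →
    (∀ p p', p ≠ p' → s p ≠ s p' ∧ ¬ G.Adj (s p) (s p')) → (∀ p, ¬ IsHub G (s p)) →
    (∀ j < K, IP G (T j) (l j)) → (∀ j < K, ∀ t ≤ l j, x ≠ T j t ∧ ¬ G.Adj x (T j t)) →
    (∀ j < K, ∀ p, ∃ t ≤ l j, G.Adj (s p) (T j t)) →
    (∀ i < K, ∀ j < K, i ≠ j → ∀ t ≤ l i, ∀ t' ≤ l j, T i t ≠ T j t') → False := by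
  obtain ⟨L, hL⟩ := exists_ladder_bound t
  obtain ⟨K, hK⟩ := exists_pigeonhole (Fin 7 → Fin 7) L
  refine ⟨K, fun {V} _ {G} hG x s T l hs hss hub hT hxT hsT hTT => ?_⟩
  have key : ∀ j, ∃ (σ : Fin 7 → Fin 7) (q : ℕ → V) (N : ℕ) (k : Fin 7 → ℕ), j < K →
      Function.Injective σ ∧ Rail G x (s ∘ σ) (T j) (l j) q N k := by
    intro j
    by_cases hj : j < K
    · obtain ⟨σ, h1, q, N, k, h2⟩ :=
        exists_rail hG.1 hs hss hub (hT j hj) (hxT j hj) (hsT j hj)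
      exact ⟨σ, q, N, k, fun _ => ⟨h1, h2⟩⟩
    · exact ⟨id, fun _ => x, 0, fun _ => 0, fun h => absurd h hj⟩
  choose σ q N k hR using key
  obtain ⟨e, c, he, hlt⟩ := hK σ
  have hR' : ∀ a < L, Function.Injective c ∧
      Rail G x (s ∘ c) (T (e a)) (l (e a)) (q (e a)) (N (e a)) (k (e a)) := by
    intro a ha
    have := hR (e a) (he a ha).1
    rwa [(he a ha).2] at this
  have hne : ∀ i < L, ∀ j < L, i ≠ j → e i ≠ e j := by
    intro i hi j hj hij
    rcases Nat.lt_or_gt_of_ne hij with h | h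
    · exact (hlt i j h hj).ne
    · exact (hlt j i h hi).ne'
  have hmem : ∀ a < L, ∀ t, k (e a) 3 ≤ t → t ≤ k (e a) 3 + 1 →
      ∃ t' ≤ l (e a), q (e a) t = T (e a) t' := by
    intro a ha t h1 h2
    have h3 := (hR' a ha).2.key 3 (by decide) (by decide)
    exact (hR' a ha).2.mem t (by omega) (by omega)
  have hdis : ∀ i < L, ∀ j < L, i ≠ j → ∀ t, k (e i) 3 ≤ t → t ≤ k (e i) 3 + 1 →
      ∀ t', k (e j) 3 ≤ t' → t' ≤ k (e j) 3 + 1 → q (e i) t ≠ q (e j) t' := by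
    intro i hi j hj hij t h1 h2 t' h3 h4
    obtain ⟨u, hu, e1⟩ := hmem i hi t h1 h2
    obtain ⟨u', hu', e2⟩ := hmem j hj t' h3 h4
    rw [e1, e2]
    exact hTT _ (he i hi).1 _ (he j hj).1 (hne i hi j hj hij) u hu u' hu'
  refine hL hG (fun a => q (e a) (k (e a) 3)) (fun a => q (e a) (k (e a) 3 + 1))
    (fun a ha => ?_) (fun i hi j hj hij => ⟨?_, ?_⟩) (fun i j hij hj => ?_)
  · have h3 := (hR' a ha).2.key 3 (by decide) (by decide)
    exact ((hR' a ha).2.spine.1.2 _ (by omega) _ (by omega)).2 (Or.inr rfl)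
  · exact hdis i hi j hj hij _ le_rfl (by omega) _ le_rfl (by omega)
  · exact hdis i hi j hj hij _ (by omega) le_rfl _ (by omega) le_rfl
  · have hi := hR' i (by omega)
    exact hi.2.touch hG.1 (fun p => hs _) (fun p p' h => hss _ _ (fun e => h (hi.1 e)))
      (hR' j hj).2 (hTT _ (he i (by omega)).1 _ (he j hj).1 (hlt i j hij hj).ne)

theorem exists_leg {V : Type} {G : SimpleGraph V} {x y : V} {n : ℕ} {f : Fin n → V}
    (hf : IsPathFromTo G n f x y) (hxy : x ≠ y) (nxy : ¬ G.Adj x y) :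
    ∃ (P : ℕ → V) (d : ℕ), Leg G x P d ∧ (∀ t ≤ d, y ≠ P t ∧ (G.Adj y (P t) ↔ t = d)) ∧
      ∀ t ≤ d, P t ∈ pathInterior n f := by
  obtain ⟨⟨hinj, hadj⟩, hn, h0, hl⟩ := hf
  have h3 : 3 ≤ n := by
    by_contra hc
    have : n = 1 ∨ n = 2 := by omega
    rcases this with rfl | rfl
    · exact hxy (h0.symm.trans hl)
    · have := (hadj ⟨0, hn⟩ ⟨1, by omega⟩).2 (Or.inr rfl)
      rw [h0] at this
      exact nxy (hl ▸ this)
  obtain ⟨P, hP⟩ : ∃ P : ℕ → V, ∀ (t : ℕ) (h : t + 1 < n), P t = f ⟨t + 1, h⟩ :=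
    ⟨fun t => if h : t + 1 < n then f ⟨t + 1, h⟩ else x, fun t h => dif_pos h⟩
  refine ⟨P, n - 3, ⟨⟨?_, ?_⟩, ?_⟩, ?_, ?_⟩
  · intro i hi j hj e
    rw [hP i (by omega), hP j (by omega)] at e
    have := congrArg Fin.val (hinj e)
    simpa using this
  · intro i hi j hj
    rw [hP i (by omega), hP j (by omega), hadj]
    simp only
    omega
  · intro t ht
    rw [hP t (by omega), ← h0]
    refine ⟨fun e => ?_, ?_⟩
    · have := congrArg Fin.val (hinj e)
      simp at this
    · rw [hadj]
      simp only
      omega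
  · intro t ht
    rw [hP t (by omega), ← hl]
    refine ⟨fun e => ?_, ?_⟩
    · have := congrArg Fin.val (hinj e)
      simp only at this
      omega
    · rw [hadj]
      simp only
      omega
  · intro t ht
    rw [hP t (by omega)]
    exact ⟨_, Nat.succ_pos t, by simp only; omega, rfl⟩

/-- There are boundedly many disjoint legs from a vertex without hub neighbours to `y`. -/
theorem exists_legs_bound (t : ℕ) : ∃ K, ∀ {V : Type} [Finite V] {G : SimpleGraph V},
    MemCt t G → ∀ {x y : V} {P : ℕ → ℕ → V} {d : ℕ → ℕ}, x ≠ y → ¬ G.Adj x y →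
    (∀ v, G.Adj x v → ¬ IsHub G v) → (∀ j < K, Leg G x (P j) (d j)) →
    (∀ j < K, ∀ t ≤ d j, y ≠ P j t ∧ (G.Adj y (P j t) ↔ t = d j)) →
    (∀ i < K, ∀ j < K, i ≠ j → ∀ s ≤ d i, ∀ t ≤ d j, P i s ≠ P j t) → False := by
  obtain ⟨A, hA⟩ := exists_seven_bound t
  obtain ⟨B, hB⟩ := exists_touching_bound t
  obtain ⟨K, hK⟩ := exists_ramsey 4 (t + 3 + (A + 7) + B)
  refine ⟨K, fun {V} _ {G} hG x y P d hxy nxy hub hP hy hd => ?_⟩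
  have seven : ∀ (g : Fin 7 → ℕ) (h : ℕ → ℕ), (∀ p, g p < K) → (∀ a < A, h a < K) →
      (∀ p p', p ≠ p' → g p ≠ g p') → (∀ a < A, ∀ b < A, a ≠ b → h a ≠ h b) →
      (∀ p p', p < p' → ¬ G.Adj (P (g p) 0) (P (g p') 0)) →
      (∀ p, ∀ a < A, ∃ t ≤ d (h a), 0 < t ∧ G.Adj (P (g p) 0) (P (h a) t)) → False := by
    intro g h hg hh hgg hhh hstable hmeet
    have hs : ∀ p, G.Adj x (P (g p) 0) :=
      fun p => ((hP _ (hg p)).2 0 (Nat.zero_le _)).2.2 rfl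
    have hpos : ∀ a < A, 0 < d (h a) := by
      intro a ha
      obtain ⟨t, h1, h2, -⟩ := hmeet 0 a ha
      omega
    refine hA hG (x := x) (s := fun p => P (g p) 0) (T := fun a t => P (h a) (1 + t))
      (l := fun a => d (h a) - 1) hs ?_ (fun p => hub _ (hs p)) ?_ ?_ ?_ ?_
    · intro p p' hpp
      refine ⟨hd _ (hg p) _ (hg p') (hgg p p' hpp) 0 (Nat.zero_le _) 0 (Nat.zero_le _), ?_⟩
      rcases lt_or_gt_of_ne hpp with h | h
      · exact hstable p p' h
      · exact fun e => hstable p' p h e.symm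
    · intro a ha
      have := hpos a ha
      exact (hP _ (hh a ha)).1.shift (by omega)
    · intro a ha t ht
      have h1 := hpos a ha
      have h2 := (hP _ (hh a ha)).2 (1 + t) (by omega)
      exact ⟨h2.1, fun e => by have := h2.2.1 e; omega⟩
    · intro a ha p
      obtain ⟨t, h1, h2, h3⟩ := hmeet p a ha
      exact ⟨t - 1, by omega, by rwa [show 1 + (t - 1) = t by omega]⟩
    · intro a ha b hb hab t ht t' ht'
      have h1 := hpos a ha
      have h2 := hpos b hb
      exact hd _ (hh a ha) _ (hh b hb) (hhh a ha b hb hab) _ (by omega) _ (by omega)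
  obtain ⟨e, c, he, hec⟩ := hK ![fun i j => G.Adj (P i 0) (P j 0),
    fun i j => ∀ s ≤ d i, ∀ t ≤ d j, ¬ G.Adj (P i s) (P j t),
    fun i j => ¬ G.Adj (P i 0) (P j 0) ∧ ∃ t ≤ d j, G.Adj (P i 0) (P j t),
    fun i j => ¬ G.Adj (P i 0) (P j 0) ∧ ∃ t ≤ d i, G.Adj (P j 0) (P i t),
    fun i j => (∀ t ≤ d j, ¬ G.Adj (P i 0) (P j t)) ∧ (∀ t ≤ d i, ¬ G.Adj (P j 0) (P i t)) ∧
      ∃ s ≤ d i, ∃ t ≤ d j, G.Adj (P i s) (P j t)] (by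
      intro i j _ _
      by_cases h0 : G.Adj (P i 0) (P j 0)
      · exact ⟨0, h0⟩
      by_cases h1 : ∀ s ≤ d i, ∀ t ≤ d j, ¬ G.Adj (P i s) (P j t)
      · exact ⟨1, h1⟩
      by_cases h2 : ∃ t ≤ d j, G.Adj (P i 0) (P j t)
      · exact ⟨2, h0, h2⟩
      by_cases h3 : ∃ t ≤ d i, G.Adj (P j 0) (P i t)
      · exact ⟨3, h0, h3⟩
      push Not at h1 h2 h3
      exact ⟨4, h2, h3, h1⟩)
  obtain ⟨M, hM⟩ : ∃ M, M = t + 3 + (A + 7) + B := ⟨_, rfl⟩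
  rw [← hM] at he hec
  have hne : ∀ a < M, ∀ b < M, a ≠ b → e a ≠ e b := by
    intro a ha b hb hab
    rcases Nat.lt_or_gt_of_ne hab with h | h
    · exact (hec a b h hb).1.ne
    · exact (hec b a h ha).1.ne'
  fin_cases c
  · exact no_clique hG.2 (f := fun a => P (e a) 0) fun i j h1 h2 => (hec i j h1 (by omega)).2
  · have hc : ∀ a b, a < b → b < M → ∀ s ≤ d (e a), ∀ t ≤ d (e b),
        ¬ G.Adj (P (e a) s) (P (e b) t) := fun a b h1 h2 => (hec a b h1 h2).2
    have hx : ∀ a < M, ∃ u ∈ sg (P (e a)) 0 (d (e a) + 1), G.Adj x u := fun a ha =>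
      ⟨_, mem_sg le_rfl (Nat.succ_pos _), ((hP _ (he a ha)).2 0 (Nat.zero_le _)).2.2 rfl⟩
    have hy' : ∀ a < M, ∃ u ∈ sg (P (e a)) 0 (d (e a) + 1), G.Adj y u := fun a ha =>
      ⟨_, mem_sg (Nat.zero_le _) (Nat.lt_succ_self _), (hy _ (he a ha) _ le_rfl).2.2 rfl⟩
    have hcn : ∀ a < M, Cn G (sg (P (e a)) 0 (d (e a) + 1)) :=
      fun a ha => (hP _ (he a ha)).1.cn le_rfl
    have hanti : ∀ a b, a < b → b < M →
        Anti G (sg (P (e a)) 0 (d (e a) + 1)) (sg (P (e b)) 0 (d (e b) + 1)) := fun a b h1 h2 =>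
      anti_sg fun s t _ hs _ ht => ⟨hd _ (he a (by omega)) _ (he b h2)
        (hne a (by omega) b h2 h1.ne) s (by omega) t (by omega),
        hc a b h1 h2 s (by omega) t (by omega)⟩
    exact no_theta hG.1 hxy nxy (hcn 0 (by omega)) (hcn 1 (by omega)) (hcn 2 (by omega))
      (hx 0 (by omega)) (hy' 0 (by omega)) (hx 1 (by omega)) (hy' 1 (by omega))
      (hx 2 (by omega)) (hy' 2 (by omega)) (hanti 0 1 (by omega) (by omega))
      (hanti 0 2 (by omega) (by omega)) (hanti 1 2 (by omega) (by omega))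
  · have hc : ∀ a b, a < b → b < M → ¬ G.Adj (P (e a) 0) (P (e b) 0) ∧
        ∃ t ≤ d (e b), G.Adj (P (e a) 0) (P (e b) t) := fun a b h1 h2 => (hec a b h1 h2).2
    refine seven (fun p => e p) (fun a => e (7 + a)) (fun p => he _ (by omega))
      (fun a ha => he _ (by omega)) (fun p p' h => hne _ (by omega) _ (by omega) (by omega))
      (fun a ha b hb h => hne _ (by omega) _ (by omega) (by omega))
      (fun p p' h => (hc _ _ h (by omega)).1) fun p a ha => ?_
    obtain ⟨h1, t, h2, h3⟩ := hc p (7 + a) (by omega) (by omega)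
    refine ⟨t, h2, Nat.pos_of_ne_zero ?_, h3⟩
    rintro rfl
    exact h1 h3
  · have hc : ∀ a b, a < b → b < M → ¬ G.Adj (P (e a) 0) (P (e b) 0) ∧
        ∃ t ≤ d (e a), G.Adj (P (e b) 0) (P (e a) t) := fun a b h1 h2 => (hec a b h1 h2).2
    refine seven (fun p => e (A + p)) (fun a => e a) (fun p => he _ (by omega))
      (fun a ha => he _ (by omega)) (fun p p' h => hne _ (by omega) _ (by omega) (by omega))
      (fun a ha b hb h => hne _ (by omega) _ (by omega) h)
      (fun p p' h => (hc _ _ (by omega) (by omega)).1) fun p a ha => ?_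
    obtain ⟨h1, t, h2, h3⟩ := hc a (A + p) (by omega) (by omega)
    refine ⟨t, h2, Nat.pos_of_ne_zero ?_, h3⟩
    rintro rfl
    exact h1 h3.symm
  · have hc : ∀ a b, a < b → b < M → (∀ t ≤ d (e b), ¬ G.Adj (P (e a) 0) (P (e b) t)) ∧
        (∀ t ≤ d (e a), ¬ G.Adj (P (e b) 0) (P (e a) t)) ∧
        ∃ s ≤ d (e a), ∃ t ≤ d (e b), G.Adj (P (e a) s) (P (e b) t) :=
      fun a b h1 h2 => (hec a b h1 h2).2
    have hc' : ∀ a < M, ∀ b < M, a ≠ b → (∀ t ≤ d (e b), ¬ G.Adj (P (e a) 0) (P (e b) t)) ∧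
        ∃ s ≤ d (e a), ∃ t ≤ d (e b), G.Adj (P (e a) s) (P (e b) t) := by
      intro a ha b hb hab
      rcases Nat.lt_or_gt_of_ne hab with h | h
      · exact ⟨(hc a b h hb).1, (hc a b h hb).2.2⟩
      · obtain ⟨h1, h2, s, hs, t, ht, h3⟩ := hc b a h ha
        exact ⟨h2, t, ht, s, hs, h3.symm⟩
    refine hB hG (x := x) (P := fun a => P (e a)) (d := fun a => d (e a))
      ⟨fun j hj => hP _ (he j (by omega)), fun j hj => ?_,
        fun i hi j hj hij => hd _ (he i (by omega)) _ (he j (by omega))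
          (hne i (by omega) j (by omega) hij),
        fun i hi j hj hij => (hc' i (by omega) j (by omega) hij).1⟩
      (fun i hi j hj hij => (hc' i (by omega) j (by omega) hij).2)
    obtain ⟨h1, s, hs, t, ht, h2⟩ := hc' j (by omega) (j + 1) (by omega) (by omega)
    refine Nat.pos_of_ne_zero fun h0 => ?_
    obtain rfl : s = 0 := by omega
    exact h1 t ht h2

end HubPaths

/-- for every `t ≥ 1` there is `k = k(t)` such that in a graph of `𝒞ₜ`, two
distinct non-adjacent vertices `x, y` with `N(x) ∩ Hub(G) = ∅` are not joined by `k` pairwise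
internally vertex-disjoint induced paths. -/
theorem stmt_6 (t : ℕ) (ht : 1 ≤ t) :
    ∃ k : ℕ, ∀ (V : Type) [Fintype V] (G : SimpleGraph V) (x y : V),
      MemCt t G → x ≠ y → ¬ G.Adj x y →
      (∀ v : V, G.Adj x v → ¬ IsHub G v) →
      ¬ KDisjointPaths G k x y := by
  obtain ⟨K, hK⟩ := HubPaths.exists_legs_bound t
  refine ⟨K, fun V _ G x y hG hxy nxy hub ⟨n, f, hf, hd⟩ => ?_⟩
  have key : ∀ i, ∃ (P : ℕ → V) (d : ℕ), ∀ h : i < K, HubPaths.Leg G x P d ∧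
      (∀ t ≤ d, y ≠ P t ∧ (G.Adj y (P t) ↔ t = d)) ∧
      ∀ t ≤ d, P t ∈ pathInterior (n ⟨i, h⟩) (f ⟨i, h⟩) := by
    intro i
    by_cases h : i < K
    · obtain ⟨P, d, h'⟩ := HubPaths.exists_leg (hf ⟨i, h⟩) hxy nxy
      exact ⟨P, d, fun _ => h'⟩
    · exact ⟨fun _ => x, 0, fun h' => absurd h' h⟩
  choose P d hP using key
  refine hK hG hxy nxy hub (fun j hj => (hP j hj).1) (fun j hj => (hP j hj).2.1)
    fun i hi j hj hij s hs t ht e => ?_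
  have hne : (⟨i, hi⟩ : Fin K) ≠ ⟨j, hj⟩ := fun e => hij (congrArg Fin.val e)
  have h1 := (hP i hi).2.2 s hs
  have h2 := (hP j hj).2.2 t ht
  rw [← e] at h2
  exact Set.disjoint_left.1 (hd _ _ hne) h1 h2
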